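/- Let Ω ⊂ ℝ^N (N ≥ 2) be a smooth bounded open set and let m ≥ 1, n ≥ 1 and 2 ≤ q ≤ min{n,N} be integers. Then there is a constant C, depending only on q, r, m, n, N and Ω, such that for every integer 1 ≤ r ≤ q, every β ∈ I(r,n), every 𝛂 = (α^1,…,α^m) with α^j ∈ I(r,N), all u, v ∈ C^m(Ω̄, ℝ^n) and all ψ ∈ C_c^m(Ω): | ∫_Ω M^β_𝛂(D^m u) ψ dx − ∫_Ω M^β_𝛂(D^m v) ψ dx | ≤ C ‖u−v‖_{W^{m−m/q,q}(Ω)} ( ‖u‖^{r−1}_{W^{m−m/q,q}(Ω)} + ‖v‖^{r−1}_{W^{m−m/q,q}(Ω)} ) ‖D^m ψ‖_{L^∞(Ω)}, where ‖D^m ψ‖_{L^∞} is the supremum over Ω of the absolute values of all m-th order partial derivatives of ψ. -/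

import Mathlib

open MeasureTheory Filter Topology Real

noncomputable section

abbrev Euc (N : ℕ) := EuclideanSpace ℝ (Fin N)

/-- The (full signed) determinant of an `m`-dimensional matrix of order `N^m`:
`det A = ∑_{τ_2,…,τ_m ∈ S_N} (∏_{s=2}^m sgn τ_s) ∏_{k=1}^N a_{k τ_2(k) ⋯ τ_m(k)}`. -/
def hyperDet {N : ℕ} : {m : ℕ} → ((Fin m → Fin N) → ℝ) → ℝ
  | 0, A => A finZeroElim
  | m + 1, A =>
      ∑ τ : Fin m → Equiv.Perm (Fin N),
        (∏ s, ((Equiv.Perm.sign (τ s) : ℤ) : ℝ)) *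
          ∏ k : Fin N, A (Fin.cons k fun s => τ s k)

/-- classical partial derivative `∂_i f`. -/
def pderiv' {N : ℕ} (i : Fin N) (f : Euc N → ℝ) : Euc N → ℝ :=
  fun x => fderiv ℝ f x (EuclideanSpace.single i 1)

/-- iterated partial derivative `∂_{l_1} ∂_{l_2} ⋯ f`. -/
def pderivList {N : ℕ} : List (Fin N) → (Euc N → ℝ) → Euc N → ℝ
  | [], f => f
  | i :: l, f => pderiv' i (pderivList l f)

/-- the `m`th-Jacobian `(β,α)`-minor `M^β_α(D^m u)` of `u : Ω → ℝ^n`, i.e. the hyper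
determinant of the `(m+1)`-dimensional matrix of order `r^{m+1}` with entries
`∂_{α^1_{l_1}} ⋯ ∂_{α^m_{l_m}} u^{β_{l_0}}`. -/
def jacMinor {N n : ℕ} (m r : ℕ) (β : Fin r → Fin n) (α : Fin m → Fin r → Fin N)
    (u : Euc N → Fin n → ℝ) (x : Euc N) : ℝ :=
  hyperDet (m := m + 1) fun l : Fin (m + 1) → Fin r =>
    pderivList (List.ofFn fun s : Fin m => α s (l s.succ)) (fun y => u y (β (l 0))) x

/-- the `m`th-Jacobian `α`-minor `M_α(D^m v)` of a scalar function `v`. -/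
def scalMinor {N : ℕ} (m r : ℕ) (α : Fin m → Fin r → Fin N)
    (v : Euc N → ℝ) (x : Euc N) : ℝ :=
  hyperDet (m := m) fun l : Fin m → Fin r =>
    pderivList (List.ofFn fun s : Fin m => α s (l s)) v x

/-- the integer Sobolev norm `‖u‖_{W^{k,p}(Ω)} = ∑_{j ≤ k} ‖D^j u‖_{L^p(Ω)}`. -/
def intSobNorm {N : ℕ} {F : Type*} [NormedAddCommGroup F] [NormedSpace ℝ F]
    (Ω : Set (Euc N)) (k : ℕ) (p : ℝ) (u : Euc N → F) : ℝ :=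
  ∑ j ∈ Finset.range (k + 1), (∫ x in Ω, ‖iteratedFDeriv ℝ j u x‖ ^ p) ^ (1 / p)

open Classical in
/-- the (possibly fractional) Sobolev norm `‖u‖_{W^{s,p}(Ω)}`: for integer `s` the usual
Sobolev norm, for non-integer `s` the `W^{[s],p}` norm plus the Gagliardo seminorm of
`D^{[s]} u` with fractional exponent `s - [s]`. -/
def sobNorm {N : ℕ} {F : Type*} [NormedAddCommGroup F] [NormedSpace ℝ F]
    (Ω : Set (Euc N)) (s p : ℝ) (u : Euc N → F) : ℝ :=
  if ∃ k : ℕ, s = k then intSobNorm Ω ⌊s⌋₊ p u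
  else
    intSobNorm Ω ⌊s⌋₊ p u +
      (∫ x in Ω, ∫ y in Ω,
          ‖iteratedFDeriv ℝ ⌊s⌋₊ u x - iteratedFDeriv ℝ ⌊s⌋₊ u y‖ ^ p /
            ‖x - y‖ ^ ((N : ℝ) + (s - ⌊s⌋₊) * p)) ^ (1 / p)

/-- `‖D^m ψ‖_{L^∞}`, the sup of the `m`-th derivatives of `ψ`. -/
def supDm {N : ℕ} (m : ℕ) (ψ : Euc N → ℝ) : ℝ := ⨆ x, ‖iteratedFDeriv ℝ m ψ x‖

/-- `ψ ∈ C_c^∞(Ω)`. -/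
def IsCinfc {N : ℕ} (Ω : Set (Euc N)) (ψ : Euc N → ℝ) : Prop :=
  ContDiff ℝ (⊤ : ℕ∞) ψ ∧ HasCompactSupport ψ ∧ tsupport ψ ⊆ Ω

/-- `Ω` is a smooth bounded open subset of `ℝ^N`. -/
def IsSmoothDomain {N : ℕ} (Ω : Set (Euc N)) : Prop :=
  IsOpen Ω ∧ Bornology.IsBounded Ω ∧
    ∃ f : Euc N → ℝ, ContDiff ℝ (⊤ : ℕ∞) f ∧ Ω = {x | f x < 0} ∧
      ∀ x ∈ frontier Ω, fderiv ℝ f x ≠ 0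

/-! ### Commuting constant-coefficient differential operators -/

section Operators

variable {V : Type*} [NormedAddCommGroup V] [NormedSpace ℝ V]

/-- The space of smooth real functions on `V`. -/
def smoothFun (V : Type*) [NormedAddCommGroup V] [NormedSpace ℝ V] : Submodule ℝ (V → ℝ) where
  carrier := {f | ContDiff ℝ (⊤ : ℕ∞) f}
  add_mem' {f g} hf hg := by
    have hf : ContDiff ℝ (⊤ : ℕ∞) f := hf
    exact hf.add hg
  zero_mem' := (contDiff_const : ContDiff ℝ (⊤ : ℕ∞) fun _ : V => (0 : ℝ))
  smul_mem' c f hf := by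
    have hf : ContDiff ℝ (⊤ : ℕ∞) f := hf
    exact contDiff_const.smul hf

theorem smoothFun_contDiff (g : smoothFun V) : ContDiff ℝ (⊤ : ℕ∞) (g : V → ℝ) := g.2

theorem smoothFun_differentiable (g : smoothFun V) : Differentiable ℝ (g : V → ℝ) :=
  (smoothFun_contDiff g).differentiable (by simp)

theorem ContDiff.fderiv_apply_smooth {f : V → ℝ} (hf : ContDiff ℝ (⊤ : ℕ∞) f) (v : V) :
    ContDiff ℝ (⊤ : ℕ∞) fun y => fderiv ℝ f y v :=
  (hf.fderiv_right (m := (⊤ : ℕ∞)) (by simp)).clm_apply contDiff_const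

/-- Differentiation in direction `v`, as an endomorphism of the smooth functions. -/
def dirEnd (v : V) : Module.End ℝ (smoothFun V) where
  toFun f := ⟨fun y => fderiv ℝ (f : V → ℝ) y v, (smoothFun_contDiff f).fderiv_apply_smooth v⟩
  map_add' f g := by
    ext y
    simp [fderiv_add (smoothFun_differentiable f y) (smoothFun_differentiable g y)]
  map_smul' c f := by
    ext y
    simp [fderiv_const_smul (smoothFun_differentiable f y) c]

theorem dirEnd_comm (v w : V) : dirEnd v * dirEnd w = dirEnd w * dirEnd v := by
  ext f y
  have hs : IsSymmSndFDerivAt ℝ (f : V → ℝ) y :=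
    ((smoothFun_contDiff f).contDiffAt).isSymmSndFDerivAt (by
      simp only [minSmoothness_of_isRCLikeNormedField]
      exact WithTop.coe_le_coe.2 (le_top : (2 : ℕ∞) ≤ ⊤))
  have hd : DifferentiableAt ℝ (fderiv ℝ (f : V → ℝ)) y :=
    (((smoothFun_contDiff f).fderiv_right (m := (⊤ : ℕ∞)) (by simp)).differentiable (by simp)) y
  have key : ∀ a b : V, fderiv ℝ (fun z => fderiv ℝ (f : V → ℝ) z a) y b
      = fderiv ℝ (fderiv ℝ (f : V → ℝ)) y b a := by
    intro a b
    rw [fderiv_clm_apply hd (differentiableAt_const a)]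
    simp
  change fderiv ℝ (fun z => fderiv ℝ (f : V → ℝ) z w) y v
    = fderiv ℝ (fun z => fderiv ℝ (f : V → ℝ) z v) y w
  rw [key, key]
  exact hs v w

/-- The algebra of constant-coefficient differential operators. -/
def opAlg (V : Type*) [NormedAddCommGroup V] [NormedSpace ℝ V] :
    Subalgebra ℝ (Module.End ℝ (smoothFun V)) :=
  Algebra.adjoin ℝ (Set.range (dirEnd (V := V)))

/-- The algebra generated by pairwise commuting elements is a commutative ring. -/
abbrev adjoinCommRing {A : Type*} [Ring A] [Algebra ℝ A] {s : Set A}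
    (h : ∀ a ∈ s, ∀ b ∈ s, a * b = b * a) : CommRing (Algebra.adjoin ℝ s) :=
  { Subalgebra.toRing (Algebra.adjoin ℝ s) with
    mul_comm := (Algebra.isMulCommutative_adjoin ℝ h).is_comm.comm }

/-- The commutative ring of constant-coefficient differential operators. -/
def OpRing (V : Type*) [NormedAddCommGroup V] [NormedSpace ℝ V] : Type _ := opAlg V

instance : CommRing (OpRing V) :=
  adjoinCommRing (s := Set.range (dirEnd (V := V))) (by
    rintro _ ⟨v, rfl⟩ _ ⟨w, rfl⟩
    exact dirEnd_comm v w)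

instance : Algebra ℝ (OpRing V) :=
  Subalgebra.algebra (Algebra.adjoin ℝ (Set.range (dirEnd (V := V))))

/-- Differentiation in direction `v`, as an element of the operator algebra. -/
def dirOp (v : V) : OpRing V := ⟨dirEnd v, Algebra.subset_adjoin ⟨v, rfl⟩⟩

/-- The action of an operator on a smooth function. -/
def opApp (b : OpRing V) (g : smoothFun V) : smoothFun V := (show opAlg V from b).1 g

theorem opApp_mul (b c : OpRing V) (g : smoothFun V) : opApp (b * c) g = opApp b (opApp c g) := rfl

theorem opApp_one (g : smoothFun V) : opApp 1 g = g := rfl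

theorem opApp_add (b c : OpRing V) (g : smoothFun V) :
    opApp (b + c) g = opApp b g + opApp c g := rfl

theorem opApp_zero (g : smoothFun V) : opApp 0 g = 0 := rfl

theorem opApp_smul (t : ℝ) (b : OpRing V) (g : smoothFun V) : opApp (t • b) g = t • opApp b g := rfl

theorem opApp_sum {κ : Type*} (s : Finset κ) (b : κ → OpRing V) (g : smoothFun V) :
    opApp (∑ i ∈ s, b i) g = ∑ i ∈ s, opApp (b i) g := by
  classical
  induction s using Finset.induction_on with
  | empty => simp [opApp_zero]
  | insert a s ha ih => rw [Finset.sum_insert ha, Finset.sum_insert ha, opApp_add, ih]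

theorem dirOp_apply (v : V) (g : smoothFun V) (y : V) :
    (opApp (dirOp v) g : V → ℝ) y = fderiv ℝ (g : V → ℝ) y v := rfl

theorem dirOp_add (v w : V) : dirOp (v + w) = dirOp v + dirOp w := by
  apply Subtype.ext
  ext f y
  change fderiv ℝ (f : V → ℝ) y (v + w) = fderiv ℝ (f : V → ℝ) y v + fderiv ℝ (f : V → ℝ) y w
  simp

theorem dirOp_zero : dirOp (0 : V) = 0 := by
  apply Subtype.ext
  ext f y
  change fderiv ℝ (f : V → ℝ) y 0 = 0
  simp

theorem dirOp_sum {κ : Type*} (s : Finset κ) (v : κ → V) :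
    dirOp (∑ i ∈ s, v i) = ∑ i ∈ s, dirOp (v i) := by
  classical
  induction s using Finset.induction_on with
  | empty => simp [dirOp_zero]
  | insert a s ha ih => rw [Finset.sum_insert ha, Finset.sum_insert ha, dirOp_add, ih]

/-- Operators do not enlarge the support. -/
theorem opApp_eq_zero_of_isOpen {U : Set V} (hU : IsOpen U) (b : OpRing V) (g : smoothFun V)
    (hg : ∀ y ∈ U, (g : V → ℝ) y = 0) : ∀ y ∈ U, (opApp b g : V → ℝ) y = 0 := by
  obtain ⟨b, hb⟩ := b
  change ∀ y ∈ U, (b g : V → ℝ) y = 0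
  induction hb using Algebra.adjoin_induction generalizing g with
  | mem x hx =>
    obtain ⟨v, rfl⟩ := hx
    intro y hy
    change fderiv ℝ (g : V → ℝ) y v = 0
    have : (g : V → ℝ) =ᶠ[𝓝 y] fun _ => 0 := by
      filter_upwards [hU.mem_nhds hy] with z hz using hg z hz
    rw [this.fderiv_eq]
    simp
  | algebraMap t =>
    intro y hy
    change t • (g : V → ℝ) y = 0
    simp [hg y hy]
  | add x y _ _ hx hy =>
    intro z hz
    change (x g : V → ℝ) z + (y g : V → ℝ) z = 0
    rw [hx g hg z hz, hy g hg z hz, add_zero]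
  | mul x y _ _ hx hy => exact hx (y g) (hy g hg)

/-- Iterated directional derivative; the head of the list is the outermost derivative. -/
def dirList : List V → (V → ℝ) → V → ℝ
  | [], f => f
  | a :: l, f => fun x => fderiv ℝ (dirList l f) x a

theorem pderivList_eq_dirList {N : ℕ} (l : List (Fin N)) (f : Euc N → ℝ) :
    pderivList l f = dirList (l.map fun i => EuclideanSpace.single i 1) f := by
  induction l with
  | nil => rfl
  | cons i l ih => simp only [pderivList, List.map_cons, dirList, ih]; rfl

/-- `dirList` on smooth functions. -/
def dirListS (l : List V) (g : smoothFun V) : smoothFun V := opApp (l.map dirOp).prod g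

theorem coe_dirListS (l : List V) (g : smoothFun V) :
    (dirListS l g : V → ℝ) = dirList l (g : V → ℝ) := by
  induction l with
  | nil => rfl
  | cons a l ih =>
    funext y
    simp only [dirListS, List.map_cons, List.prod_cons, opApp_mul, dirOp_apply, dirList]
    rw [← ih]
    rfl

end Operators

/-! ### Determinants modulo an ideal -/

theorem Matrix.det_eq_sum_mul_det_submatrix {R : Type*} [CommRing R] {n : ℕ}
    (A : Matrix (Fin (n + 1)) (Fin (n + 1)) R) (h : ∀ c : Fin n, ∑ k, A k c.succ = 0) :
    A.det = (∑ k, A k 0) * (A.submatrix Fin.succ Fin.succ).det := by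
  have h1 := Matrix.det_updateRow_sum A 0 (fun _ => (1 : R))
  simp only [one_smul] at h1
  rw [← h1, Matrix.det_succ_row_zero, Fin.sum_univ_succ]
  have h2 : (A.updateRow 0 (∑ k, A k)).submatrix Fin.succ (Fin.succAbove 0)
      = A.submatrix Fin.succ Fin.succ := by
    ext i j
    simp
  have h3 : ∀ c, (∑ x, A x) c = ∑ x, A x c := fun c => Finset.sum_apply c _ _
  simp only [Matrix.updateRow_self, h3, h, mul_zero, zero_mul, Finset.sum_const_zero,
    add_zero, h2]
  simp

theorem Matrix.det_sub_mem {R : Type*} [CommRing R] (I : Ideal R) {n : ℕ}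
    (A : Matrix (Fin (n + 1)) (Fin (n + 1)) R) (h : ∀ c : Fin n, ∑ k, A k c.succ ∈ I) :
    Ideal.Quotient.mk I A.det =
      Ideal.Quotient.mk I ((∑ k, A k 0) * (A.submatrix Fin.succ Fin.succ).det) := by
  have := Matrix.det_eq_sum_mul_det_submatrix (A.map (Ideal.Quotient.mk I)) (by
    intro c
    have := Ideal.Quotient.eq_zero_iff_mem.2 (h c)
    rw [map_sum] at this
    exact this)
  rw [map_mul, RingHom.map_det, RingHom.map_det, map_sum]
  exact this

/-! ### Operators on tensor products of functions -/

section Tensor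

variable {E : Type*} [NormedAddCommGroup E] [NormedSpace ℝ E] {ι : Type*} [Fintype ι]

/-- The tensor product `y ↦ ∏ i, G i (y i)`. -/
def tens (G : ι → smoothFun E) : smoothFun (ι → E) :=
  ⟨fun y => ∏ i, (G i : E → ℝ) (y i), by
    change ContDiff ℝ (⊤ : ℕ∞) _
    exact contDiff_prod fun i _ => (smoothFun_contDiff (G i)).comp (contDiff_apply ℝ E i)⟩

theorem tens_apply (G : ι → smoothFun E) (y : ι → E) :
    (tens G : (ι → E) → ℝ) y = ∏ i, (G i : E → ℝ) (y i) := rfl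

variable [DecidableEq ι]

theorem opApp_dirOp_tens (k : ι) (a : E) (G : ι → smoothFun E) :
    opApp (dirOp (Pi.single k a)) (tens G) =
      tens (Function.update G k (opApp (dirOp a) (G k))) := by
  apply Subtype.ext
  funext y
  rw [dirOp_apply, tens_apply]
  have h : ∀ i, HasFDerivAt (fun y : ι → E => (G i : E → ℝ) (y i))
      ((fderiv ℝ (G i : E → ℝ) (y i)).comp (ContinuousLinearMap.proj (R := ℝ) (φ := fun _ : ι => E) i)) y :=
    fun i => HasFDerivAt.comp y (smoothFun_differentiable (G i) (y i)).hasFDerivAt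
      (hasFDerivAt_apply i y)
  have h2 : HasFDerivAt (tens G : (ι → E) → ℝ) _ y :=
    HasFDerivAt.finsetProd (u := Finset.univ) fun i _ => h i
  rw [h2.fderiv]
  simp only [_root_.sum_apply, _root_.smul_apply,
    ContinuousLinearMap.comp_apply, ContinuousLinearMap.proj_apply, smul_eq_mul]
  rw [Finset.sum_eq_single k]
  · rw [← Finset.mul_prod_erase _ _ (Finset.mem_univ k), Function.update_self, dirOp_apply,
      Pi.single_eq_same, mul_comm]
    congr 1
    refine Finset.prod_congr rfl fun i hi => ?_
    rw [Function.update_of_ne (Finset.ne_of_mem_erase hi)]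
  · intro i _ hi
    rw [Pi.single_eq_of_ne hi]
    simp
  · simp

/-- The differential operator acting by the word `l` on the `k`-th variable. -/
def slotOp (k : ι) (l : List E) : OpRing (ι → E) := (l.map fun a => dirOp (Pi.single k a)).prod

theorem slotOp_nil (k : ι) : slotOp k ([] : List E) = 1 := rfl

theorem slotOp_singleton (k : ι) (a : E) : slotOp k [a] = dirOp (Pi.single k a) := by
  simp [slotOp]

theorem slotOp_flatten (k : ι) (L : List (List E)) :
    slotOp k L.flatten = (L.map (slotOp k)).prod := by
  induction L with
  | nil => rfl
  | cons a L ih => simp [slotOp] at ih ⊢; rw [ih]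

theorem opApp_slotOp_tens (k : ι) (l : List E) (G : ι → smoothFun E) :
    opApp (slotOp k l) (tens G) = tens (Function.update G k (dirListS l (G k))) := by
  induction l with
  | nil => simp [slotOp, dirListS, opApp_one]
  | cons a l ih =>
    have : slotOp k (a :: l) = dirOp (Pi.single k a) * slotOp k l := by simp [slotOp]
    rw [this, opApp_mul, ih, opApp_dirOp_tens]
    congr 1
    simp [dirListS, opApp_mul]

theorem opApp_prod_slotOp_tens (l : ι → List E) (S : Finset ι) (G : ι → smoothFun E) :
    opApp (∏ i ∈ S, slotOp i (l i)) (tens G) =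
      tens fun i => if i ∈ S then dirListS (l i) (G i) else G i := by
  induction S using Finset.induction_on with
  | empty => simp [opApp_one]
  | insert a S ha ih =>
    rw [Finset.prod_insert ha, opApp_mul, ih, opApp_slotOp_tens]
    congr 1
    funext i
    by_cases h : i = a
    · subst h; simp [ha]
    · simp [h]

theorem opApp_prod_univ_slotOp_tens (l : ι → List E) (G : ι → smoothFun E) :
    opApp (∏ i, slotOp i (l i)) (tens G) = tens fun i => dirListS (l i) (G i) := by
  rw [opApp_prod_slotOp_tens]
  simp

/-- A product of determinants of slot operators, applied to a tensor product. -/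
theorem opApp_prod_det_tens {m : ℕ} (γ : Fin m → ι → ι → ℝ) (L : Fin m → ι → ι → List E)
    (G : ι → smoothFun E) :
    opApp (∏ j, (Matrix.of fun k c => γ j k c • slotOp k (L j k c)).det) (tens G) =
      ∑ σ : Fin m → Equiv.Perm ι,
        ((∏ j, ((Equiv.Perm.sign (σ j) : ℤ) : ℝ)) * ∏ j, ∏ k, γ j k (σ j k)) •
          tens fun k => dirListS (List.ofFn fun j => L j k (σ j k)).flatten (G k) := by
  have h1 : ∀ j, (Matrix.of fun k c => γ j k c • slotOp k (L j k c)).det =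
      ∑ σ : Equiv.Perm ι, (((Equiv.Perm.sign σ : ℤ) : ℝ) * ∏ k, γ j k (σ k)) •
        ∏ k, slotOp k (L j k (σ k)) := by
    intro j
    rw [← Matrix.det_transpose, Matrix.det_apply]
    refine Finset.sum_congr rfl fun σ _ => ?_
    simp only [Matrix.transpose_apply, Matrix.of_apply]
    rw [Finset.prod_smul, mul_smul, Units.smul_def]
    rw [zsmul_eq_mul, Algebra.smul_def ((_ : ℤ) : ℝ), map_intCast]
  simp only [h1]
  rw [Finset.prod_univ_sum, Fintype.piFinset_univ, opApp_sum]
  refine Finset.sum_congr rfl fun σ _ => ?_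
  rw [Finset.prod_smul, opApp_smul, Finset.prod_mul_distrib, ← opApp_prod_univ_slotOp_tens]
  congr 2
  rw [Finset.prod_comm]
  refine Finset.prod_congr rfl fun k _ => ?_
  rw [slotOp_flatten, List.map_ofFn, List.prod_ofFn]
  rfl

end Tensor

section Identity

variable {E : Type*} [NormedAddCommGroup E] [NormedSpace ℝ E] {r m : ℕ}

theorem sum_dirOp_single (a : E) :
    ∑ k : Fin (r + 1), dirOp (Pi.single k a) = dirOp (fun _ : Fin (r + 1) => a) := by
  rw [← dirOp_sum]
  congr 1
  funext i
  simp [Finset.sum_apply, Pi.single_apply]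

theorem fderiv_diag (g : smoothFun (Fin (r + 1) → E)) (a p : E) :
    fderiv ℝ (fun q : E => (g : (Fin (r + 1) → E) → ℝ) fun _ => q) p a =
      (opApp (dirOp fun _ => a) g : (Fin (r + 1) → E) → ℝ) fun _ => p := by
  have h1 : HasFDerivAt (fun q : E => fun _ : Fin (r + 1) => q)
      (ContinuousLinearMap.pi fun _ => ContinuousLinearMap.id ℝ E) p :=
    hasFDerivAt_pi.2 fun _ => hasFDerivAt_id p
  have h2 := HasFDerivAt.comp p (smoothFun_differentiable g fun _ => p).hasFDerivAt h1
  have h3 : fderiv ℝ (fun q : E => (g : (Fin (r + 1) → E) → ℝ) fun _ => q) p = _ := h2.fderiv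
  rw [h3, dirOp_apply]
  rfl

theorem contDiff_diag (g : smoothFun (Fin (r + 1) → E)) :
    ContDiff ℝ (⊤ : ℕ∞) fun q : E => (g : (Fin (r + 1) → E) → ℝ) fun _ => q :=
  (smoothFun_contDiff g).comp (contDiff_pi.2 fun _ => contDiff_id)

theorem hasCompactSupport_diag (b : OpRing (Fin (r + 1) → E)) (G : Fin (r + 1) → smoothFun E)
    (hG : HasCompactSupport (G 0 : E → ℝ)) :
    HasCompactSupport fun q : E => (opApp b (tens G) : (Fin (r + 1) → E) → ℝ) fun _ => q := by
  refine HasCompactSupport.intro hG fun p hp => ?_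
  have hU : IsOpen {y : Fin (r + 1) → E | y 0 ∉ tsupport (G 0 : E → ℝ)} :=
    ((isClosed_tsupport _).preimage (continuous_apply 0)).isOpen_compl
  refine opApp_eq_zero_of_isOpen hU b _ ?_ _ hp
  intro y hy
  rw [tens_apply, Fin.prod_univ_succ, image_eq_zero_of_notMem_tsupport hy, zero_mul]

/-- The matrix of operators with free first column and remaining columns `∂_{a c}`. -/
def colMatrix (C : Fin (r + 1) → OpRing (Fin (r + 1) → E)) (a : Fin r → E) :
    Matrix (Fin (r + 1)) (Fin (r + 1)) (OpRing (Fin (r + 1) → E)) :=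
  Matrix.of fun k => Fin.cons (C k) fun c => slotOp k [a c]

/-- A functional which annihilates all derivatives `∂_{a j c}` cannot distinguish the determinants
with general first columns from the product of the column sums with the reduced determinants. -/
theorem functional_prod_det (Λ : (E → ℝ) → ℝ) (a : Fin m → Fin r → E)
    (hadd : ∀ g h : E → ℝ, ContDiff ℝ (⊤ : ℕ∞) g → HasCompactSupport g →
      ContDiff ℝ (⊤ : ℕ∞) h → HasCompactSupport h → Λ (fun p => g p + h p) = Λ g + Λ h)
    (hkill : ∀ g : E → ℝ, ContDiff ℝ (⊤ : ℕ∞) g → HasCompactSupport g → ∀ j c,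
      Λ (fun p => fderiv ℝ g p (a j c)) = 0)
    (C : Fin m → Fin (r + 1) → OpRing (Fin (r + 1) → E)) (G : Fin (r + 1) → smoothFun E)
    (hG : HasCompactSupport (G 0 : E → ℝ)) :
    Λ (fun p => (opApp (∏ j, (colMatrix (C j) (a j)).det) (tens G) : (Fin (r + 1) → E) → ℝ)
        fun _ => p) =
      Λ (fun p => (opApp ((∏ j, ∑ k, C j k) *
          ∏ j, ((colMatrix (C j) (a j)).submatrix Fin.succ Fin.succ).det) (tens G) :
            (Fin (r + 1) → E) → ℝ) fun _ => p) := by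
  set D : Fin m → Fin r → OpRing (Fin (r + 1) → E) := fun j c => dirOp fun _ => a j c
  set I : Ideal (OpRing (Fin (r + 1) → E)) := Ideal.span {b | ∃ j c, b = D j c} with hI
  have hΛ : ∀ b ∈ I, Λ (fun p => (opApp b (tens G) : (Fin (r + 1) → E) → ℝ) fun _ => p) = 0 := by
    have h0 : ∀ b, Λ (fun p => (opApp b (tens G) : (Fin (r + 1) → E) → ℝ) fun _ => p) = 0 →
        ∀ b', Λ (fun p => (opApp b' (tens G) : (Fin (r + 1) → E) → ℝ) fun _ => p) = 0 →
        Λ (fun p => (opApp (b + b') (tens G) : (Fin (r + 1) → E) → ℝ) fun _ => p) = 0 := by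
      intro b hb b' hb'
      have := hadd _ _ (contDiff_diag (opApp b (tens G))) (hasCompactSupport_diag b G hG)
        (contDiff_diag (opApp b' (tens G))) (hasCompactSupport_diag b' G hG)
      rw [hb, hb', add_zero] at this
      rw [opApp_add]
      exact this
    have h1 : ∀ j c b, Λ (fun p => (opApp (D j c * b) (tens G) : (Fin (r + 1) → E) → ℝ)
        fun _ => p) = 0 := by
      intro j c b
      have := hkill _ (contDiff_diag (opApp b (tens G))) (hasCompactSupport_diag b G hG) j c
      simp only [fderiv_diag] at this
      exact this
    have h2 : ∀ b ∈ I, ∀ b', Λ (fun p => (opApp (b * b') (tens G) : (Fin (r + 1) → E) → ℝ)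
        fun _ => p) = 0 := by
      intro b hb
      induction hb using Submodule.span_induction with
      | mem x hx =>
        obtain ⟨j, c, rfl⟩ := hx
        exact h1 j c
      | zero =>
        intro b'
        have h3 : Λ (fun _ => 0) = 0 := by
          have := hadd (fun _ => 0) (fun _ => 0) contDiff_const HasCompactSupport.zero
            contDiff_const HasCompactSupport.zero
          simp only [add_zero] at this
          linarith
        rw [zero_mul, opApp_zero]
        exact h3
      | add x y _ _ hx hy =>
        intro b'
        rw [add_mul]
        exact h0 _ (hx b') _ (hy b')
      | smul t x _ hx =>
        intro b'
        rw [smul_eq_mul, mul_comm t x, mul_assoc]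
        exact hx _
    intro b hb
    have := h2 b hb 1
    rwa [mul_one] at this
  have hmem : ∏ j, (colMatrix (C j) (a j)).det - (∏ j, ∑ k, C j k) *
      ∏ j, ((colMatrix (C j) (a j)).submatrix Fin.succ Fin.succ).det ∈ I := by
    rw [← Ideal.Quotient.eq, ← Finset.prod_mul_distrib, map_prod, map_prod]
    refine Finset.prod_congr rfl fun j _ => ?_
    rw [Matrix.det_sub_mem]
    · rfl
    · intro c
      have : ∑ k, colMatrix (C j) (a j) k c.succ = D j c := by
        simp only [colMatrix, Matrix.of_apply, Fin.cons_succ, slotOp_singleton]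
        exact sum_dirOp_single _
      rw [this]
      exact Ideal.subset_span ⟨j, c, rfl⟩
  have h4 := hΛ _ hmem
  set b1 := ∏ j, (colMatrix (C j) (a j)).det
  set b2 := (∏ j, ∑ k, C j k) * ∏ j, ((colMatrix (C j) (a j)).submatrix Fin.succ Fin.succ).det
  have h5 := hadd _ _ (contDiff_diag (opApp (b1 - b2) (tens G))) (hasCompactSupport_diag _ G hG)
        (contDiff_diag (opApp b2 (tens G))) (hasCompactSupport_diag b2 G hG)
  rw [h4, zero_add] at h5
  rw [← h5]
  congr 1
  funext p
  have : opApp b1 (tens G) = opApp (b1 - b2) (tens G) + opApp b2 (tens G) := by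
    rw [← opApp_add, sub_add_cancel]
  rw [this]
  rfl

end Identity

/-! ### The Jacobian of a family of scalar functions -/

theorem List.flatten_ofFn_singleton {α : Type*} {m : ℕ} (f : Fin m → α) :
    (List.ofFn fun j => [f j]).flatten = List.ofFn f := by
  induction m with
  | zero => simp
  | succ m ih =>
    rw [List.ofFn_succ, List.ofFn_succ, List.flatten_cons, ih fun j => f j.succ]
    rfl

section JacFam

variable {E : Type*} [NormedAddCommGroup E] [NormedSpace ℝ E] {r m : ℕ}

/-- The polarised `m`th Jacobian of a family of `r` scalar functions in the directions `a`. -/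
def jacFam (a : Fin m → Fin r → E) (f : Fin r → E → ℝ) (x : E) : ℝ :=
  ∑ τ : Fin m → Equiv.Perm (Fin r), (∏ s, ((Equiv.Perm.sign (τ s) : ℤ) : ℝ)) *
    ∏ k, dirList (List.ofFn fun s => a s (τ s k)) (f k) x

theorem opApp_prod_det_submatrix_tens (C : Fin m → Fin (r + 1) → OpRing (Fin (r + 1) → E))
    (a : Fin m → Fin r → E) (G : Fin (r + 1) → smoothFun E) :
    opApp (∏ j, ((colMatrix (C j) (a j)).submatrix Fin.succ Fin.succ).det) (tens G) =
      ∑ τ : Fin m → Equiv.Perm (Fin r), (∏ s, ((Equiv.Perm.sign (τ s) : ℤ) : ℝ)) •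
        tens fun i => dirListS ((Fin.cons [] fun k => List.ofFn fun s => a s (τ s k) :
          Fin (r + 1) → List E) i) (G i) := by
  have h1 : ∀ j, ((colMatrix (C j) (a j)).submatrix Fin.succ Fin.succ).det =
      ∑ σ : Equiv.Perm (Fin r), (((Equiv.Perm.sign σ : ℤ) : ℝ)) •
        ∏ k, slotOp (Fin.succ k) [a j (σ k)] := by
    intro j
    rw [← Matrix.det_transpose, Matrix.det_apply]
    refine Finset.sum_congr rfl fun σ _ => ?_
    simp only [Matrix.transpose_apply, Matrix.submatrix_apply, colMatrix, Matrix.of_apply,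
      Fin.cons_succ]
    rw [Units.smul_def, zsmul_eq_mul, Algebra.smul_def ((_ : ℤ) : ℝ), map_intCast]
  simp only [h1]
  rw [Finset.prod_univ_sum, Fintype.piFinset_univ, opApp_sum]
  refine Finset.sum_congr rfl fun σ _ => ?_
  rw [Finset.prod_smul, opApp_smul, ← opApp_prod_univ_slotOp_tens]
  congr 2
  rw [Finset.prod_comm, Fin.prod_univ_succ, Fin.cons_zero, slotOp_nil, one_mul]
  refine Finset.prod_congr rfl fun k _ => ?_
  rw [Fin.cons_succ]
  rw [← List.flatten_ofFn_singleton, slotOp_flatten, List.map_ofFn, List.prod_ofFn]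
  rfl

theorem opApp_prod_det_submatrix_tens_diag (C : Fin m → Fin (r + 1) → OpRing (Fin (r + 1) → E))
    (a : Fin m → Fin r → E) (G : Fin (r + 1) → smoothFun E) (p : E) :
    (opApp (∏ j, ((colMatrix (C j) (a j)).submatrix Fin.succ Fin.succ).det) (tens G) :
      (Fin (r + 1) → E) → ℝ) (fun _ => p) =
      (G 0 : E → ℝ) p * jacFam a (fun k => (G k.succ : E → ℝ)) p := by
  rw [opApp_prod_det_submatrix_tens, jacFam, Finset.mul_sum]
  rw [Submodule.coe_sum, Finset.sum_apply]
  refine Finset.sum_congr rfl fun τ _ => ?_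
  rw [Submodule.coe_smul, Pi.smul_apply, tens_apply, Fin.prod_univ_succ, smul_eq_mul]
  simp only [coe_dirListS, Fin.cons_zero, Fin.cons_succ, dirList]
  ring

theorem jacMinor_eq_jacFam {N n : ℕ} (β : Fin r → Fin n) (α : Fin m → Fin r → Fin N)
    (u : Euc N → Fin n → ℝ) (x : Euc N) :
    jacMinor m r β α u x =
      jacFam (fun s c => (EuclideanSpace.single (α s c) 1 : Euc N)) (fun k y => u y (β k)) x := by
  simp only [jacMinor, hyperDet, jacFam, Fin.cons_zero, Fin.cons_succ, pderivList_eq_dirList,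
    List.map_ofFn]
  rfl

end JacFam

/-! ### The pointwise bound when all derivatives can be distributed evenly -/

section IntegerCase

variable {E : Type*} [NormedAddCommGroup E] [NormedSpace ℝ E] {r m : ℕ}

theorem abs_opApp_prod_det_tens_le (γ : Fin m → Fin (r + 1) → Fin (r + 1) → ℝ)
    (L : Fin m → Fin (r + 1) → Fin (r + 1) → List E) (G : Fin (r + 1) → smoothFun E) (p : E) :
    |(opApp (∏ j, (Matrix.of fun k c => γ j k c • slotOp k (L j k c)).det) (tens G) :
        (Fin (r + 1) → E) → ℝ) fun _ => p| ≤
      ∑ σ : Fin m → Equiv.Perm (Fin (r + 1)), |∏ j, ∏ k, γ j k (σ j k)| *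
        ∏ k, |dirList (List.ofFn fun j => L j k (σ j k)).flatten (G k : E → ℝ) p| := by
  rw [opApp_prod_det_tens, Submodule.coe_sum, Finset.sum_apply]
  refine (Finset.abs_sum_le_sum_abs _ _).trans (Finset.sum_le_sum fun σ _ => ?_)
  have h : |∏ j, ((Equiv.Perm.sign (σ j) : ℤ) : ℝ)| = 1 := by
    rw [Finset.abs_prod]
    refine Finset.prod_eq_one fun j _ => ?_
    rcases Int.units_eq_one_or (Equiv.Perm.sign (σ j)) with h | h <;> simp [h]
  rw [Submodule.coe_smul, Pi.smul_apply, tens_apply, smul_eq_mul, abs_mul, abs_mul, h, one_mul]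
  simp only [coe_dirListS]
  rw [← Finset.abs_prod]

/-- The sum of the absolute values of all partial derivatives of order `j`. -/
def wordSum {N : ℕ} (j : ℕ) (f : Euc N → ℝ) (x : Euc N) : ℝ :=
  ∑ w : Fin j → Fin N, |pderivList (List.ofFn w) f x|

theorem wordSum_nonneg {N : ℕ} (j : ℕ) (f : Euc N → ℝ) (x : Euc N) : 0 ≤ wordSum j f x :=
  Finset.sum_nonneg fun _ _ => abs_nonneg _

/-- The sum of the absolute values of all partial derivatives of order at most `s`. -/
def wordSumLE {N : ℕ} (s : ℕ) (f : Euc N → ℝ) (x : Euc N) : ℝ :=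
  ∑ j ∈ Finset.range (s + 1), wordSum j f x

theorem wordSumLE_nonneg {N : ℕ} (s : ℕ) (f : Euc N → ℝ) (x : Euc N) : 0 ≤ wordSumLE s f x :=
  Finset.sum_nonneg fun _ _ => wordSum_nonneg _ _ _

theorem abs_pderivList_le_wordSum {N : ℕ} (l : List (Fin N)) (f : Euc N → ℝ) (x : Euc N) :
    |pderivList l f x| ≤ wordSum l.length f x := by
  have := Finset.single_le_sum (f := fun w : Fin l.length → Fin N =>
    |pderivList (List.ofFn w) f x|) (fun _ _ => abs_nonneg _) (Finset.mem_univ l.get)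
  rwa [List.ofFn_get] at this

theorem abs_pderivList_le_wordSumLE {N s : ℕ} (l : List (Fin N)) (hl : l.length ≤ s)
    (f : Euc N → ℝ) (x : Euc N) : |pderivList l f x| ≤ wordSumLE s f x :=
  (abs_pderivList_le_wordSum l f x).trans <|
    Finset.single_le_sum (f := fun j => wordSum j f x) (fun _ _ => wordSum_nonneg _ _ _)
      (Finset.mem_range.2 (by omega))

/-- The partial derivatives `∂_{i_1}⋯∂_{i_m}` with indices prescribed by `α`. -/
def coordDir {N : ℕ} (α : Fin m → Fin r → Fin N) : Fin m → Fin r → Euc N :=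
  fun s c => EuclideanSpace.single (α s c) 1

theorem abs_integral_jacFam_le_of_smooth {N s : ℕ} (α : Fin m → Fin r → Fin N) (i : Fin m → Fin r)
    (hi : ∀ k, m ≤ s + (Finset.univ.filter fun j => i j = k).card)
    (f : Fin r → Euc N → ℝ) (hf : ∀ k, ContDiff ℝ (⊤ : ℕ∞) (f k))
    (ψ : Euc N → ℝ) (hψ : ContDiff ℝ (⊤ : ℕ∞) ψ) (hc : HasCompactSupport ψ) (B : ℝ)
    (hB : ∀ l : List (Fin N), l.length ≤ m → ∀ x, |pderivList l ψ x| ≤ B)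
    (hint : IntegrableOn (fun x => ∏ k, wordSumLE s (f k) x) (tsupport ψ)) :
    |∫ x, ψ x * jacFam (coordDir α) f x| ≤
      Fintype.card (Fin m → Equiv.Perm (Fin (r + 1))) *
        (B * ∫ x in tsupport ψ, ∏ k, wordSumLE s (f k) x) := by
  classical
  set a := coordDir α with ha
  have hB0 : 0 ≤ B := (abs_nonneg _).trans (hB [] (by simp) 0)
  set G : Fin (r + 1) → smoothFun (Euc N) :=
    Fin.cons ⟨ψ, hψ⟩ fun k => ⟨f k, hf k⟩ with hG
  set γ : Fin m → Fin (r + 1) → Fin (r + 1) → ℝ := fun j k =>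
    Fin.cons (if k = (i j).succ then 1 else 0) fun _ => 1 with hγ
  set L : Fin m → Fin (r + 1) → Fin (r + 1) → List (Fin N) := fun j _ =>
    Fin.cons [] fun c => [α j c] with hL
  set C : Fin m → Fin (r + 1) → OpRing (Fin (r + 1) → Euc N) := fun j k =>
    if k = (i j).succ then 1 else 0 with hC
  have hG0 : HasCompactSupport (G 0 : Euc N → ℝ) := hc
  have hmat : ∀ j, colMatrix (C j) (a j) =
      Matrix.of fun k c => γ j k c • slotOp k ((L j k c).map fun i => EuclideanSpace.single i 1) := by
    intro j
    ext k c
    refine Fin.cases ?_ (fun c => ?_) c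
    · simp only [colMatrix, Matrix.of_apply, Fin.cons_zero, hγ, hL, hC, List.map_nil, slotOp_nil]
      split_ifs <;> simp
    · simp only [colMatrix, Matrix.of_apply, Fin.cons_succ, hγ, hL, one_smul, ha, coordDir]
      rfl
  have key := functional_prod_det (fun g => ∫ x, g x) a ?_ ?_ C G hG0
  · have hsum : ∀ j, ∑ k, C j k = 1 := by intro j; simp [hC]
    simp only [hsum, Finset.prod_const_one, one_mul] at key
    simp only [opApp_prod_det_submatrix_tens_diag] at key
    have e1 : ∀ x, ψ x * jacFam a f x =
        (G 0 : Euc N → ℝ) x * jacFam a (fun k => (G k.succ : Euc N → ℝ)) x := fun x => rfl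
    simp only [e1]
    rw [← key]
    have hpt : ∀ x, |(opApp (∏ j, (colMatrix (C j) (a j)).det) (tens G) :
        (Fin (r + 1) → Euc N) → ℝ) fun _ => x| ≤
        Fintype.card (Fin m → Equiv.Perm (Fin (r + 1))) * (B * ∏ k, wordSumLE s (f k) x) := by
      intro x
      simp only [hmat]
      refine (abs_opApp_prod_det_tens_le _ _ _ _).trans ?_
      rw [← nsmul_eq_mul]
      refine Finset.sum_le_card_nsmul _ _ _ fun σ _ => ?_
      have hP : 0 ≤ B * ∏ k, wordSumLE s (f k) x :=
        mul_nonneg hB0 (Finset.prod_nonneg fun _ _ => wordSumLE_nonneg _ _ _)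
      by_cases hσ : ∀ j, σ j (i j).succ = 0
      · have h1 : |∏ j, ∏ k, γ j k (σ j k)| ≤ 1 := by
          rw [Finset.abs_prod]
          refine Finset.prod_le_one (fun _ _ => abs_nonneg _) fun j _ => ?_
          rw [Finset.abs_prod]
          refine Finset.prod_le_one (fun _ _ => abs_nonneg _) fun k _ => ?_
          generalize σ j k = c
          refine Fin.cases ?_ (fun c => ?_) c
          · simp only [hγ, Fin.cons_zero]; split_ifs <;> simp
          · simp [hγ]
        refine (mul_le_of_le_one_left (Finset.prod_nonneg fun _ _ => abs_nonneg _) h1).trans ?_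
        have hlen : ∀ j k c, (L j k c).length ≤ 1 := by
          intro j k c
          refine Fin.cases ?_ (fun c => ?_) c <;> simp [hL]
        have hflat : ∀ k, (List.ofFn fun j => (L j k (σ j k)).map fun i =>
            (EuclideanSpace.single i 1 : Euc N)).flatten =
            (List.ofFn fun j => L j k (σ j k)).flatten.map fun i => EuclideanSpace.single i 1 := by
          intro k
          rw [List.map_flatten, List.map_ofFn]
          rfl
        have hflen : ∀ k, (List.ofFn fun j => L j k (σ j k)).flatten.length =
            ∑ j, (L j k (σ j k)).length := by
          intro k
          rw [List.length_flatten, List.map_ofFn, List.sum_ofFn]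
          rfl
        simp only [hflat, ← pderivList_eq_dirList]
        rw [Fin.prod_univ_succ]
        refine mul_le_mul ?_ ?_ (Finset.prod_nonneg fun _ _ => abs_nonneg _) hB0
        · refine hB _ ?_ x
          rw [hflen]
          refine (Finset.sum_le_sum fun j _ => hlen j 0 _).trans ?_
          simp
        · refine Finset.prod_le_prod (fun _ _ => abs_nonneg _) fun k _ => ?_
          refine abs_pderivList_le_wordSumLE _ ?_ _ _
          rw [hflen]
          have : ∑ j, (L j k.succ (σ j k.succ)).length ≤ ∑ j, if i j = k then 0 else 1 := by
            refine Finset.sum_le_sum fun j _ => ?_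
            split_ifs with h
            · have := hσ j
              rw [h] at this
              rw [this]
              simp [hL]
            · exact hlen j k.succ _
          refine this.trans ?_
          have h2 := hi k
          have h3 : (∑ j : Fin m, if i j = k then 0 else 1) =
              (Finset.univ.filter fun j => ¬ i j = k).card := by
            rw [Finset.card_filter]
            refine Finset.sum_congr rfl fun j _ => ?_
            by_cases h : i j = k <;> simp [h]
          have h4 := Finset.card_filter_add_card_filter_not (s := (Finset.univ : Finset (Fin m)))
            (fun j => i j = k)
          rw [Finset.card_univ, Fintype.card_fin] at h4
          omega
      · push Not at hσ
        obtain ⟨j, hj⟩ := hσ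
        have : ∏ j, ∏ k, γ j k (σ j k) = 0 := by
          refine Finset.prod_eq_zero (Finset.mem_univ j) ?_
          refine Finset.prod_eq_zero (Finset.mem_univ ((σ j).symm 0)) ?_
          rw [Equiv.apply_symm_apply]
          simp only [hγ, Fin.cons_zero]
          rw [if_neg]
          intro h
          apply hj
          rw [← h, Equiv.apply_symm_apply]
        rw [this]
        simpa using hP
    have hsupp : ∀ x, x ∉ tsupport ψ → (opApp (∏ j, (colMatrix (C j) (a j)).det) (tens G) :
        (Fin (r + 1) → Euc N) → ℝ) (fun _ => x) = 0 := by
      intro x hx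
      have hU : IsOpen {y : Fin (r + 1) → Euc N | y 0 ∉ tsupport ψ} :=
        ((isClosed_tsupport _).preimage (continuous_apply 0)).isOpen_compl
      refine opApp_eq_zero_of_isOpen hU _ _ ?_ _ hx
      intro y hy
      rw [tens_apply, Fin.prod_univ_succ]
      have : (G 0 : Euc N → ℝ) (y 0) = 0 := image_eq_zero_of_notMem_tsupport (f := ψ) hy
      rw [this, zero_mul]
    rw [← setIntegral_eq_integral_of_forall_compl_eq_zero hsupp]
    rw [← integral_const_mul, ← integral_const_mul]
    exact norm_integral_le_of_norm_le ((hint.const_mul _).const_mul _)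
      (Filter.Eventually.of_forall fun x => (Real.norm_eq_abs _).trans_le (hpt x))
  · intro g h hg hgc hh hhc
    exact integral_add (hg.continuous.integrable_of_hasCompactSupport hgc)
      (hh.continuous.integrable_of_hasCompactSupport hhc)
  · intro g hg hgc j c
    have := integral_mul_fderiv_eq_neg_fderiv_mul_of_integrable (μ := volume) (f := fun _ => 1) (g := g)
      (v := a j c) ?_ ?_ ?_ (fun _ _ => by fun_prop)
      (fun x _ => hg.differentiable (by simp) x)
    · simpa using this
    · simp
    · simp only [one_mul]
      exact ((hg.fderiv_apply_smooth _).continuous).integrable_of_hasCompactSupport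
        (hgc.fderiv_apply ℝ _)
    · simpa using hg.continuous.integrable_of_hasCompactSupport hgc

end IntegerCase

/-! ### Extension to the half space by averaging -/

section Averaging

variable {N : ℕ}

/-- The average `(x, t) ↦ ∫ f (x - t z) φ z dz`. -/
def dilAvg (f φ : Euc N → ℝ) (p : Euc N × ℝ) : ℝ := ∫ z, f (p.1 - p.2 • z) * φ z

theorem pderiv'_contDiff {f : Euc N → ℝ} (hf : ContDiff ℝ (⊤ : ℕ∞) f) (i : Fin N) :
    ContDiff ℝ (⊤ : ℕ∞) (pderiv' i f) := hf.fderiv_apply_smooth _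

theorem pderiv'_hasCompactSupport {f : Euc N → ℝ} (hf : HasCompactSupport f) (i : Fin N) :
    HasCompactSupport (pderiv' i f) := hf.fderiv_apply ℝ _

theorem tsupport_pderiv'_subset (f : Euc N → ℝ) (i : Fin N) :
    tsupport (pderiv' i f) ⊆ tsupport f := tsupport_fderiv_apply_subset ℝ _

theorem pderivList_contDiff {f : Euc N → ℝ} (hf : ContDiff ℝ (⊤ : ℕ∞) f) (l : List (Fin N)) :
    ContDiff ℝ (⊤ : ℕ∞) (pderivList l f) := by
  induction l with
  | nil => exact hf
  | cons i l ih => exact pderiv'_contDiff ih i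

theorem tsupport_pderivList_subset (f : Euc N → ℝ) (l : List (Fin N)) :
    tsupport (pderivList l f) ⊆ tsupport f := by
  induction l with
  | nil => exact subset_rfl
  | cons i l ih => exact (tsupport_pderiv'_subset _ i).trans ih

theorem pderivList_hasCompactSupport {f : Euc N → ℝ} (hf : HasCompactSupport f)
    (l : List (Fin N)) : HasCompactSupport (pderivList l f) :=
  hf.of_isClosed_subset (isClosed_tsupport _) (tsupport_pderivList_subset f l)

theorem dilAvg_integrable {g φ : Euc N → ℝ} (hg : Continuous g) (hφ : Continuous φ)
    (hφc : HasCompactSupport φ) (p : Euc N × ℝ) :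
    Integrable fun z => g (p.1 - p.2 • z) * φ z :=
  Continuous.integrable_of_hasCompactSupport (by fun_prop) hφc.mul_left

theorem dilAvg_hasFDerivAt {f φ : Euc N → ℝ} (hf : ContDiff ℝ (⊤ : ℕ∞) f)
    (hfc : HasCompactSupport f) (hφ : Continuous φ) (hφc : HasCompactSupport φ)
    (p : Euc N × ℝ) :
    HasFDerivAt (dilAvg f φ) (∫ z, φ z • (fderiv ℝ f (p.1 - p.2 • z)).comp
      (ContinuousLinearMap.fst ℝ (Euc N) ℝ - (ContinuousLinearMap.snd ℝ (Euc N) ℝ).smulRight z)) p ∧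
    Integrable fun z => φ z • (fderiv ℝ f (p.1 - p.2 • z)).comp
      (ContinuousLinearMap.fst ℝ (Euc N) ℝ - (ContinuousLinearMap.snd ℝ (Euc N) ℝ).smulRight z) := by
  have hdf : Continuous (fderiv ℝ f) := hf.continuous_fderiv (by simp)
  obtain ⟨M, hM⟩ := hdf.bounded_above_of_compact_support (hfc.fderiv ℝ)
  set A : Euc N → (Euc N × ℝ →L[ℝ] Euc N) := fun z =>
    ContinuousLinearMap.fst ℝ (Euc N) ℝ - (ContinuousLinearMap.snd ℝ (Euc N) ℝ).smulRight z
  have hA : Continuous A := by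
    refine continuous_const.sub ?_
    exact ((ContinuousLinearMap.smulRightL ℝ (Euc N × ℝ) (Euc N))
      (ContinuousLinearMap.snd ℝ (Euc N) ℝ)).continuous
  set F' : Euc N × ℝ → Euc N → (Euc N × ℝ →L[ℝ] ℝ) := fun p z =>
    φ z • (fderiv ℝ f (p.1 - p.2 • z)).comp (A z)
  have hF'c : ∀ p, Continuous (F' p) := by
    intro p
    refine hφ.smul (Continuous.clm_comp ?_ hA)
    exact hdf.comp (by fun_prop)
  have hF'i : ∀ p, Integrable (F' p) := fun p =>
    (hF'c p).integrable_of_hasCompactSupport hφc.smul_right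
  refine ⟨?_, hF'i p⟩
  refine hasFDerivAt_integral_of_dominated_of_fderiv_le (F := fun p z => f (p.1 - p.2 • z) * φ z)
    (F' := F') (bound := fun z => |φ z| * (M * ‖A z‖)) (s := Set.univ) Filter.univ_mem ?_ ?_ ?_ ?_ ?_ ?_
  · exact Filter.Eventually.of_forall fun p =>
      (dilAvg_integrable hf.continuous hφ hφc p).aestronglyMeasurable
  · exact dilAvg_integrable hf.continuous hφ hφc p
  · exact (hF'c p).aestronglyMeasurable
  · refine Filter.Eventually.of_forall fun z p _ => ?_
    rw [norm_smul, Real.norm_eq_abs]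
    refine mul_le_mul_of_nonneg_left ?_ (abs_nonneg _)
    exact (ContinuousLinearMap.opNorm_comp_le _ _).trans
      (mul_le_mul_of_nonneg_right (hM _) (norm_nonneg _))
  · refine Continuous.integrable_of_hasCompactSupport (by fun_prop) ?_
    exact HasCompactSupport.mul_right (hφc.comp_left (g := fun y => |y|) abs_zero)
  · refine Filter.Eventually.of_forall fun z p _ => ?_
    have h1 : HasFDerivAt (fun p : Euc N × ℝ => p.1 - p.2 • z) (A z) p := by
      have := (A z).hasFDerivAt (x := p)
      exact this
    have h2 := (HasFDerivAt.comp p ((hf.differentiable (by simp)) (p.1 - p.2 • z)).hasFDerivAt h1).mul_const (φ z)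
    exact h2

theorem fderiv_dilAvg_apply {f φ : Euc N → ℝ} (hf : ContDiff ℝ (⊤ : ℕ∞) f)
    (hfc : HasCompactSupport f) (hφ : Continuous φ) (hφc : HasCompactSupport φ)
    (p a : Euc N × ℝ) :
    fderiv ℝ (dilAvg f φ) p a = ∑ i, dilAvg (pderiv' i f) (fun z => (a.1 i - a.2 * z i) * φ z) p := by
  obtain ⟨h1, h2⟩ := dilAvg_hasFDerivAt hf hfc hφ hφc p
  rw [h1.fderiv, ContinuousLinearMap.integral_apply h2]
  simp only [dilAvg]
  rw [← integral_finsetSum]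
  · refine integral_congr_ae (Filter.Eventually.of_forall fun z => ?_)
    have h3 : a.1 - a.2 • z = ∑ i, (a.1 i - a.2 * z i) • (EuclideanSpace.single i (1 : ℝ) : Euc N) := by
      ext j
      simp [Finset.sum_apply, Pi.single_apply]
    have h4 : (fderiv ℝ f (p.1 - p.2 • z)) (a.1 - a.2 • z) =
        ∑ i, (a.1 i - a.2 * z i) * pderiv' i f (p.1 - p.2 • z) := by
      rw [h3, map_sum]
      simp [pderiv']
    simp only [_root_.smul_apply, ContinuousLinearMap.comp_apply, _root_.sub_apply,
      ContinuousLinearMap.coe_fst', ContinuousLinearMap.smulRight_apply,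
      ContinuousLinearMap.coe_snd', smul_eq_mul]
    rw [h4, Finset.mul_sum]
    exact Finset.sum_congr rfl fun i _ => by ring
  · intro i _
    exact dilAvg_integrable (pderiv'_contDiff hf i).continuous (by fun_prop) hφc.mul_left p

theorem dilAvg_contDiff {f φ : Euc N → ℝ} (hf : ContDiff ℝ (⊤ : ℕ∞) f)
    (hfc : HasCompactSupport f) (hφ : Continuous φ) (hφc : HasCompactSupport φ) :
    ContDiff ℝ (⊤ : ℕ∞) (dilAvg f φ) := by
  rw [contDiff_infty]
  intro n
  induction n generalizing f φ with
  | zero =>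
    rw [Nat.cast_zero, contDiff_zero]
    exact continuous_iff_continuousAt.2 fun p => (dilAvg_hasFDerivAt hf hfc hφ hφc p).1.continuousAt
  | succ n ih =>
    rw [Nat.cast_succ, contDiff_succ_iff_fderiv_apply]
    refine ⟨fun p => (dilAvg_hasFDerivAt hf hfc hφ hφc p).1.differentiableAt, by simp, fun a => ?_⟩
    simp only [fderiv_dilAvg_apply hf hfc hφ hφc]
    refine ContDiff.sum fun i _ => ?_
    exact ih (pderiv'_contDiff hf i) (pderiv'_hasCompactSupport hfc i) (by fun_prop) hφc.mul_left

theorem dilAvg_pderiv' {f φ : Euc N → ℝ} (hf : ContDiff ℝ (⊤ : ℕ∞) f)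
    (hφ : ContDiff ℝ (⊤ : ℕ∞) φ) (hφc : HasCompactSupport φ) (i : Fin N)
    (p : Euc N × ℝ) (hp : 0 < p.2) :
    dilAvg (pderiv' i f) φ p = p.2⁻¹ * dilAvg f (pderiv' i φ) p := by
  set g : Euc N → ℝ := fun z => f (p.1 - p.2 • z) with hg
  have hgs : ContDiff ℝ (⊤ : ℕ∞) g := hf.comp (by fun_prop)
  have hgd : ∀ z, fderiv ℝ g z (EuclideanSpace.single i 1) = - p.2 * pderiv' i f (p.1 - p.2 • z) := by
    intro z
    have h1 : HasFDerivAt (fun z : Euc N => p.1 - p.2 • z) (-(p.2 • ContinuousLinearMap.id ℝ (Euc N))) z := by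
      exact ((p.2 • ContinuousLinearMap.id ℝ (Euc N)).hasFDerivAt (x := z)).const_sub p.1
    have h2 : HasFDerivAt g _ z :=
      HasFDerivAt.comp z ((hf.differentiable (by simp)) (p.1 - p.2 • z)).hasFDerivAt h1
    rw [h2.fderiv]
    simp [pderiv']
  have hgc := hgs.continuous
  have hdg := (hgs.fderiv_apply_smooth (EuclideanSpace.single i 1)).continuous
  have key := integral_mul_fderiv_eq_neg_fderiv_mul_of_integrable (μ := volume) (f := g) (g := φ)
    (v := EuclideanSpace.single i 1) ?_ ?_ ?_ (fun x _ => hgs.differentiable (by simp) x)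
    (fun x _ => hφ.differentiable (by simp) x)
  · simp only [hgd] at key
    simp only [dilAvg]
    have e1 : ∫ z, g z * fderiv ℝ φ z (EuclideanSpace.single i 1) =
      ∫ z, f (p.1 - p.2 • z) * pderiv' i φ z := rfl
    rw [← e1, key]
    simp only [neg_mul, mul_assoc]
    rw [integral_neg, neg_neg, integral_const_mul, ← mul_assoc, inv_mul_cancel₀ hp.ne', one_mul]
  · exact (hdg.mul hφ.continuous).integrable_of_hasCompactSupport hφc.mul_left
  · exact (hgc.mul (pderiv'_contDiff hφ i).continuous).integrable_of_hasCompactSupport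
      (pderiv'_hasCompactSupport hφc i).mul_left
  · exact (hgc.mul hφ.continuous).integrable_of_hasCompactSupport hφc.mul_left

theorem dirList_dilAvg_spatial {f φ : Euc N → ℝ} (hf : ContDiff ℝ (⊤ : ℕ∞) f)
    (hfc : HasCompactSupport f) (hφ : Continuous φ) (hφc : HasCompactSupport φ)
    (l : List (Fin N)) :
    dirList (l.map fun i => ((EuclideanSpace.single i 1 : Euc N), (0 : ℝ))) (dilAvg f φ) =
      dilAvg (pderivList l f) φ := by
  induction l with
  | nil => rfl
  | cons i l ih =>
    funext p
    simp only [List.map_cons, dirList, ih, pderivList]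
    rw [fderiv_dilAvg_apply (pderivList_contDiff hf l) (pderivList_hasCompactSupport hfc l) hφ hφc]
    rw [Finset.sum_eq_single i]
    · simp
    · intro j _ hj
      simp [dilAvg, hj]
    · simp

end Averaging

section Kernels

variable {N : ℕ}

theorem exists_kernel_dirList_dilAvg {φ : Euc N → ℝ} (hφ : ContDiff ℝ (⊤ : ℕ∞) φ)
    (hφc : HasCompactSupport φ) (k : ℕ) (l : List (Euc N × ℝ)) (hl : l.length = k) :
    ∃ κ : (Fin k → Fin N) → Euc N → ℝ,
      (∀ γ, ContDiff ℝ (⊤ : ℕ∞) (κ γ) ∧ tsupport (κ γ) ⊆ tsupport φ) ∧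
      ∀ f : Euc N → ℝ, ContDiff ℝ (⊤ : ℕ∞) f → HasCompactSupport f →
        dirList l (dilAvg f φ) = fun p => ∑ γ, dilAvg (pderivList (List.ofFn γ) f) (κ γ) p := by
  induction l generalizing k with
  | nil =>
    subst hl
    refine ⟨fun _ => φ, fun _ => ⟨hφ, subset_rfl⟩, fun f _ _ => ?_⟩
    funext p
    simp only [dirList, List.length_nil, List.ofFn_zero, pderivList]
    simp
  | cons a l ih =>
    obtain ⟨k, rfl⟩ : ∃ k', k = k' + 1 := ⟨l.length, by simpa using hl.symm⟩
    obtain ⟨κ, hκ, h⟩ := ih k (by simpa using hl)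
    refine ⟨fun γ z => (a.1 (γ 0) - a.2 * z (γ 0)) * κ (Fin.tail γ) z, fun γ => ⟨?_, ?_⟩, ?_⟩
    · have := (hκ (Fin.tail γ)).1
      fun_prop
    · exact (tsupport_mul_subset_right).trans (hκ _).2
    · intro f hf hfc
      have hc : ∀ γ, HasCompactSupport (κ γ) := fun γ =>
        hφc.of_isClosed_subset (isClosed_tsupport _) (hκ γ).2
      funext p
      simp only [dirList, h f hf hfc]
      have hd : ∀ γ, HasFDerivAt (dilAvg (pderivList (List.ofFn γ) f) (κ γ))
          (fderiv ℝ (dilAvg (pderivList (List.ofFn γ) f) (κ γ)) p) p := fun γ =>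
        ((dilAvg_contDiff (pderivList_contDiff hf _) (pderivList_hasCompactSupport hfc _)
          (hκ γ).1.continuous (hc γ)).differentiable (by simp) p).hasFDerivAt
      rw [(HasFDerivAt.fun_sum fun γ (_ : γ ∈ Finset.univ) => hd γ).fderiv, _root_.sum_apply]
      rw [← (Fin.consEquiv fun _ : Fin (k + 1) => Fin N).sum_comp, Fintype.sum_prod_type_right]
      refine Finset.sum_congr rfl fun γ _ => ?_
      rw [fderiv_dilAvg_apply (pderivList_contDiff hf _) (pderivList_hasCompactSupport hfc _)
          (hκ γ).1.continuous (hc γ)]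
      refine Finset.sum_congr rfl fun i _ => ?_
      change _ = dilAvg (pderivList (List.ofFn (Fin.cons i γ : Fin (k + 1) → Fin N)) f)
        (fun z => (a.1 i - a.2 * z i) * κ (Fin.tail (Fin.cons i γ : Fin (k + 1) → Fin N)) z) p
      rw [List.ofFn_cons, Fin.tail_cons]
      rfl

theorem exists_kernel_dirList_append_dilAvg {φ : Euc N → ℝ} (hφ : ContDiff ℝ (⊤ : ℕ∞) φ)
    (hφc : HasCompactSupport φ) (k : ℕ) (l₀ : List (Euc N × ℝ)) (hl₀ : l₀.length = k)
    (l : List (Euc N × ℝ)) :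
    ∃ κ : (Fin k → Fin N) → Euc N → ℝ,
      (∀ γ, ContDiff ℝ (⊤ : ℕ∞) (κ γ) ∧ tsupport (κ γ) ⊆ tsupport φ) ∧
      (l ≠ [] → ∀ γ, ∫ z, κ γ z = 0) ∧
      ∀ f : Euc N → ℝ, ContDiff ℝ (⊤ : ℕ∞) f → HasCompactSupport f → ∀ p, 0 < p.2 →
        dirList (l ++ l₀) (dilAvg f φ) p =
          p.2⁻¹ ^ l.length * ∑ γ, dilAvg (pderivList (List.ofFn γ) f) (κ γ) p := by
  induction l with
  | nil =>
    obtain ⟨κ, hκ, h⟩ := exists_kernel_dirList_dilAvg hφ hφc k l₀ hl₀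
    refine ⟨κ, hκ, by simp, fun f hf hfc p _ => ?_⟩
    simp [h f hf hfc]
  | cons a l ih =>
    obtain ⟨κ, hκ, h0, h⟩ := ih
    have hc : ∀ γ, HasCompactSupport (κ γ) := fun γ =>
      hφc.of_isClosed_subset (isClosed_tsupport _) (hκ γ).2
    set κ₁ : (Fin k → Fin N) → Fin N → Euc N → ℝ := fun γ i z => (a.1 i - a.2 * z i) * κ γ z with hκ₁
    have hs₁ : ∀ γ i, ContDiff ℝ (⊤ : ℕ∞) (κ₁ γ i) := by
      intro γ i
      have := (hκ γ).1
      fun_prop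
    have ht₁ : ∀ γ i, tsupport (κ₁ γ i) ⊆ tsupport φ := fun γ i =>
      (tsupport_mul_subset_right).trans (hκ _).2
    have hc₁ : ∀ γ i, HasCompactSupport (κ₁ γ i) := fun γ i =>
      hφc.of_isClosed_subset (isClosed_tsupport _) (ht₁ γ i)
    have hint : ∀ γ i, Integrable (pderiv' i (κ₁ γ i)) := fun γ i =>
      (pderiv'_contDiff (hs₁ γ i) i).continuous.integrable_of_hasCompactSupport
        (pderiv'_hasCompactSupport (hc₁ γ i) i)
    refine ⟨fun γ z => -(l.length * a.2) * κ γ z + ∑ i, pderiv' i (κ₁ γ i) z,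
      fun γ => ⟨?_, ?_⟩, fun _ γ => ?_, ?_⟩
    · refine (contDiff_const.mul (hκ γ).1).add (ContDiff.sum fun i _ => ?_)
      exact pderiv'_contDiff (hs₁ γ i) i
    · refine closure_minimal ?_ (isClosed_tsupport _)
      intro z hz
      by_contra hzn
      apply hz
      have e1 : κ γ z = 0 := image_eq_zero_of_notMem_tsupport fun hh => hzn ((hκ γ).2 hh)
      have e2 : ∀ i, pderiv' i (κ₁ γ i) z = 0 := fun i => image_eq_zero_of_notMem_tsupport
        fun hh => hzn (ht₁ γ i (tsupport_pderiv'_subset _ i hh))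
      simp [e1, e2]
    · rw [integral_add, integral_finsetSum _ fun i _ => hint γ i, integral_const_mul]
      · have e1 : ∀ i, ∫ z, pderiv' i (κ₁ γ i) z = 0 := by
          intro i
          have := integral_mul_fderiv_eq_neg_fderiv_mul_of_integrable (μ := volume)
            (f := fun _ => 1) (g := κ₁ γ i) (v := EuclideanSpace.single i 1) ?_ ?_ ?_
            (fun _ _ => by fun_prop) (fun x _ => (hs₁ γ i).differentiable (by simp) x)
          · simp only [one_mul, fderiv_const_apply, _root_.zero_apply, zero_mul,
              integral_zero, neg_zero] at this
            exact this
          · simp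
          · simp only [one_mul]
            exact hint γ i
          · simpa using (hs₁ γ i).continuous.integrable_of_hasCompactSupport (hc₁ γ i)
        simp only [e1, Finset.sum_const_zero, add_zero]
        by_cases hl : l = []
        · simp [hl]
        · rw [h0 hl γ, mul_zero]
      · exact ((hκ γ).1.continuous.integrable_of_hasCompactSupport (hc γ)).const_mul _
      · exact integrable_finsetSum _ fun i _ => hint γ i
    · intro f hf hfc p hp
      have hD : ∀ γ, ContDiff ℝ (⊤ : ℕ∞) (dilAvg (pderivList (List.ofFn γ) f) (κ γ)) := fun γ =>
        dilAvg_contDiff (pderivList_contDiff hf _) (pderivList_hasCompactSupport hfc _)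
          (hκ γ).1.continuous (hc γ)
      have hev : dirList (l ++ l₀) (dilAvg f φ) =ᶠ[𝓝 p] fun p => p.2⁻¹ ^ l.length *
          ∑ γ, dilAvg (pderivList (List.ofFn γ) f) (κ γ) p := by
        filter_upwards [(isOpen_lt continuous_const continuous_snd).mem_nhds hp] with p' hp'
        exact h f hf hfc p' hp'
      have h1 : HasFDerivAt (fun p : Euc N × ℝ => p.2⁻¹ ^ l.length)
          ((-(l.length * p.2⁻¹ ^ (l.length + 1))) • ContinuousLinearMap.snd ℝ (Euc N) ℝ) p := by
        have h2 : HasDerivAt (fun t : ℝ => t⁻¹ ^ l.length) (-(l.length * p.2⁻¹ ^ (l.length + 1))) p.2 := by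
          have := (hasDerivAt_inv hp.ne').pow l.length
          refine this.congr_deriv ?_
          rcases Nat.eq_zero_or_pos l.length with h | h
          · simp [h]
          · obtain ⟨n, hn⟩ : ∃ n, l.length = n + 1 := ⟨l.length - 1, by omega⟩
            rw [hn, Nat.add_sub_cancel, ← inv_pow p.2 2]
            ring
        exact h2.comp_hasFDerivAt p (ContinuousLinearMap.snd ℝ (Euc N) ℝ).hasFDerivAt
      have h3 := HasFDerivAt.fun_sum fun γ (_ : γ ∈ Finset.univ) =>
        ((hD γ).differentiable (by simp) p).hasFDerivAt
      simp only [List.cons_append, dirList, List.length_cons]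
      rw [hev.fderiv_eq, (h1.fun_mul h3).fderiv]
      simp only [_root_.add_apply, _root_.smul_apply, _root_.sum_apply,
        ContinuousLinearMap.coe_snd', smul_eq_mul]
      rw [Finset.mul_sum, Finset.sum_mul, Finset.mul_sum, ← Finset.sum_add_distrib]
      refine Finset.sum_congr rfl fun γ _ => ?_
      rw [fderiv_dilAvg_apply (pderivList_contDiff hf _) (pderivList_hasCompactSupport hfc _)
          (hκ γ).1.continuous (hc γ)]
      have h4 : ∀ i, dilAvg (pderiv' i (pderivList (List.ofFn γ) f)) (κ₁ γ i) p =
          p.2⁻¹ * dilAvg (pderivList (List.ofFn γ) f) (pderiv' i (κ₁ γ i)) p := fun i =>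
        dilAvg_pderiv' (pderivList_contDiff hf _) (hs₁ γ i) (hc₁ γ i) i p hp
      have h5 : dilAvg (pderivList (List.ofFn γ) f)
          (fun z => -(l.length * a.2) * κ γ z + ∑ i, pderiv' i (κ₁ γ i) z) p =
          -(l.length * a.2) * dilAvg (pderivList (List.ofFn γ) f) (κ γ) p +
            ∑ i, dilAvg (pderivList (List.ofFn γ) f) (pderiv' i (κ₁ γ i)) p := by
        have hg := (pderivList_contDiff hf (List.ofFn γ)).continuous
        simp only [dilAvg]
        rw [← integral_const_mul, ← integral_finsetSum, ← integral_add]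
        · refine integral_congr_ae (Filter.Eventually.of_forall fun z => ?_)
          simp only [mul_add, Finset.mul_sum]
          ring
        · exact (dilAvg_integrable hg (hκ γ).1.continuous (hc γ) p).const_mul _
        · refine integrable_finsetSum _ fun i _ => dilAvg_integrable hg
            (pderiv'_contDiff (hs₁ γ i) i).continuous (pderiv'_hasCompactSupport (hc₁ γ i) i) p
        · exact fun i _ => dilAvg_integrable hg
            (pderiv'_contDiff (hs₁ γ i) i).continuous (pderiv'_hasCompactSupport (hc₁ γ i) i) p
      rw [h5]
      have h6 : ∀ i, dilAvg (pderiv' i (pderivList (List.ofFn γ) f))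
          (fun z => (a.1 i - a.2 * z i) * κ γ z) p =
          p.2⁻¹ * dilAvg (pderivList (List.ofFn γ) f) (pderiv' i (κ₁ γ i)) p := h4
      simp only [h6, ← Finset.mul_sum]
      ring

end Kernels

/-! ### The weighted half space functional -/

section HalfSpace

variable {N : ℕ}

/-- The product of Lebesgue measure and Lebesgue measure on the half line. -/
def halfMeasure (N : ℕ) : Measure (Euc N × ℝ) := volume.prod (volume.restrict (Set.Ioi 0))

instance : IsFiniteMeasureOnCompacts (halfMeasure N) := by
  unfold halfMeasure
  infer_instance

theorem integrable_pow_mul_halfMeasure (j : ℕ) {g : Euc N × ℝ → ℝ} (hg : Continuous g)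
    (hgc : HasCompactSupport g) : Integrable (fun p => p.2 ^ j * g p) (halfMeasure N) :=
  Continuous.integrable_of_hasCompactSupport (by fun_prop) hgc.mul_left

theorem integral_halfMeasure_fderiv_spatial (j : ℕ) {g : Euc N × ℝ → ℝ}
    (hg : ContDiff ℝ (⊤ : ℕ∞) g) (hgc : HasCompactSupport g) (a : Euc N) :
    ∫ p, p.2 ^ j * fderiv ℝ g p (a, 0) ∂(halfMeasure N) = 0 := by
  have hi := integrable_pow_mul_halfMeasure j (hg.fderiv_apply_smooth (a, 0)).continuous
    (hgc.fderiv_apply ℝ (a, 0))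
  unfold halfMeasure at hi ⊢
  rw [integral_prod_symm _ hi]
  refine integral_eq_zero_of_ae (Filter.Eventually.of_forall fun t => ?_)
  simp only [Pi.zero_apply]
  rw [integral_const_mul]
  have hgt : ContDiff ℝ (⊤ : ℕ∞) fun x => g (x, t) := hg.comp (by fun_prop)
  have hcemb : IsClosedEmbedding fun x : Euc N => (x, t) := by
    refine Topology.IsClosedEmbedding.of_continuous_injective_isClosedMap (by fun_prop)
      (fun x y h => (Prod.ext_iff.1 h).1) ?_
    intro S hS
    have : (fun x : Euc N => (x, t)) '' S = S ×ˢ {t} := by ext ⟨x, s⟩; simp [eq_comm]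
    rw [this]
    exact hS.prod isClosed_singleton
  have hgtc : HasCompactSupport fun x => g (x, t) := hgc.comp_isClosedEmbedding hcemb
  have hd : ∀ x, fderiv ℝ (fun x => g (x, t)) x a = fderiv ℝ g (x, t) (a, 0) := by
    intro x
    have h1 : HasFDerivAt (fun x : Euc N => (x, t))
        (ContinuousLinearMap.inl ℝ (Euc N) ℝ) x := by
      simpa using (hasFDerivAt_prodMk_left x t)
    have h2 := HasFDerivAt.comp x (hg.differentiable (by simp) (x, t)).hasFDerivAt h1
    have h3 : fderiv ℝ (fun x => g (x, t)) x = _ := h2.fderiv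
    rw [h3]
    simp
  simp only [← hd]
  have := integral_mul_fderiv_eq_neg_fderiv_mul_of_integrable (μ := volume)
    (f := fun _ => 1) (g := fun x => g (x, t)) (v := a) ?_ ?_ ?_
    (fun _ _ => by fun_prop) (fun x _ => hgt.differentiable (by simp) x)
  · simp only [one_mul, fderiv_const_apply, _root_.zero_apply, zero_mul,
      integral_zero, neg_zero] at this
    rw [this, mul_zero]
  · simp
  · simp only [one_mul]
    exact (hgt.fderiv_apply_smooth a).continuous.integrable_of_hasCompactSupport
      (hgtc.fderiv_apply ℝ a)
  · simpa using hgt.continuous.integrable_of_hasCompactSupport hgtc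

theorem integral_halfMeasure_fderiv_normal (j : ℕ) {g : Euc N × ℝ → ℝ}
    (hg : ContDiff ℝ (⊤ : ℕ∞) g) (hgc : HasCompactSupport g) :
    ∫ p, p.2 ^ j * fderiv ℝ g p (0, 1) ∂(halfMeasure N) =
      - j * ∫ p, p.2 ^ (j - 1) * g p ∂(halfMeasure N) - 0 ^ j * ∫ x, g (x, 0) := by
  have hi := integrable_pow_mul_halfMeasure j (hg.fderiv_apply_smooth (0, 1)).continuous
    (hgc.fderiv_apply ℝ (0, 1))
  have hi2 := integrable_pow_mul_halfMeasure (j - 1) hg.continuous hgc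
  have hsum : ∫ p, (j * (p.2 ^ (j - 1) * g p) + p.2 ^ j * fderiv ℝ g p (0, 1)) ∂(halfMeasure N) =
      ∫ x, - (0 ^ j * g (x, 0)) := by
    have hi3 := (hi2.const_mul (j : ℝ)).add hi
    unfold halfMeasure at hi3 ⊢
    rw [show (∫ p, (j * (p.2 ^ (j - 1) * g p) + p.2 ^ j * fderiv ℝ g p (0, 1))
      ∂(volume.prod (volume.restrict (Set.Ioi 0)))) = _ from integral_prod _ hi3]
    refine integral_congr_ae (Filter.Eventually.of_forall fun x => ?_)
    simp only
    have hgt : ContDiff ℝ (⊤ : ℕ∞) fun t => g (x, t) := hg.comp (by fun_prop)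
    have hcemb : IsClosedEmbedding fun t : ℝ => (x, t) := by
      refine Topology.IsClosedEmbedding.of_continuous_injective_isClosedMap (by fun_prop)
        (fun x y h => (Prod.ext_iff.1 h).2) ?_
      intro S hS
      have : (fun t : ℝ => (x, t)) '' S = {x} ×ˢ S := by ext ⟨y, s⟩; simp [eq_comm, and_comm]
      rw [this]
      exact isClosed_singleton.prod hS
    have hgtc : HasCompactSupport fun t => g (x, t) := hgc.comp_isClosedEmbedding hcemb
    have hd : ∀ t, HasDerivAt (fun t => g (x, t)) (fderiv ℝ g (x, t) (0, 1)) t := by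
      intro t
      have h1 : HasFDerivAt (fun t : ℝ => (x, t))
          (ContinuousLinearMap.inr ℝ (Euc N) ℝ) t := by
        simpa using (hasFDerivAt_prodMk_right x t)
      have h2 := HasFDerivAt.comp t (hg.differentiable (by simp) (x, t)).hasFDerivAt h1
      have h3 : HasDerivAt (fun t => g (x, t)) _ t := h2.hasDerivAt
      refine h3.congr_deriv ?_
      simp
    have hF : ∀ t, HasDerivAt (fun t => t ^ j * g (x, t))
        (j * (t ^ (j - 1) * g (x, t)) + t ^ j * fderiv ℝ g (x, t) (0, 1)) t := by
      intro t
      refine ((hasDerivAt_pow j t).fun_mul (hd t)).congr_deriv ?_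
      ring
    have hFc : HasCompactSupport fun t => t ^ j * g (x, t) := hgtc.mul_left
    have hdF : deriv (fun t => t ^ j * g (x, t)) = fun t =>
        (j * (t ^ (j - 1) * g (x, t)) + t ^ j * fderiv ℝ g (x, t) (0, 1)) := by
      funext t
      exact (hF t).deriv
    have hcont : Continuous fun t => (j * (t ^ (j - 1) * g (x, t)) +
        t ^ j * fderiv ℝ g (x, t) (0, 1)) := by
      have h1 := hg.continuous
      have h2 := (hg.fderiv_apply_smooth (0, 1)).continuous
      fun_prop
    have hcs : HasCompactSupport fun t => (j * (t ^ (j - 1) * g (x, t)) +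
        t ^ j * fderiv ℝ g (x, t) (0, 1)) := by
      rw [← hdF]
      exact hFc.deriv
    rw [integral_Ioi_of_hasDerivAt_of_tendsto (f := fun t => t ^ j * g (x, t)) (m := 0)]
    · ring
    · exact (hF 0).continuousAt.continuousWithinAt
    · exact fun t _ => hF t
    · exact (hcont.integrable_of_hasCompactSupport hcs).integrableOn
    · have := hFc.is_zero_at_infty
      exact this.mono_left (by rw [cocompact_eq_atBot_atTop]; exact le_sup_right)
  rw [integral_add (hi2.const_mul _) hi, integral_const_mul, integral_neg, integral_const_mul] at hsum
  linarith

theorem integral_halfMeasure_iterate (h : ℕ → Euc N × ℝ → ℝ)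
    (hs : ∀ i, ContDiff ℝ (⊤ : ℕ∞) (h i)) (hc : ∀ i, HasCompactSupport (h i))
    (hd : ∀ i p, h (i + 1) p = fderiv ℝ (h i) p (0, 1)) (n i : ℕ) :
    ∫ p, p.2 ^ n * h (n + 1 + i) p ∂(halfMeasure N) =
      (-1) ^ (n + 1) * n.factorial * ∫ x, h i (x, 0) := by
  induction n with
  | zero =>
    have := integral_halfMeasure_fderiv_normal 0 (hs i) (hc i)
    simp only [← hd] at this
    rw [show 0 + 1 + i = i + 1 by ring, this]
    simp
  | succ n ih =>
    have := integral_halfMeasure_fderiv_normal (n + 1) (hs (n + 1 + i)) (hc (n + 1 + i))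
    simp only [← hd] at this
    rw [show n + 1 + 1 + i = n + 1 + i + 1 by ring, this, Nat.add_sub_cancel, ih,
      Nat.factorial_succ]
    push_cast
    ring

end HalfSpace

/-! ### Bounds for the extensions -/

section Holder

open scoped ENNReal

theorem lintegral_mul_prod_le_of_le {X : Type*} [MeasurableSpace X] {μ : Measure X} {r q : ℕ}
    (hq : 1 ≤ q) (hrq : r ≤ q) {w : X → ℝ≥0∞} (hw : AEMeasurable w μ)
    {F : Fin r → X → ℝ≥0∞} (hF : ∀ i, AEMeasurable (F i) μ) :
    ∫⁻ x, w x * ∏ i, F i x ∂μ ≤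
      (∫⁻ x, w x ∂μ) ^ (((q : ℝ) - r) / q) * ∏ i, (∫⁻ x, w x * F i x ^ q ∂μ) ^ (1 / (q : ℝ)) := by
  have hq0 : (0 : ℝ) < q := by exact_mod_cast hq
  have h0 : 0 ≤ ((q : ℝ) - r) / q := div_nonneg (sub_nonneg.2 (by exact_mod_cast hrq)) hq0.le
  have key := ENNReal.lintegral_mul_prod_norm_pow_le (μ := μ) (Finset.univ : Finset (Fin r)) hw
    (f := fun i x => w x * F i x ^ q) (fun i _ => hw.mul ((hF i).pow_const q)) (((q : ℝ) - r) / q)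
    (p := fun _ => 1 / (q : ℝ)) (by simp; field_simp; ring) h0 (fun _ _ => by positivity)
  refine le_trans (le_of_eq ?_) key
  refine lintegral_congr fun x => ?_
  have h1 : ∀ i, (w x * F i x ^ q) ^ (1 / (q : ℝ)) = w x ^ (1 / (q : ℝ)) * F i x := by
    intro i
    rw [ENNReal.mul_rpow_of_nonneg _ _ (by positivity), ← ENNReal.rpow_natCast (F i x),
      ← ENNReal.rpow_mul, mul_one_div_cancel hq0.ne', ENNReal.rpow_one]
  simp only [h1]
  rw [Finset.prod_mul_distrib, Finset.prod_const, Finset.card_univ, Fintype.card_fin,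
    ← ENNReal.rpow_natCast, ← ENNReal.rpow_mul, ← mul_assoc,
    ← ENNReal.rpow_add_of_nonneg _ _ h0 (by positivity)]
  have : ((q : ℝ) - r) / q + 1 / q * r = 1 := by field_simp; ring
  rw [this, ENNReal.rpow_one]

theorem lintegral_pow_le_mul_lintegral_pow {X : Type*} [MeasurableSpace X] {μ : Measure X} {q : ℕ}
    (hq : 1 ≤ q) {F : X → ℝ≥0∞} (hF : AEMeasurable F μ) :
    (∫⁻ x, F x ∂μ) ^ q ≤ μ Set.univ ^ (q - 1) * ∫⁻ x, F x ^ q ∂μ := by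
  have hq0 : (0 : ℝ) < q := by exact_mod_cast hq
  have := lintegral_mul_prod_le_of_le (μ := μ) (r := 1) hq hq (w := fun _ => 1) aemeasurable_const
    (F := fun _ => F) fun _ => hF
  simp only [one_mul, Finset.univ_unique, Finset.prod_const, Finset.card_singleton, pow_one,
    lintegral_const, Nat.cast_one] at this
  refine (pow_le_pow_left' this q).trans (le_of_eq ?_)
  rw [mul_pow, ← ENNReal.rpow_natCast, ← ENNReal.rpow_mul, ← ENNReal.rpow_natCast (_ ^ (1 / (q : ℝ))),
    ← ENNReal.rpow_mul, one_div_mul_cancel hq0.ne', ENNReal.rpow_one, div_mul_cancel₀ _ hq0.ne']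
  congr 1
  rw [← Nat.cast_one, ← Nat.cast_sub hq, ENNReal.rpow_natCast]

end Holder

section Words

variable {N : ℕ}

/-- The coordinate vectors of `ℝ^N × ℝ`; `none` is the last one. -/
def letterVec : Option (Fin N) → Euc N × ℝ
  | none => (0, 1)
  | some i => (EuclideanSpace.single i 1, 0)

/-- The word in the first `N` coordinates contained in a word. -/
def spatialPart (l : List (Option (Fin N))) : List (Fin N) := l.filterMap id

/-- The number of derivatives in the last coordinate in a word. -/
def normalCount (l : List (Option (Fin N))) : ℕ := l.countP fun a => a.isNone

theorem dirList_tensor {ψ : Euc N → ℝ} (hψ : ContDiff ℝ (⊤ : ℕ∞) ψ) {θ : ℝ → ℝ}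
    (hθ : ContDiff ℝ (⊤ : ℕ∞) θ) (l : List (Option (Fin N))) :
    dirList (l.map letterVec) (fun p : Euc N × ℝ => ψ p.1 * θ p.2) =
      fun p => pderivList (spatialPart l) ψ p.1 * iteratedDeriv (normalCount l) θ p.2 := by
  induction l with
  | nil =>
    funext p
    simp [dirList, spatialPart, normalCount, pderivList]
  | cons a l ih =>
    funext p
    simp only [List.map_cons, dirList, ih]
    have h1 : HasFDerivAt (fun p : Euc N × ℝ => pderivList (spatialPart l) ψ p.1)
        ((fderiv ℝ (pderivList (spatialPart l) ψ) p.1).comp (ContinuousLinearMap.fst ℝ (Euc N) ℝ)) p :=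
      HasFDerivAt.comp p (((pderivList_contDiff hψ _).differentiable (by simp)) p.1).hasFDerivAt
        (ContinuousLinearMap.fst ℝ (Euc N) ℝ).hasFDerivAt
    have h2 : HasFDerivAt (fun p : Euc N × ℝ => iteratedDeriv (normalCount l) θ p.2)
        ((iteratedDeriv (normalCount l + 1) θ p.2) • ContinuousLinearMap.snd ℝ (Euc N) ℝ) p := by
      have h3 : HasDerivAt (iteratedDeriv (normalCount l) θ) (iteratedDeriv (normalCount l + 1) θ p.2)
          p.2 := by
        rw [iteratedDeriv_succ]
        refine DifferentiableAt.hasDerivAt ?_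
        exact (hθ.differentiable_iteratedDeriv _ (by exact_mod_cast WithTop.coe_lt_top _)) _
      exact h3.comp_hasFDerivAt p (ContinuousLinearMap.snd ℝ (Euc N) ℝ).hasFDerivAt
    rw [(h1.fun_mul h2).fderiv]
    cases a with
    | none =>
      simp [letterVec, spatialPart, normalCount]
    | some i =>
      simp [letterVec, spatialPart, normalCount, pderivList, pderiv', mul_comm]

/-- The sum of the absolute differences of all partial derivatives of order `k`. -/
def diffSum (k : ℕ) (f : Euc N → ℝ) (x y : Euc N) : ℝ :=
  ∑ γ : Fin k → Fin N, |pderivList (List.ofFn γ) f x - pderivList (List.ofFn γ) f y|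

theorem diffSum_nonneg (k : ℕ) (f : Euc N → ℝ) (x y : Euc N) : 0 ≤ diffSum k f x y :=
  Finset.sum_nonneg fun _ _ => abs_nonneg _

theorem exists_abs_dirList_dilAvg_le {φ : Euc N → ℝ} (hφ : ContDiff ℝ (⊤ : ℕ∞) φ)
    (hφc : HasCompactSupport φ) (k d : ℕ) (hd : 0 < d) (l : List (Euc N × ℝ)) (hl : l.length = d + k) :
    ∃ C : ℝ, 0 ≤ C ∧ ∀ f : Euc N → ℝ, ContDiff ℝ (⊤ : ℕ∞) f → HasCompactSupport f → ∀ p, 0 < p.2 →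
      |dirList l (dilAvg f φ) p| ≤
        C * (p.2⁻¹ ^ d * ∫ z in tsupport φ, diffSum k f (p.1 - p.2 • z) p.1) := by
  obtain ⟨κ, hκ, h0, h⟩ := exists_kernel_dirList_append_dilAvg hφ hφc k (l.drop d)
    (by simp [hl]) (l.take d)
  have hc : ∀ γ, HasCompactSupport (κ γ) := fun γ =>
    hφc.of_isClosed_subset (isClosed_tsupport _) (hκ γ).2
  have hne : l.take d ≠ [] := by
    intro h
    have := congrArg List.length h
    simp [hl] at this
    omega
  rw [List.take_append_drop] at h
  have hlen : (l.take d).length = d := by simp [hl]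
  rw [hlen] at h
  have hM : ∀ γ, ∃ M, ∀ z, ‖κ γ z‖ ≤ M := fun γ =>
    (hκ γ).1.continuous.bounded_above_of_compact_support (hc γ)
  choose M hM using hM
  have hM0 : ∀ γ, 0 ≤ M γ := fun γ => (norm_nonneg _).trans (hM γ 0)
  refine ⟨∑ γ, M γ, Finset.sum_nonneg fun γ _ => hM0 γ, fun f hf hfc p hp => ?_⟩
  rw [h f hf hfc p hp, abs_mul, abs_of_nonneg (by positivity : 0 ≤ p.2⁻¹ ^ d), mul_left_comm]
  refine mul_le_mul_of_nonneg_left ?_ (by positivity)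
  refine (Finset.abs_sum_le_sum_abs _ _).trans ?_
  rw [Finset.sum_mul]
  refine Finset.sum_le_sum fun γ _ => ?_
  have hg : ∀ γ : Fin k → Fin N, Continuous (pderivList (List.ofFn γ) f) := fun γ =>
    (pderivList_contDiff hf _).continuous
  have hS : IsCompact (tsupport φ) := hφc
  have hdc : Continuous fun z => diffSum k f (p.1 - p.2 • z) p.1 := by
    unfold diffSum
    refine continuous_finsetSum _ fun γ _ => ?_
    have := hg γ
    fun_prop
  have e1 : dilAvg (pderivList (List.ofFn γ) f) (κ γ) p = ∫ z in tsupport φ,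
      (pderivList (List.ofFn γ) f (p.1 - p.2 • z) - pderivList (List.ofFn γ) f p.1) * κ γ z := by
    rw [setIntegral_eq_integral_of_forall_compl_eq_zero]
    · simp only [sub_mul]
      rw [integral_sub, integral_const_mul, h0 hne γ, mul_zero, sub_zero, dilAvg]
      · exact dilAvg_integrable (hg γ) (hκ γ).1.continuous (hc γ) p
      · exact ((hκ γ).1.continuous.integrable_of_hasCompactSupport (hc γ)).const_mul _
    · intro z hz
      rw [image_eq_zero_of_notMem_tsupport (f := κ γ) fun hh => hz ((hκ γ).2 hh), mul_zero]
  rw [e1, ← integral_const_mul, ← Real.norm_eq_abs]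
  refine norm_integral_le_of_norm_le ?_ (Filter.Eventually.of_forall fun z => ?_)
  · exact (hdc.continuousOn.integrableOn_compact hS).const_mul _
  · rw [norm_mul, mul_comm]
    refine mul_le_mul (hM γ z) ?_ (norm_nonneg _) (hM0 γ)
    exact Finset.single_le_sum (f := fun γ => |pderivList (List.ofFn γ) f (p.1 - p.2 • z) -
      pderivList (List.ofFn γ) f p.1|) (fun _ _ => abs_nonneg _) (Finset.mem_univ γ)

end Words

section FractionalCase

open scoped ENNReal

variable {N : ℕ}

/-- The `L^q` energy of the differences of the derivatives of order `k` at the points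
`x - t z` and `x`, with the weight which makes it comparable to a fractional seminorm. -/
def dilEnergy (K : Set (Euc N)) (t₀ : ℝ) (S : Set (Euc N)) (m k q : ℕ) (f : Euc N → ℝ) : ℝ≥0∞ :=
  ∫⁻ p in K ×ˢ Set.Ioo 0 t₀, ∫⁻ z in S, ENNReal.ofReal (p.2 ^ (m - 1) * (p.2⁻¹ ^ (m - k)) ^ q) *
    ENNReal.ofReal (diffSum k f (p.1 - p.2 • z) p.1) ^ q

theorem continuous_diffSum {f : Euc N → ℝ} (k : ℕ)
    (hf : ∀ γ : Fin k → Fin N, Continuous (pderivList (List.ofFn γ) f)) :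
    Continuous fun p : Euc N × Euc N => diffSum k f p.1 p.2 := by
  unfold diffSum
  refine continuous_finsetSum _ fun γ _ => ?_
  have := hf γ
  fun_prop

theorem lintegral_prod_dil_le {K : Set (Euc N)} (t₀ : ℝ) {S : Set (Euc N)}
    {m k q r : ℕ} (hq : 1 ≤ q) (hrq : r ≤ q) {f : Fin r → Euc N → ℝ}
    (hf : ∀ i (γ : Fin k → Fin N), Continuous (pderivList (List.ofFn γ) (f i)))
    (hK : MeasurableSet K) :
    ∫⁻ p in K ×ˢ Set.Ioo 0 t₀, ENNReal.ofReal (p.2 ^ (m - 1)) *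
        ∏ i, (ENNReal.ofReal (p.2⁻¹ ^ (m - k)) *
          ∫⁻ z in S, ENNReal.ofReal (diffSum k (f i) (p.1 - p.2 • z) p.1)) ≤
      (∫⁻ p in K ×ˢ Set.Ioo 0 t₀, ENNReal.ofReal (p.2 ^ (m - 1))) ^ (((q : ℝ) - r) / q) *
        ∏ i, (volume S ^ (q - 1) * dilEnergy K t₀ S m k q (f i)) ^ (1 / (q : ℝ)) := by
  have hc : ∀ i, Continuous fun x : (Euc N × ℝ) × Euc N =>
      diffSum k (f i) (x.1.1 - x.1.2 • x.2) x.1.1 := fun i =>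
    (continuous_diffSum k (hf i)).comp (f := fun x : (Euc N × ℝ) × Euc N =>
      (x.1.1 - x.1.2 • x.2, x.1.1)) (by fun_prop)
  have hI : ∀ i, Measurable fun p : Euc N × ℝ =>
      ∫⁻ z in S, ENNReal.ofReal (diffSum k (f i) (p.1 - p.2 • z) p.1) := fun i =>
    (hc i).measurable.ennreal_ofReal.lintegral_prod_right'
  refine (lintegral_mul_prod_le_of_le hq hrq ?_ fun i => ?_).trans ?_
  · exact (Measurable.ennreal_ofReal (by fun_prop)).aemeasurable
  · exact ((Measurable.ennreal_ofReal (by fun_prop)).mul (hI i)).aemeasurable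
  · gcongr with i _
    unfold dilEnergy
    rw [← lintegral_const_mul]
    · refine setLIntegral_mono_ae' (hK.prod measurableSet_Ioo) (Filter.Eventually.of_forall ?_)
      intro p hp
      have hp2 : 0 < p.2 := hp.2.1
      have hcp : Continuous fun z => diffSum k (f i) (p.1 - p.2 • z) p.1 :=
        (hc i).comp (f := fun z => (p, z)) (by fun_prop)
      have hm : Measurable fun z => ENNReal.ofReal (diffSum k (f i) (p.1 - p.2 • z) p.1) :=
        hcp.measurable.ennreal_ofReal
      have h1 := lintegral_pow_le_mul_lintegral_pow (μ := volume.restrict S) hq hm.aemeasurable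
      rw [Measure.restrict_apply_univ] at h1
      rw [lintegral_const_mul _ (hm.pow_const q), mul_pow, ENNReal.ofReal_mul (by positivity),
        ENNReal.ofReal_pow (by positivity : 0 ≤ p.2⁻¹ ^ (m - k))]
      calc _ ≤ ENNReal.ofReal (p.2 ^ (m - 1)) * (ENNReal.ofReal (p.2⁻¹ ^ (m - k)) ^ q *
            (volume S ^ (q - 1) *
              ∫⁻ z in S, ENNReal.ofReal (diffSum k (f i) (p.1 - p.2 • z) p.1) ^ q)) := by
            gcongr
        _ = _ := by ring
    · refine Measurable.lintegral_prod_right' (f := fun x : (Euc N × ℝ) × Euc N =>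
        ENNReal.ofReal (x.1.2 ^ (m - 1) * (x.1.2⁻¹ ^ (m - k)) ^ q) *
        ENNReal.ofReal (diffSum k (f i) (x.1.1 - x.1.2 • x.2) x.1.1) ^ q) ?_
      exact (Measurable.ennreal_ofReal (by fun_prop)).mul
        ((hc i).measurable.ennreal_ofReal.pow_const q)

theorem exists_abs_integral_jacFam_le_dilEnergy {m k q r : ℕ} (hkm : k < m) (hq : 1 ≤ q)
    (hrq : r ≤ q) (α : Fin m → Fin r → Fin N) {φ : Euc N → ℝ} (hφ : ContDiff ℝ (⊤ : ℕ∞) φ)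
    (hφc : HasCompactSupport φ) (hφ1 : ∫ z, φ z = 1) {t₀ : ℝ} (ht₀ : 0 < t₀) :
    ∃ C : ℝ≥0∞, C ≠ ⊤ ∧ ∀ (f : Fin r → Euc N → ℝ), (∀ i, ContDiff ℝ (⊤ : ℕ∞) (f i)) →
      (∀ i, HasCompactSupport (f i)) → ∀ (ψ : Euc N → ℝ), ContDiff ℝ (⊤ : ℕ∞) ψ →
      HasCompactSupport ψ → ∀ (K : Set (Euc N)), MeasurableSet K → tsupport ψ ⊆ K → ∀ B : ℝ,
      (∀ l : List (Fin N), l.length ≤ m → ∀ x, |pderivList l ψ x| ≤ B) →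
      ENNReal.ofReal |∫ x, ψ x * jacFam (coordDir α) f x| ≤
        C * ENNReal.ofReal B *
          ((∫⁻ p in K ×ˢ Set.Ioo 0 t₀, ENNReal.ofReal (p.2 ^ (m - 1))) ^ (((q : ℝ) - r) / q) *
        ∏ i, dilEnergy K t₀ (tsupport φ) m k q (f i) ^ (1 / (q : ℝ))) := by
  classical
  obtain ⟨d, hd, hdm⟩ : ∃ d, 0 < d ∧ m = d + k := ⟨m - k, by omega, by omega⟩
  have hmk : m - k = d := by omega
  -- the cut-off in the normal variable
  let bθ : ContDiffBump (0 : ℝ) := ⟨t₀ / 4, t₀ / 2, by positivity, by linarith⟩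
  set θ : ℝ → ℝ := fun t => bθ t with hθ
  have hθs : ContDiff ℝ (⊤ : ℕ∞) θ := bθ.contDiff
  have hθc : HasCompactSupport θ := bθ.hasCompactSupport
  have hθ0 : θ 0 = 1 := bθ.one_of_mem_closedBall (by simp [bθ]; positivity)
  have hθt : ∀ t, t₀ ≤ t → θ t = 0 := by
    intro t ht
    refine bθ.zero_of_le_dist ?_
    simp only [dist_zero_right, Real.norm_eq_abs, bθ]
    exact le_trans (by linarith) (le_abs_self t)
  have hMθ : ∀ j, ∃ M, ∀ t, ‖iteratedDeriv j θ t‖ ≤ M := by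
    intro j
    have h1 : HasCompactSupport (iteratedFDeriv ℝ j θ) := hθc.iteratedFDeriv j
    obtain ⟨M, hM⟩ := (hθs.continuous_iteratedFDeriv (m := j) (by exact_mod_cast le_top)).bounded_above_of_compact_support h1
    exact ⟨M, fun t => by rw [← norm_iteratedFDeriv_eq_norm_iteratedDeriv]; exact hM t⟩
  choose Mθ hMθ using hMθ
  have hMθ0 : ∀ j, 0 ≤ Mθ j := fun j => (norm_nonneg _).trans (hMθ j 0)
  set Cθ := ∑ j ∈ Finset.range (m + 1), Mθ j
  have hCθ0 : 0 ≤ Cθ := Finset.sum_nonneg fun j _ => hMθ0 j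
  -- words
  set L : Fin m → Fin (r + 1) → Option (Fin N) := fun j => Fin.cons none fun c => some (α j c)
  set W : (Fin m → Equiv.Perm (Fin (r + 1))) → Fin (r + 1) → List (Option (Fin N)) := fun σ i =>
    List.ofFn fun j => L j (σ j i)
  have hWlen : ∀ σ i, (W σ i).length = m := fun σ i => by simp [W]
  have hCW : ∀ σ i, ∃ C : ℝ, 0 ≤ C ∧ ∀ f : Euc N → ℝ, ContDiff ℝ (⊤ : ℕ∞) f → HasCompactSupport f →
      ∀ p, 0 < p.2 → |dirList ((W σ i).map letterVec) (dilAvg f φ) p| ≤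
        C * (p.2⁻¹ ^ d * ∫ z in tsupport φ, diffSum k f (p.1 - p.2 • z) p.1) := fun σ i =>
    exists_abs_dirList_dilAvg_le hφ hφc k d hd _ (by rw [List.length_map, hWlen, hdm])
  choose CW hCW0 hCW using hCW
  set D := ∑ σ, ∑ i, CW σ i
  have hCWD : ∀ σ i, CW σ i ≤ D := fun σ i =>
    (Finset.single_le_sum (f := fun i => CW σ i) (fun i _ => hCW0 σ i) (Finset.mem_univ i)).trans
      (Finset.single_le_sum (f := fun σ => ∑ i, CW σ i)
        (fun σ _ => Finset.sum_nonneg fun i _ => hCW0 σ i) (Finset.mem_univ σ))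
  have hD0 : 0 ≤ D := Finset.sum_nonneg fun σ _ => Finset.sum_nonneg fun i _ => hCW0 σ i
  set A : ℝ := Fintype.card (Fin m → Equiv.Perm (Fin (r + 1))) * (Cθ * D ^ r)
  have hA0 : 0 ≤ A := by positivity
  have hS : IsCompact (tsupport φ) := hφc
  refine ⟨ENNReal.ofReal A * ∏ _i : Fin r, (volume (tsupport φ) ^ (q - 1)) ^ (1 / (q : ℝ)), ?_, ?_⟩
  · refine ENNReal.mul_ne_top ENNReal.ofReal_ne_top (ENNReal.prod_ne_top fun i _ => ?_)
    exact ENNReal.rpow_ne_top_of_nonneg (by positivity) (ENNReal.pow_ne_top hS.measure_lt_top.ne)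
  intro f hf hfc ψ hψ hψc K hK hψK B hB
  have hB0 : 0 ≤ B := (abs_nonneg _).trans (hB [] (by simp) 0)
  set G : Fin (r + 1) → smoothFun (Euc N × ℝ) :=
    Fin.cons ⟨fun p => ψ p.1 * θ p.2, (hψ.comp contDiff_fst).mul (hθs.comp contDiff_snd)⟩
      fun i => ⟨dilAvg (f i) φ, dilAvg_contDiff (hf i) (hfc i) hφ.continuous hφc⟩ with hG
  have hG0 : HasCompactSupport (G 0 : Euc N × ℝ → ℝ) := by
    refine HasCompactSupport.intro (hψc.isCompact.prod hθc.isCompact) ?_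
    intro p hp
    change ψ p.1 * θ p.2 = 0
    by_cases h1 : p.1 ∈ tsupport ψ
    · have h2 : p.2 ∉ tsupport θ := fun h2 => hp ⟨h1, h2⟩
      rw [image_eq_zero_of_notMem_tsupport h2, mul_zero]
    · rw [image_eq_zero_of_notMem_tsupport h1, zero_mul]
  set a : Fin m → Fin r → Euc N × ℝ := fun j c => (EuclideanSpace.single (α j c) 1, 0) with ha
  set Cc : Fin m → Fin (r + 1) → OpRing (Fin (r + 1) → Euc N × ℝ) := fun _ i => slotOp i [(0, 1)]
  have hmat : ∀ j, colMatrix (Cc j) (a j) =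
      Matrix.of fun i c => (1 : ℝ) • slotOp i [letterVec (L j c)] := by
    intro j
    ext i c
    refine Fin.cases ?_ (fun c => ?_) c
    · simp [colMatrix, Cc, L, letterVec]
    · simp [colMatrix, L, a, letterVec]
  set b := ∏ j, ((colMatrix (Cc j) (a j)).submatrix Fin.succ Fin.succ).det
  set T : OpRing (Fin (r + 1) → Euc N × ℝ) := dirOp fun _ => (0, 1)
  have hT : ∏ j, ∑ i, Cc j i = T ^ m := by
    simp only [Cc, slotOp_singleton, sum_dirOp_single]
    simp [T]
  have key := functional_prod_det (fun g => ∫ p, p.2 ^ (m - 1) * g p ∂(halfMeasure N)) a ?_ ?_ Cc G hG0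
  rotate_left
  · intro g h hg hgc hh hhc
    simp only [mul_add]
    exact integral_add (integrable_pow_mul_halfMeasure _ hg.continuous hgc)
      (integrable_pow_mul_halfMeasure _ hh.continuous hhc)
  · intro g hg hgc j c
    exact integral_halfMeasure_fderiv_spatial _ hg hgc _
  rw [hT] at key
  set h : ℕ → Euc N × ℝ → ℝ := fun i p => (opApp (T ^ i * b) (tens G) :
    (Fin (r + 1) → Euc N × ℝ) → ℝ) fun _ => p with hh
  have hiter := integral_halfMeasure_iterate h (fun i => contDiff_diag _)
    (fun i => hasCompactSupport_diag _ G hG0) (fun i p => by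
      simp only [hh]
      rw [fderiv_diag, pow_succ', mul_assoc, opApp_mul]) (m - 1) 0
  have h0 : ∀ x, h 0 (x, 0) = ψ x * jacFam (coordDir α) f x := by
    intro x
    simp only [hh, pow_zero, one_mul, b]
    rw [opApp_prod_det_submatrix_tens_diag]
    have e1 : (G 0 : Euc N × ℝ → ℝ) (x, 0) = ψ x := by
      change ψ x * θ 0 = ψ x
      rw [hθ0, mul_one]
    rw [e1]
    congr 1
    simp only [jacFam]
    refine Finset.sum_congr rfl fun τ _ => ?_
    congr 1
    refine Finset.prod_congr rfl fun i _ => ?_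
    have e2 : (List.ofFn fun s => a s (τ s i)) = (List.ofFn fun s => α s (τ s i)).map fun i =>
        ((EuclideanSpace.single i 1 : Euc N), (0 : ℝ)) := by
      rw [List.map_ofFn]
      rfl
    have e3 : (List.ofFn fun s => coordDir α s (τ s i)) = (List.ofFn fun s => α s (τ s i)).map fun i =>
        ((EuclideanSpace.single i 1 : Euc N)) := by
      rw [List.map_ofFn]
      rfl
    rw [e2, e3, ← pderivList_eq_dirList]
    change dirList _ (dilAvg (f i) φ) (x, 0) = _
    rw [dirList_dilAvg_spatial (hf i) (hfc i) hφ.continuous hφc, dilAvg]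
    simp only [zero_smul, sub_zero]
    rw [integral_const_mul, hφ1, mul_one]
  simp only [h0, add_zero] at hiter
  have hm1 : m - 1 + 1 = m := by omega
  rw [hm1] at hiter
  have hkey2 : ∫ p, p.2 ^ (m - 1) * (opApp (∏ j, (colMatrix (Cc j) (a j)).det) (tens G) :
      (Fin (r + 1) → Euc N × ℝ) → ℝ) (fun _ => p) ∂(halfMeasure N) =
      (-1) ^ m * (m - 1).factorial * ∫ x, ψ x * jacFam (coordDir α) f x := by
    rw [← hiter]
    exact key
  have habs : |∫ x, ψ x * jacFam (coordDir α) f x| ≤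
      |∫ p, p.2 ^ (m - 1) * (opApp (∏ j, (colMatrix (Cc j) (a j)).det) (tens G) :
      (Fin (r + 1) → Euc N × ℝ) → ℝ) (fun _ => p) ∂(halfMeasure N)| := by
    rw [hkey2, abs_mul, abs_mul, abs_pow, abs_neg, abs_one, one_pow, one_mul]
    refine le_mul_of_one_le_left (abs_nonneg _) ?_
    rw [Nat.abs_cast]
    exact_mod_cast Nat.one_le_iff_ne_zero.2 (Nat.factorial_ne_zero _)
  set g : Euc N × ℝ → ℝ := fun p => (opApp (∏ j, (colMatrix (Cc j) (a j)).det) (tens G) :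
      (Fin (r + 1) → Euc N × ℝ) → ℝ) (fun _ => p) with hg
  have hbound : ∀ p : Euc N × ℝ, 0 < p.2 → |g p| ≤ ∑ σ : Fin m → Equiv.Perm (Fin (r + 1)),
      |pderivList (spatialPart (W σ 0)) ψ p.1 * iteratedDeriv (normalCount (W σ 0)) θ p.2| *
        ∏ i, (D * (p.2⁻¹ ^ d * ∫ z in tsupport φ, diffSum k (f i) (p.1 - p.2 • z) p.1)) := by
    intro p hp
    simp only [hg, hmat]
    refine (abs_opApp_prod_det_tens_le _ _ _ _).trans ?_
    simp only [Finset.prod_const_one, abs_one, one_mul, List.flatten_ofFn_singleton]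
    refine Finset.sum_le_sum fun σ _ => ?_
    have e1 : ∀ i, (List.ofFn fun j => letterVec (L j (σ j i))) = (W σ i).map letterVec := by
      intro i
      rw [List.map_ofFn]
      rfl
    simp only [e1]
    rw [Fin.prod_univ_succ]
    refine mul_le_mul (le_of_eq ?_) ?_ (Finset.prod_nonneg fun _ _ => abs_nonneg _) (abs_nonneg _)
    · change |dirList _ (fun p : Euc N × ℝ => ψ p.1 * θ p.2) p| = _
      rw [dirList_tensor hψ hθs]
    · refine Finset.prod_le_prod (fun _ _ => abs_nonneg _) fun i _ => ?_
      refine (hCW σ i.succ (f i) (hf i) (hfc i) p hp).trans ?_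
      refine mul_le_mul_of_nonneg_right (hCWD _ _) ?_
      exact mul_nonneg (by positivity) (integral_nonneg fun z => diffSum_nonneg _ _ _ _)
  have hcount : ∀ σ, (spatialPart (W σ 0)).length ≤ m ∧ normalCount (W σ 0) < m + 1 := by
    intro σ
    refine ⟨(List.length_filterMap_le _ _).trans (hWlen σ 0).le, ?_⟩
    exact Nat.lt_succ_of_le ((List.countP_le_length).trans (hWlen σ 0).le)
  have hbound2 : ∀ p ∈ K ×ˢ Set.Ioo 0 t₀, |g p| ≤ A * B *
      ∏ i, (p.2⁻¹ ^ d * ∫ z in tsupport φ, diffSum k (f i) (p.1 - p.2 • z) p.1) := by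
    intro p hp
    refine (hbound p hp.2.1).trans ?_
    have hP : 0 ≤ ∏ i, (p.2⁻¹ ^ d * ∫ z in tsupport φ, diffSum k (f i) (p.1 - p.2 • z) p.1) := by
      refine Finset.prod_nonneg fun i _ => mul_nonneg ?_ (integral_nonneg fun z => diffSum_nonneg _ _ _ _)
      have := hp.2.1
      positivity
    calc _ ≤ ∑ σ : Fin m → Equiv.Perm (Fin (r + 1)), (B * Cθ) * (D ^ r *
          ∏ i, (p.2⁻¹ ^ d * ∫ z in tsupport φ, diffSum k (f i) (p.1 - p.2 • z) p.1)) := by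
          refine Finset.sum_le_sum fun σ _ => ?_
          rw [Finset.prod_mul_distrib, Finset.prod_const, Finset.card_univ, Fintype.card_fin]
          refine mul_le_mul_of_nonneg_right ?_ (mul_nonneg (pow_nonneg hD0 _) hP)
          rw [abs_mul]
          refine mul_le_mul (hB _ (hcount σ).1 _) ?_ (abs_nonneg _) hB0
          refine (hMθ _ _).trans ?_
          exact Finset.single_le_sum (fun j _ => hMθ0 j) (Finset.mem_range.2 (hcount σ).2)
      _ = _ := by
          rw [Finset.sum_const, Finset.card_univ, nsmul_eq_mul]
          simp only [A]
          ring
  have hzero : ∀ p : Euc N × ℝ, 0 < p.2 → p ∉ K ×ˢ Set.Ioo 0 t₀ → g p = 0 := by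
    intro p hp hpn
    have hU : IsOpen {y : Fin (r + 1) → Euc N × ℝ | y 0 ∉ tsupport (G 0 : Euc N × ℝ → ℝ)} :=
      ((isClosed_tsupport _).preimage (continuous_apply 0)).isOpen_compl
    refine opApp_eq_zero_of_isOpen hU _ _ ?_ _ ?_
    · intro y hy
      rw [tens_apply, Fin.prod_univ_succ, image_eq_zero_of_notMem_tsupport hy, zero_mul]
    · intro hmem
      apply hpn
      have hsub : tsupport (G 0 : Euc N × ℝ → ℝ) ⊆ tsupport ψ ×ˢ tsupport θ := by
        refine closure_minimal ?_ ((isClosed_tsupport _).prod (isClosed_tsupport _))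
        intro p hp
        have hp' : ψ p.1 * θ p.2 ≠ 0 := hp
        exact ⟨subset_tsupport _ (left_ne_zero_of_mul hp'), subset_tsupport _ (right_ne_zero_of_mul hp')⟩
      have h1 := hsub hmem
      refine ⟨hψK h1.1, hp, ?_⟩
      have h2 : p.2 ∈ tsupport θ := h1.2
      rw [bθ.tsupport_eq] at h2
      have h3 : |p.2| ≤ t₀ / 2 := by simpa using h2
      linarith [le_abs_self p.2]
  have hmeas : halfMeasure N = volume.restrict (Set.univ ×ˢ Set.Ioi (0 : ℝ)) := by
    rw [halfMeasure, Measure.volume_eq_prod, ← Measure.prod_restrict, Measure.restrict_univ]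
  have hKm : MeasurableSet (K ×ˢ Set.Ioo 0 t₀) := hK.prod measurableSet_Ioo
  calc ENNReal.ofReal |∫ x, ψ x * jacFam (coordDir α) f x|
      ≤ ENNReal.ofReal |∫ p, p.2 ^ (m - 1) * g p ∂(halfMeasure N)| := ENNReal.ofReal_le_ofReal habs
    _ ≤ ∫⁻ p, ENNReal.ofReal |p.2 ^ (m - 1) * g p| ∂(halfMeasure N) := by
        rw [← Real.norm_eq_abs, ofReal_norm]
        refine (enorm_integral_le_lintegral_enorm _).trans (le_of_eq ?_)
        refine lintegral_congr fun p => ?_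
        rw [← Real.norm_eq_abs, ofReal_norm]
    _ ≤ ∫⁻ p in K ×ˢ Set.Ioo 0 t₀, ENNReal.ofReal |p.2 ^ (m - 1) * g p| := by
        rw [hmeas, ← lintegral_indicator (MeasurableSet.univ.prod measurableSet_Ioi),
          ← lintegral_indicator hKm]
        refine lintegral_mono fun p => ?_
        by_cases hp : p ∈ K ×ˢ Set.Ioo 0 t₀
        · rw [Set.indicator_of_mem hp]
          exact Set.indicator_le_self' (fun _ _ => zero_le) _
        · rw [Set.indicator_of_notMem hp]
          by_cases hp2 : 0 < p.2
          · rw [Set.indicator_of_mem (by exact ⟨trivial, hp2⟩), hzero p hp2 hp]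
            simp
          · rw [Set.indicator_of_notMem fun hh => hp2 hh.2]
    _ ≤ ∫⁻ p in K ×ˢ Set.Ioo 0 t₀, ENNReal.ofReal A * ENNReal.ofReal B *
        (ENNReal.ofReal (p.2 ^ (m - 1)) * ∏ i, (ENNReal.ofReal (p.2⁻¹ ^ (m - k)) *
          ∫⁻ z in tsupport φ, ENNReal.ofReal (diffSum k (f i) (p.1 - p.2 • z) p.1))) := by
        refine setLIntegral_mono_ae' hKm (Filter.Eventually.of_forall fun p hp => ?_)
        have hp2 : 0 < p.2 := hp.2.1
        have hI : ∀ i, ENNReal.ofReal (∫ z in tsupport φ, diffSum k (f i) (p.1 - p.2 • z) p.1) =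
            ∫⁻ z in tsupport φ, ENNReal.ofReal (diffSum k (f i) (p.1 - p.2 • z) p.1) := by
          intro i
          refine ofReal_integral_eq_lintegral_ofReal ?_
            (Filter.Eventually.of_forall fun z => diffSum_nonneg _ _ _ _)
          have hc : Continuous fun z => diffSum k (f i) (p.1 - p.2 • z) p.1 :=
            (continuous_diffSum k fun γ => (pderivList_contDiff (hf i) _).continuous).comp
              (f := fun z => (p.1 - p.2 • z, p.1)) (by fun_prop)
          exact hc.continuousOn.integrableOn_compact hS
        rw [abs_mul, abs_of_pos (pow_pos hp2 _), hmk]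
        calc ENNReal.ofReal (p.2 ^ (m - 1) * |g p|) ≤ ENNReal.ofReal (p.2 ^ (m - 1) * (A * B *
              ∏ i, (p.2⁻¹ ^ d * ∫ z in tsupport φ, diffSum k (f i) (p.1 - p.2 • z) p.1))) := by
              refine ENNReal.ofReal_le_ofReal ?_
              exact mul_le_mul_of_nonneg_left (hbound2 p hp) (by positivity)
          _ = _ := by
              rw [ENNReal.ofReal_mul (by positivity), ENNReal.ofReal_mul (by positivity),
                ENNReal.ofReal_mul hA0, ENNReal.ofReal_prod_of_nonneg]
              · simp only [ENNReal.ofReal_mul (pow_nonneg (inv_nonneg.2 hp2.le) d), hI]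
                ring
              · exact fun i _ => mul_nonneg (by positivity)
                  (integral_nonneg fun z => diffSum_nonneg _ _ _ _)
    _ ≤ _ := by
        rw [lintegral_const_mul' _ _ (ENNReal.mul_ne_top ENNReal.ofReal_ne_top ENNReal.ofReal_ne_top)]
        refine (mul_le_mul_right (lintegral_prod_dil_le t₀ hq hrq
          (fun i γ => (pderivList_contDiff (hf i) _).continuous) hK) _).trans (le_of_eq ?_)
        simp only [ENNReal.mul_rpow_of_nonneg _ _ (by positivity : 0 ≤ 1 / (q : ℝ)),
          Finset.prod_mul_distrib]
        ring

end FractionalCase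

section Mollification

variable {N : ℕ}

theorem contDiff_pderivList {m n : ℕ} {f : Euc N → ℝ} (hf : ContDiff ℝ m f) (l : List (Fin N))
    (hl : n + l.length ≤ m) : ContDiff ℝ n (pderivList l f) := by
  induction l generalizing n with
  | nil => exact hf.of_le (by exact_mod_cast hl)
  | cons i l ih =>
    have h1 : ContDiff ℝ ((n + 1 : ℕ) : WithTop ℕ∞) (pderivList l f) :=
      ih (by simp only [List.length_cons] at hl; omega)
    exact (h1.fderiv_right (m := n) (by norm_cast)).clm_apply contDiff_const

theorem continuous_pderivList {m : ℕ} {f : Euc N → ℝ} (hf : ContDiff ℝ m f) (l : List (Fin N))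
    (hl : l.length ≤ m) : Continuous (pderivList l f) :=
  (contDiff_pderivList (n := 0) hf l (by simpa using hl)).continuous

theorem exists_abs_pderivList_le {m : ℕ} {f : Euc N → ℝ} (hf : ContDiff ℝ m f)
    (hfc : HasCompactSupport f) :
    ∃ M : ℝ, 0 ≤ M ∧ ∀ l : List (Fin N), l.length ≤ m → ∀ x, |pderivList l f x| ≤ M := by
  have hfin : {l : List (Fin N) | l.length ≤ m}.Finite := List.finite_length_le _ _
  have h1 : ∀ l ∈ {l : List (Fin N) | l.length ≤ m}, ∃ M, ∀ x, |pderivList l f x| ≤ M := by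
    intro l hl
    exact (continuous_pderivList hf l hl).bounded_above_of_compact_support
      (pderivList_hasCompactSupport hfc l)
  choose! M hM using h1
  refine ⟨∑ l ∈ hfin.toFinset, |M l|, Finset.sum_nonneg fun _ _ => abs_nonneg _, fun l hl x => ?_⟩
  refine (hM l hl x).trans ((le_abs_self _).trans ?_)
  exact Finset.single_le_sum (f := fun l => |M l|) (fun _ _ => abs_nonneg _)
    (hfin.mem_toFinset.2 hl)

open scoped Convolution in
theorem pderivList_convolution {m : ℕ} {f φ : Euc N → ℝ} (hf : ContDiff ℝ m f)
    (hfc : HasCompactSupport f) (hφ : Continuous φ) (l : List (Fin N)) (hl : l.length ≤ m) :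
    pderivList l (φ ⋆[ContinuousLinearMap.lsmul ℝ ℝ, volume] f) =
      φ ⋆[ContinuousLinearMap.lsmul ℝ ℝ, volume] (pderivList l f) := by
  induction l with
  | nil => rfl
  | cons i l ih =>
    simp only [List.length_cons] at hl
    have h1 : ContDiff ℝ 1 (pderivList l f) := by
      exact_mod_cast contDiff_pderivList (n := 1) hf l (by omega)
    have hc := pderivList_hasCompactSupport hfc l
    funext x
    change fderiv ℝ (pderivList l _) x _ = _
    rw [ih (by omega), (hc.hasFDerivAt_convolution_right _ hφ.locallyIntegrable h1 x).fderiv,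
      convolution_precompR_apply _ hφ.locallyIntegrable (hc.fderiv ℝ)
        (h1.continuous_fderiv (by simp))]
    rfl

open scoped Convolution in
theorem exists_smooth_approx {m : ℕ} {f : Euc N → ℝ} (hf : ContDiff ℝ m f)
    (hfc : HasCompactSupport f) {δ : ℝ} (hδ : 0 < δ) :
    ∃ F : ℕ → Euc N → ℝ, (∀ n, ContDiff ℝ (⊤ : ℕ∞) (F n)) ∧ (∀ n, HasCompactSupport (F n)) ∧
      (∀ n, tsupport (F n) ⊆ Metric.cthickening δ (tsupport f)) ∧
      (∀ l : List (Fin N), l.length ≤ m → ∀ x,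
        Tendsto (fun n => pderivList l (F n) x) atTop (𝓝 (pderivList l f x))) ∧
      ∀ l : List (Fin N), l.length ≤ m → ∀ M, (∀ x, |pderivList l f x| ≤ M) →
        ∀ n x, |pderivList l (F n) x| ≤ M := by
  let b : ℕ → ContDiffBump (0 : Euc N) := fun n =>
    ⟨δ / (n + 1) / 2, δ / (n + 1), by positivity, by
      have : 0 < δ / (n + 1) := by positivity
      linarith⟩
  have hout : ∀ n, (b n).rOut = δ / (n + 1) := fun n => rfl
  have hle : ∀ n, (b n).rOut ≤ δ := fun n => by
    rw [hout]
    exact div_le_self hδ.le (by linarith [(Nat.cast_nonneg n : (0 : ℝ) ≤ n)])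
  have htend : Tendsto (fun n => (b n).rOut) atTop (𝓝 0) := by
    simp only [hout]
    exact tendsto_const_div_atTop_nhds_zero_nat δ |>.comp (tendsto_add_atTop_nat 1) |>.congr
      fun n => by simp
  have hbc : ∀ n, Continuous ((b n).normed volume) := fun n => (b n).continuous_normed
  refine ⟨fun n => (b n).normed volume ⋆[ContinuousLinearMap.lsmul ℝ ℝ, volume] f, ?_, ?_, ?_, ?_, ?_⟩
  · intro n
    exact (b n).hasCompactSupport_normed.contDiff_convolution_left _ (b n).contDiff_normed
      hf.continuous.locallyIntegrable
  · intro n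
    exact (b n).hasCompactSupport_normed.convolution _ hfc
  · intro n
    refine closure_minimal ?_ Metric.isClosed_cthickening
    refine (support_convolution_subset _).trans ?_
    rintro _ ⟨y, hy, z, hz, rfl⟩
    refine Metric.mem_cthickening_of_dist_le _ z _ _ (subset_tsupport _ hz) ?_
    rw [(b n).support_normed_eq] at hy
    have hy' : ‖y‖ < (b n).rOut := by simpa using hy
    simpa using hy'.le.trans (hle n)
  · intro l hl x
    simp only [fun n => pderivList_convolution hf hfc (hbc n) l hl]
    exact ContDiffBump.convolution_tendsto_right_of_continuous htend
      (continuous_pderivList hf l hl) x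
  · intro l hl M hM n x
    rw [pderivList_convolution hf hfc (hbc n) l hl, convolution_def]
    have h1 : ∀ t, ‖(b n).normed volume t • pderivList l f (x - t)‖ ≤ (b n).normed volume t * M := by
      intro t
      rw [norm_smul, Real.norm_eq_abs, Real.norm_eq_abs, abs_of_nonneg ((b n).nonneg_normed t)]
      exact mul_le_mul_of_nonneg_left (hM _) ((b n).nonneg_normed t)
    have h2 := norm_integral_le_of_norm_le ((b n).integrable_normed.mul_const M)
      (Filter.Eventually.of_forall h1)
    rwa [integral_mul_const, (b n).integral_normed, one_mul] at h2

end Mollification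

section PassageToTheLimit

open scoped ENNReal

variable {N m r : ℕ}

theorem jacFam_coordDir (α : Fin m → Fin r → Fin N) (f : Fin r → Euc N → ℝ) (x : Euc N) :
    jacFam (coordDir α) f x =
      ∑ τ : Fin m → Equiv.Perm (Fin r), (∏ s, ((Equiv.Perm.sign (τ s) : ℤ) : ℝ)) *
        ∏ k, pderivList (List.ofFn fun s => α s (τ s k)) (f k) x := by
  simp only [jacFam, pderivList_eq_dirList, List.map_ofFn]
  rfl

theorem continuous_jacFam_coordDir (α : Fin m → Fin r → Fin N) {f : Fin r → Euc N → ℝ}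
    (hf : ∀ i, ContDiff ℝ m (f i)) : Continuous (jacFam (coordDir α) f) := by
  have h : ∀ (τ : Fin m → Equiv.Perm (Fin r)) k,
      Continuous (pderivList (List.ofFn fun s => α s (τ s k)) (f k)) := fun τ k =>
    continuous_pderivList (hf k) _ (by simp)
  have : jacFam (coordDir α) f = fun x => _ := funext (jacFam_coordDir α f)
  rw [this]
  fun_prop

theorem abs_jacFam_coordDir_le (α : Fin m → Fin r → Fin N) {f : Fin r → Euc N → ℝ} {M : ℝ}
    {x : Euc N} (hM : ∀ i (l : List (Fin N)), l.length ≤ m → |pderivList l (f i) x| ≤ M) :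
    |jacFam (coordDir α) f x| ≤ Fintype.card (Fin m → Equiv.Perm (Fin r)) * M ^ r := by
  rw [jacFam_coordDir]
  refine (Finset.abs_sum_le_sum_abs _ _).trans ?_
  rw [← nsmul_eq_mul]
  refine Finset.sum_le_card_nsmul _ _ _ fun τ _ => ?_
  have h : |∏ j, ((Equiv.Perm.sign (τ j) : ℤ) : ℝ)| = 1 := by
    rw [Finset.abs_prod]
    refine Finset.prod_eq_one fun j _ => ?_
    rcases Int.units_eq_one_or (Equiv.Perm.sign (τ j)) with h | h <;> simp [h]
  rw [abs_mul, h, one_mul, Finset.abs_prod]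
  refine (Finset.prod_le_prod (fun _ _ => abs_nonneg _) fun k _ => hM k _ (by simp)).trans ?_
  rw [Finset.prod_const, Finset.card_univ, Fintype.card_fin]

theorem tendsto_integral_mul_jacFam (α : Fin m → Fin r → Fin N) {f : Fin r → Euc N → ℝ}
    {ψ : Euc N → ℝ} {F : Fin r → ℕ → Euc N → ℝ} {Ψ : ℕ → Euc N → ℝ} {K : Set (Euc N)}
    (hK : IsCompact K) (hΨ : ∀ n, Continuous (Ψ n)) (hΨK : ∀ n, tsupport (Ψ n) ⊆ K)
    (hF : ∀ i n, ContDiff ℝ m (F i n))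
    (hFt : ∀ i (l : List (Fin N)), l.length ≤ m → ∀ x,
      Tendsto (fun n => pderivList l (F i n) x) atTop (𝓝 (pderivList l (f i) x)))
    (hΨt : ∀ x, Tendsto (fun n => Ψ n x) atTop (𝓝 (ψ x))) {M B : ℝ} (hB : ∀ n x, |Ψ n x| ≤ B)
    (hM : ∀ i (l : List (Fin N)), l.length ≤ m → ∀ n x, |pderivList l (F i n) x| ≤ M) :
    Tendsto (fun n => ∫ x, Ψ n x * jacFam (coordDir α) (fun i => F i n) x) atTop
      (𝓝 (∫ x, ψ x * jacFam (coordDir α) f x)) := by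
  have hB0 : 0 ≤ B := (abs_nonneg _).trans (hB 0 0)
  refine tendsto_integral_of_dominated_convergence
    (K.indicator fun _ => B * (Fintype.card (Fin m → Equiv.Perm (Fin r)) * M ^ r)) ?_ ?_ ?_ ?_
  · intro n
    exact ((hΨ n).mul (continuous_jacFam_coordDir α fun i => hF i n)).aestronglyMeasurable
  · exact (integrable_indicator_iff hK.measurableSet).2 (integrableOn_const hK.measure_lt_top.ne)
  · intro n
    refine Filter.Eventually.of_forall fun x => ?_
    by_cases hx : x ∈ K
    · rw [Set.indicator_of_mem hx, norm_mul]
      exact mul_le_mul (hB n x) (abs_jacFam_coordDir_le α fun i l hl => hM i l hl n x)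
        (norm_nonneg _) hB0
    · rw [Set.indicator_of_notMem hx,
        image_eq_zero_of_notMem_tsupport fun h => hx (hΨK n h), zero_mul, norm_zero]
  · refine Filter.Eventually.of_forall fun x => (hΨt x).mul ?_
    simp only [jacFam_coordDir]
    exact tendsto_finsetSum _ fun τ _ => tendsto_const_nhds.mul
      (tendsto_finsetProd _ fun k _ => hFt k _ (by simp) x)

theorem ofReal_abs_integral_jacFam_le_of_tendsto (α : Fin m → Fin r → Fin N)
    {f : Fin r → Euc N → ℝ} (hf : ∀ i, ContDiff ℝ m (f i)) (hfc : ∀ i, HasCompactSupport (f i))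
    {ψ : Euc N → ℝ} (hψ : ContDiff ℝ m ψ) (hψc : HasCompactSupport ψ) {δ : ℝ} (hδ : 0 < δ)
    {B : ℝ} (hB : ∀ l : List (Fin N), l.length ≤ m → ∀ x, |pderivList l ψ x| ≤ B)
    {c : ℝ≥0∞} (hc : c ≠ ⊤) {ρ : ℝ} (hρ : 0 ≤ ρ) {E : (Euc N → ℝ) → ℝ≥0∞}
    (hsmooth : ∀ F : Fin r → Euc N → ℝ, (∀ i, ContDiff ℝ (⊤ : ℕ∞) (F i)) →
      (∀ i, HasCompactSupport (F i)) → ∀ Ψ : Euc N → ℝ, ContDiff ℝ (⊤ : ℕ∞) Ψ →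
      HasCompactSupport Ψ → tsupport Ψ ⊆ Metric.cthickening δ (tsupport ψ) →
      (∀ l : List (Fin N), l.length ≤ m → ∀ x, |pderivList l Ψ x| ≤ B) →
      ENNReal.ofReal |∫ x, Ψ x * jacFam (coordDir α) F x| ≤ c * ∏ i, E (F i) ^ ρ)
    (hE : ∀ i, ∀ F : ℕ → Euc N → ℝ, (∀ n, ContDiff ℝ (⊤ : ℕ∞) (F n)) →
      (∀ l : List (Fin N), l.length ≤ m → ∀ x,
        Tendsto (fun n => pderivList l (F n) x) atTop (𝓝 (pderivList l (f i) x))) →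
      ∀ M, (∀ l : List (Fin N), l.length ≤ m → ∀ n x, |pderivList l (F n) x| ≤ M) →
      Tendsto (fun n => E (F n)) atTop (𝓝 (E (f i))))
    (hfin : ∀ i, E (f i) ≠ ⊤) :
    ENNReal.ofReal |∫ x, ψ x * jacFam (coordDir α) f x| ≤ c * ∏ i, E (f i) ^ ρ := by
  choose F hF hFc _ hFt hFM using fun i => exists_smooth_approx (hf i) (hfc i) hδ
  obtain ⟨Ψ, hΨ, hΨc, hΨK, hΨt, hΨM⟩ := exists_smooth_approx hψ hψc hδ
  choose M hM0 hM using fun i => exists_abs_pderivList_le (hf i) (hfc i)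
  have hMle : ∀ i (l : List (Fin N)), l.length ≤ m → ∀ n x, |pderivList l (F i n) x| ≤ ∑ i, M i :=
    fun i l hl n x => (hFM i l hl (M i) (hM i l hl) n x).trans
      (Finset.single_le_sum (f := M) (fun i _ => hM0 i) (Finset.mem_univ i))
  have hlhs := tendsto_integral_mul_jacFam α (K := Metric.cthickening δ (tsupport ψ))
    (hψc.isCompact.cthickening) (fun n => (hΨ n).continuous) hΨK
    (fun i n => (hF i n).of_le (by exact_mod_cast le_top)) hFt (hΨt [] (by simp))
    (fun n x => hΨM [] (by simp) B (hB [] (by simp)) n x) hMle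
  have hlhs' := (ENNReal.continuous_ofReal.tendsto _).comp hlhs.abs
  have hrhs : Tendsto (fun n => c * ∏ i, E (F i n) ^ ρ) atTop (𝓝 (c * ∏ i, E (f i) ^ ρ)) := by
    refine ENNReal.Tendsto.const_mul ?_ (Or.inr hc)
    have : ∀ i, Tendsto (fun n => E (F i n) ^ ρ) atTop (𝓝 (E (f i) ^ ρ)) := fun i =>
      (ENNReal.continuous_rpow_const.tendsto _).comp (hE i (F i) (hF i) (hFt i) _ (hMle i))
    have hne : ∀ i, E (f i) ^ ρ ≠ ⊤ := fun i => ENNReal.rpow_ne_top_of_nonneg hρ (hfin i)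
    generalize (Finset.univ : Finset (Fin r)) = s
    classical
    induction s using Finset.induction_on with
    | empty => simp
    | insert a s ha ih =>
      simp only [Finset.prod_insert ha]
      exact ENNReal.Tendsto.mul (this a) (Or.inr (ENNReal.prod_ne_top fun i _ => hne i)) ih
        (Or.inr (hne a))
  refine le_of_tendsto_of_tendsto' hlhs' hrhs fun n => ?_
  exact hsmooth _ (fun i => hF i n) (fun i => hFc i n) _ (hΨ n) (hΨc n) (hΨK n)
    fun l hl x => hΨM l hl B (hB l hl) n x

/-- The `L^q` energy of all derivatives of order at most `s`. -/
def intEnergy (K : Set (Euc N)) (s q : ℕ) (f : Euc N → ℝ) : ℝ≥0∞ :=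
  ∫⁻ x in K, ENNReal.ofReal (wordSumLE s f x) ^ q

theorem continuous_wordSumLE {s : ℕ} (hs : s ≤ m) {f : Euc N → ℝ} (hf : ContDiff ℝ m f) :
    Continuous (wordSumLE s f) := by
  unfold wordSumLE wordSum
  refine continuous_finsetSum _ fun j hj => continuous_finsetSum _ fun w _ => ?_
  rw [Finset.mem_range] at hj
  exact (continuous_pderivList hf _ (by rw [List.length_ofFn]; omega)).abs

theorem wordSumLE_le {s : ℕ} (hs : s ≤ m) {f : Euc N → ℝ} {M : ℝ} {x : Euc N}
    (hM : ∀ l : List (Fin N), l.length ≤ m → |pderivList l f x| ≤ M) :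
    wordSumLE s f x ≤ ∑ j ∈ Finset.range (s + 1), ∑ _w : Fin j → Fin N, M := by
  unfold wordSumLE wordSum
  refine Finset.sum_le_sum fun j hj => Finset.sum_le_sum fun w _ => ?_
  rw [Finset.mem_range] at hj
  exact hM _ (by rw [List.length_ofFn]; omega)

theorem intEnergy_ne_top {K : Set (Euc N)} (hK : IsCompact K) {s q : ℕ} (hs : s ≤ m)
    {f : Euc N → ℝ} (hf : ContDiff ℝ m f) (hfc : HasCompactSupport f) :
    intEnergy K s q f ≠ ⊤ := by
  obtain ⟨M, _, hM⟩ := exists_abs_pderivList_le hf hfc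
  refine ne_top_of_le_ne_top ?_ (setLIntegral_mono measurable_const fun x _ =>
    pow_le_pow_left' (ENNReal.ofReal_le_ofReal (wordSumLE_le hs fun l hl => hM l hl x)) q)
  rw [setLIntegral_const]
  exact ENNReal.mul_ne_top (ENNReal.pow_ne_top ENNReal.ofReal_ne_top) hK.measure_lt_top.ne

theorem tendsto_intEnergy {K : Set (Euc N)} (hK : IsCompact K) {s q : ℕ} (hs : s ≤ m)
    {f : Euc N → ℝ} {F : ℕ → Euc N → ℝ} (hF : ∀ n, ContDiff ℝ (⊤ : ℕ∞) (F n))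
    (ht : ∀ l : List (Fin N), l.length ≤ m → ∀ x,
        Tendsto (fun n => pderivList l (F n) x) atTop (𝓝 (pderivList l f x)))
    {M : ℝ} (hM : ∀ l : List (Fin N), l.length ≤ m → ∀ n x, |pderivList l (F n) x| ≤ M) :
    Tendsto (fun n => intEnergy K s q (F n)) atTop (𝓝 (intEnergy K s q f)) := by
  refine tendsto_lintegral_of_dominated_convergence
    (fun _ => ENNReal.ofReal (∑ j ∈ Finset.range (s + 1), ∑ _w : Fin j → Fin N, M) ^ q) ?_ ?_ ?_ ?_
  · intro n
    exact ((continuous_wordSumLE hs ((hF n).of_le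
      (by exact_mod_cast le_top))).measurable.ennreal_ofReal).pow_const q
  · intro n
    refine Filter.Eventually.of_forall fun x => ?_
    exact pow_le_pow_left' (ENNReal.ofReal_le_ofReal (wordSumLE_le hs fun l hl => hM l hl n x)) q
  · rw [setLIntegral_const]
    exact ENNReal.mul_ne_top (ENNReal.pow_ne_top ENNReal.ofReal_ne_top) hK.measure_lt_top.ne
  · refine Filter.Eventually.of_forall fun x => ?_
    refine ENNReal.Tendsto.pow ((ENNReal.continuous_ofReal.tendsto _).comp ?_)
    unfold wordSumLE wordSum
    refine tendsto_finsetSum _ fun j hj => tendsto_finsetSum _ fun w _ => ?_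
    rw [Finset.mem_range] at hj
    exact (ht _ (by rw [List.length_ofFn]; omega) x).abs

theorem ofReal_abs_integral_jacFam_le_intEnergy {s q : ℕ} (hq : 1 ≤ q) (hrq : r ≤ q)
    (hs : s ≤ m) (α : Fin m → Fin r → Fin N) (i : Fin m → Fin r)
    (hi : ∀ k, m ≤ s + (Finset.univ.filter fun j => i j = k).card)
    {f : Fin r → Euc N → ℝ} (hf : ∀ i, ContDiff ℝ m (f i)) (hfc : ∀ i, HasCompactSupport (f i))
    {ψ : Euc N → ℝ} (hψ : ContDiff ℝ m ψ) (hψc : HasCompactSupport ψ) {δ : ℝ} (hδ : 0 < δ)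
    {B : ℝ} (hB : ∀ l : List (Fin N), l.length ≤ m → ∀ x, |pderivList l ψ x| ≤ B)
    {K : Set (Euc N)} (hK : IsCompact K) (hψK : Metric.cthickening δ (tsupport ψ) ⊆ K) :
    ENNReal.ofReal |∫ x, ψ x * jacFam (coordDir α) f x| ≤
      (Fintype.card (Fin m → Equiv.Perm (Fin (r + 1))) * ENNReal.ofReal B *
        volume K ^ (((q : ℝ) - r) / q)) * ∏ i, intEnergy K s q (f i) ^ (1 / (q : ℝ)) := by
  have hB0 : 0 ≤ B := (abs_nonneg _).trans (hB [] (by simp) 0)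
  have hqr : 0 ≤ ((q : ℝ) - r) / q :=
    div_nonneg (sub_nonneg.2 (by exact_mod_cast hrq)) (Nat.cast_nonneg _)
  refine ofReal_abs_integral_jacFam_le_of_tendsto α hf hfc hψ hψc hδ hB ?_ (by positivity) ?_
    (fun i F hF ht M hM => tendsto_intEnergy hK hs hF ht hM)
    (fun i => intEnergy_ne_top hK hs (hf i) (hfc i))
  · refine ENNReal.mul_ne_top (ENNReal.mul_ne_top (ENNReal.natCast_ne_top _)
      ENNReal.ofReal_ne_top) (ENNReal.rpow_ne_top_of_nonneg hqr hK.measure_lt_top.ne)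
  · intro F hF hFc Ψ hΨ hΨc hΨK hBΨ
    have hcont : ∀ i, Continuous (wordSumLE s (F i)) := fun i =>
      continuous_wordSumLE hs ((hF i).of_le (by exact_mod_cast le_top))
    have hcp : Continuous fun x => ∏ k, wordSumLE s (F k) x := by fun_prop
    have hint := hcp.continuousOn.integrableOn_compact (μ := volume) hK
    have h1 := abs_integral_jacFam_le_of_smooth α i hi F hF Ψ hΨ hΨc B hBΨ
      (hint.mono_set (hΨK.trans hψK))
    have hnn : ∀ x, 0 ≤ ∏ k, wordSumLE s (F k) x := fun x =>
      Finset.prod_nonneg fun k _ => wordSumLE_nonneg _ _ _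
    have h2 : ∫ x in tsupport Ψ, ∏ k, wordSumLE s (F k) x ≤ ∫ x in K, ∏ k, wordSumLE s (F k) x :=
      setIntegral_mono_set hint (Filter.Eventually.of_forall hnn)
        (LE.le.eventuallyLE (hΨK.trans hψK))
    refine (ENNReal.ofReal_le_ofReal (h1.trans (mul_le_mul_of_nonneg_left
      (mul_le_mul_of_nonneg_left h2 hB0) (Nat.cast_nonneg _)))).trans ?_
    rw [ENNReal.ofReal_mul (Nat.cast_nonneg _), ENNReal.ofReal_mul hB0, ENNReal.ofReal_natCast,
      ofReal_integral_eq_lintegral_ofReal hint (Filter.Eventually.of_forall hnn)]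
    have h3 := lintegral_mul_prod_le_of_le (μ := volume.restrict K) hq hrq (w := fun _ => 1)
      aemeasurable_const (F := fun i x => ENNReal.ofReal (wordSumLE s (F i) x)) fun i =>
        (hcont i).measurable.ennreal_ofReal.aemeasurable
    simp only [one_mul, setLIntegral_const] at h3
    simp only [ENNReal.ofReal_prod_of_nonneg fun k _ => wordSumLE_nonneg s (F k) _]
    calc _ ≤ _ := mul_le_mul_right (mul_le_mul_right h3 _) _
      _ = _ := by
        simp only [intEnergy]
        ring

end PassageToTheLimit

section DilEnergyLimit

open scoped ENNReal

variable {N m r : ℕ}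

theorem norm_fderiv_le_sum_pderiv' (f : Euc N → ℝ) (x : Euc N) :
    ‖fderiv ℝ f x‖ ≤ ∑ i, |pderiv' i f x| := by
  refine ContinuousLinearMap.opNorm_le_bound _ (Finset.sum_nonneg fun _ _ => abs_nonneg _) fun v => ?_
  have h1 : v = ∑ i, v i • (EuclideanSpace.single i (1 : ℝ) : Euc N) := by
    ext j
    simp [Finset.sum_apply, Pi.single_apply]
  conv_lhs => rw [h1, map_sum]
  rw [Finset.sum_mul]
  refine (norm_sum_le _ _).trans (Finset.sum_le_sum fun i _ => ?_)
  rw [map_smul, norm_smul, mul_comm]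
  exact mul_le_mul_of_nonneg_left (PiLp.norm_apply_le v i) (abs_nonneg _)

theorem diffSum_le {k : ℕ} (hk : k < m) {f : Euc N → ℝ} (hf : ContDiff ℝ m f) {M : ℝ}
    (hM : ∀ l : List (Fin N), l.length ≤ m → ∀ x, |pderivList l f x| ≤ M) (x y : Euc N) :
    diffSum k f x y ≤ (∑ _γ : Fin k → Fin N, N * M) * ‖x - y‖ := by
  unfold diffSum
  rw [Finset.sum_mul]
  refine Finset.sum_le_sum fun γ _ => ?_
  have hd : ContDiff ℝ 1 (pderivList (List.ofFn γ) f) := by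
    exact_mod_cast contDiff_pderivList (n := 1) hf (List.ofFn γ) (by rw [List.length_ofFn]; omega)
  refine (convex_univ).norm_image_sub_le_of_norm_fderiv_le (𝕜 := ℝ)
    (fun z _ => (hd.differentiable (by simp)) z) (fun z _ => ?_) (Set.mem_univ y) (Set.mem_univ x)
  refine (norm_fderiv_le_sum_pderiv' _ z).trans ?_
  refine (Finset.sum_le_card_nsmul _ _ M fun i _ => ?_).trans (by simp)
  exact hM (i :: List.ofFn γ) (by rw [List.length_cons, List.length_ofFn]; omega) z

/-- A bound for the integrand of `dilEnergy`. -/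
theorem dilEnergy_integrand_le {k q : ℕ} (hk : k < m) (hq : (m - k - 1) * q < m)
    {f : Euc N → ℝ} (hf : ContDiff ℝ m f) {M : ℝ} (hM0 : 0 ≤ M)
    (hM : ∀ l : List (Fin N), l.length ≤ m → ∀ x, |pderivList l f x| ≤ M) {t t₀ R : ℝ}
    (ht : 0 < t) (htt : t < t₀) {z : Euc N} (hz : ‖z‖ ≤ R) (x : Euc N) :
    ENNReal.ofReal (t ^ (m - 1) * (t⁻¹ ^ (m - k)) ^ q) *
        ENNReal.ofReal (diffSum k f (x - t • z) x) ^ q ≤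
      ENNReal.ofReal (t₀ ^ (m - 1 - (m - k - 1) * q) * ((∑ _γ : Fin k → Fin N, N * M) * R) ^ q) := by
  have hR : 0 ≤ R := (norm_nonneg z).trans hz
  have hL : 0 ≤ ∑ _γ : Fin k → Fin N, N * M := Finset.sum_nonneg fun _ _ => by positivity
  have h1 := diffSum_le hk hf hM (x - t • z) x
  rw [sub_sub_cancel_left, norm_neg, norm_smul, Real.norm_eq_abs, abs_of_pos ht] at h1
  have h2 : diffSum k f (x - t • z) x ≤ t * ((∑ _γ : Fin k → Fin N, N * M) * R) :=
    h1.trans (by rw [mul_left_comm]; gcongr)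
  rw [← ENNReal.ofReal_pow (diffSum_nonneg _ _ _ _), ← ENNReal.ofReal_mul (by positivity)]
  refine ENNReal.ofReal_le_ofReal ?_
  calc _ ≤ (t ^ (m - 1) * (t⁻¹ ^ (m - k)) ^ q) * (t * ((∑ _γ : Fin k → Fin N, N * M) * R)) ^ q := by
        have := diffSum_nonneg k f (x - t • z) x
        gcongr
    _ = t ^ (m - 1 - (m - k - 1) * q) * ((∑ _γ : Fin k → Fin N, N * M) * R) ^ q := by
        rw [mul_pow, ← mul_assoc]
        congr 1
        obtain ⟨e, he⟩ : ∃ e, m - k = e + 1 := ⟨m - k - 1, by omega⟩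
        obtain ⟨a, ha⟩ : ∃ a, m - 1 = a + (m - k - 1) * q := ⟨m - 1 - (m - k - 1) * q, by omega⟩
        have he' : m - k - 1 = e := by omega
        rw [ha, he', he, Nat.add_sub_cancel, mul_assoc, ← mul_pow, pow_succ t⁻¹, mul_assoc,
          inv_mul_cancel₀ ht.ne', mul_one, pow_add, pow_mul, mul_assoc, ← mul_pow, ← mul_pow,
          mul_inv_cancel₀ ht.ne', one_pow, one_pow, mul_one]
    _ ≤ _ := by gcongr

theorem dilEnergy_ne_top {K : Set (Euc N)} (hK : IsCompact K) {S : Set (Euc N)} (hS : IsCompact S)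
    (t₀ : ℝ) {k q : ℕ} (hk : k < m) (hq : (m - k - 1) * q < m)
    {f : Euc N → ℝ} (hf : ContDiff ℝ m f) (hfc : HasCompactSupport f) :
    dilEnergy K t₀ S m k q f ≠ ⊤ := by
  obtain ⟨M, hM0, hM⟩ := exists_abs_pderivList_le hf hfc
  obtain ⟨R, hR⟩ := hS.isBounded.exists_norm_le
  set A := ENNReal.ofReal (t₀ ^ (m - 1 - (m - k - 1) * q) *
    ((∑ _γ : Fin k → Fin N, N * M) * R) ^ q)
  have h : dilEnergy K t₀ S m k q f ≤ ∫⁻ _p in K ×ˢ Set.Ioo 0 t₀, A * volume S := by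
    refine setLIntegral_mono_ae' (hK.measurableSet.prod measurableSet_Ioo)
      (Filter.Eventually.of_forall fun p hp => ?_)
    rw [← setLIntegral_const]
    exact setLIntegral_mono_ae' hS.measurableSet (Filter.Eventually.of_forall fun z hz =>
      dilEnergy_integrand_le hk hq hf hM0 hM hp.2.1 hp.2.2 (hR z hz) p.1)
  refine ne_top_of_le_ne_top ?_ h
  rw [setLIntegral_const, Measure.volume_eq_prod, Measure.prod_prod, Real.volume_Ioo]
  exact ENNReal.mul_ne_top (ENNReal.mul_ne_top ENNReal.ofReal_ne_top hS.measure_lt_top.ne)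
    (ENNReal.mul_ne_top hK.measure_lt_top.ne ENNReal.ofReal_ne_top)

theorem tendsto_dilEnergy {K : Set (Euc N)} (hK : IsCompact K) {S : Set (Euc N)} (hS : IsCompact S)
    (t₀ : ℝ) {k q : ℕ} (hk : k < m) (hq : (m - k - 1) * q < m)
    {f : Euc N → ℝ} {F : ℕ → Euc N → ℝ} (hF : ∀ n, ContDiff ℝ (⊤ : ℕ∞) (F n))
    (ht : ∀ l : List (Fin N), l.length ≤ m → ∀ x,
        Tendsto (fun n => pderivList l (F n) x) atTop (𝓝 (pderivList l f x)))
    {M : ℝ} (hM : ∀ l : List (Fin N), l.length ≤ m → ∀ n x, |pderivList l (F n) x| ≤ M) :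
    Tendsto (fun n => dilEnergy K t₀ S m k q (F n)) atTop (𝓝 (dilEnergy K t₀ S m k q f)) := by
  obtain ⟨R, hR⟩ := hS.isBounded.exists_norm_le
  have hM0 : 0 ≤ M := (abs_nonneg _).trans (hM [] (by simp) 0 0)
  have hFm : ∀ n, ContDiff ℝ m (F n) := fun n => (hF n).of_le (by exact_mod_cast le_top)
  set A := ENNReal.ofReal (t₀ ^ (m - 1 - (m - k - 1) * q) *
    ((∑ _γ : Fin k → Fin N, N * M) * R) ^ q) with hA
  have hcs : ∀ n, Measurable fun x : (Euc N × ℝ) × Euc N =>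
      ENNReal.ofReal (x.1.2 ^ (m - 1) * (x.1.2⁻¹ ^ (m - k)) ^ q) *
        ENNReal.ofReal (diffSum k (F n) (x.1.1 - x.1.2 • x.2) x.1.1) ^ q := fun n => by
    have : Continuous fun x : (Euc N × ℝ) × Euc N =>
        diffSum k (F n) (x.1.1 - x.1.2 • x.2) x.1.1 :=
      (continuous_diffSum k fun γ => (pderivList_contDiff (hF n) _).continuous).comp
        (f := fun x : (Euc N × ℝ) × Euc N => (x.1.1 - x.1.2 • x.2, x.1.1)) (by fun_prop)
    exact (Measurable.ennreal_ofReal (by fun_prop)).mul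
      (this.measurable.ennreal_ofReal.pow_const q)
  have hAt : A * volume S ≠ ⊤ := ENNReal.mul_ne_top ENNReal.ofReal_ne_top hS.measure_lt_top.ne
  have hb : ∀ n (p : Euc N × ℝ), p ∈ K ×ˢ Set.Ioo 0 t₀ → ∀ z ∈ S,
      ENNReal.ofReal (p.2 ^ (m - 1) * (p.2⁻¹ ^ (m - k)) ^ q) *
        ENNReal.ofReal (diffSum k (F n) (p.1 - p.2 • z) p.1) ^ q ≤ A := fun n p hp z hz =>
    dilEnergy_integrand_le hk hq (hFm n) hM0 (fun l hl => hM l hl n) hp.2.1 hp.2.2 (hR z hz) p.1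
  refine tendsto_lintegral_of_dominated_convergence (fun _ => A * volume S) ?_ ?_ ?_ ?_
  · exact fun n => (hcs n).lintegral_prod_right'
  · intro n
    refine (ae_restrict_iff' (hK.measurableSet.prod measurableSet_Ioo)).2
      (Filter.Eventually.of_forall fun p hp => ?_)
    rw [← setLIntegral_const]
    exact setLIntegral_mono_ae' hS.measurableSet
      (Filter.Eventually.of_forall fun z hz => hb n p hp z hz)
  · rw [setLIntegral_const, Measure.volume_eq_prod, Measure.prod_prod, Real.volume_Ioo]
    exact ENNReal.mul_ne_top hAt (ENNReal.mul_ne_top hK.measure_lt_top.ne ENNReal.ofReal_ne_top)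
  · refine (ae_restrict_iff' (hK.measurableSet.prod measurableSet_Ioo)).2
      (Filter.Eventually.of_forall fun p hp => ?_)
    refine tendsto_lintegral_of_dominated_convergence (fun _ => A) ?_ ?_ ?_ ?_
    · exact fun n => (hcs n).comp measurable_prodMk_left
    · exact fun n => (ae_restrict_iff' hS.measurableSet).2
        (Filter.Eventually.of_forall fun z hz => hb n p hp z hz)
    · rw [setLIntegral_const]
      exact ENNReal.mul_ne_top ENNReal.ofReal_ne_top hS.measure_lt_top.ne
    · refine Filter.Eventually.of_forall fun z => ?_
      refine ENNReal.Tendsto.const_mul (ENNReal.Tendsto.pow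
        ((ENNReal.continuous_ofReal.tendsto _).comp ?_)) (Or.inr ENNReal.ofReal_ne_top)
      unfold diffSum
      exact tendsto_finsetSum _ fun γ _ =>
        ((ht _ (by rw [List.length_ofFn]; omega) _).sub
          (ht _ (by rw [List.length_ofFn]; omega) _)).abs

theorem exists_ofReal_abs_integral_jacFam_le_dilEnergy {k q : ℕ} (hkm : k < m)
    (hkq : (m - k - 1) * q < m) (hq : 1 ≤ q)
    (hrq : r ≤ q) (α : Fin m → Fin r → Fin N) {φ : Euc N → ℝ} (hφ : ContDiff ℝ (⊤ : ℕ∞) φ)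
    (hφc : HasCompactSupport φ) (hφ1 : ∫ z, φ z = 1) {t₀ : ℝ} (ht₀ : 0 < t₀) :
    ∃ C : ℝ≥0∞, C ≠ ⊤ ∧ ∀ (f : Fin r → Euc N → ℝ), (∀ i, ContDiff ℝ m (f i)) →
      (∀ i, HasCompactSupport (f i)) → ∀ (ψ : Euc N → ℝ), ContDiff ℝ m ψ →
      HasCompactSupport ψ → ∀ δ : ℝ, 0 < δ → ∀ (K : Set (Euc N)), IsCompact K →
      Metric.cthickening δ (tsupport ψ) ⊆ K → ∀ B : ℝ,
      (∀ l : List (Fin N), l.length ≤ m → ∀ x, |pderivList l ψ x| ≤ B) →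
      ENNReal.ofReal |∫ x, ψ x * jacFam (coordDir α) f x| ≤
        C * ENNReal.ofReal B * volume K ^ (((q : ℝ) - r) / q) *
          ∏ i, dilEnergy K t₀ (tsupport φ) m k q (f i) ^ (1 / (q : ℝ)) := by
  obtain ⟨C, hC, h⟩ := exists_abs_integral_jacFam_le_dilEnergy hkm hq hrq α hφ hφc hφ1 ht₀
  have hqr : 0 ≤ ((q : ℝ) - r) / q :=
    div_nonneg (sub_nonneg.2 (by exact_mod_cast hrq)) (Nat.cast_nonneg _)
  set D : ℝ≥0∞ := (ENNReal.ofReal (t₀ ^ (m - 1)) * ENNReal.ofReal t₀) ^ (((q : ℝ) - r) / q)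
  have hD : D ≠ ⊤ := ENNReal.rpow_ne_top_of_nonneg hqr
    (ENNReal.mul_ne_top ENNReal.ofReal_ne_top ENNReal.ofReal_ne_top)
  refine ⟨C * D, ENNReal.mul_ne_top hC hD, ?_⟩
  intro f hf hfc ψ hψ hψc δ hδ K hK hψK B hB
  refine ofReal_abs_integral_jacFam_le_of_tendsto α hf hfc hψ hψc hδ hB ?_
    (by positivity : 0 ≤ 1 / (q : ℝ)) ?_
    (fun i F hF ht M hM => tendsto_dilEnergy hK hφc t₀ hkm hkq hF ht hM)
    (fun i => dilEnergy_ne_top hK hφc t₀ hkm hkq (hf i) (hfc i))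
  · exact ENNReal.mul_ne_top (ENNReal.mul_ne_top (ENNReal.mul_ne_top hC hD) ENNReal.ofReal_ne_top)
      (ENNReal.rpow_ne_top_of_nonneg hqr hK.measure_lt_top.ne)
  · intro F hF hFc Ψ hΨ hΨc hΨK hBΨ
    refine (h F hF hFc Ψ hΨ hΨc K hK.measurableSet (hΨK.trans hψK) B hBΨ).trans ?_
    have h1 : ∫⁻ p in K ×ˢ Set.Ioo 0 t₀, ENNReal.ofReal (p.2 ^ (m - 1)) ≤
        (ENNReal.ofReal (t₀ ^ (m - 1)) * ENNReal.ofReal t₀) * volume K := by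
      refine (setLIntegral_mono_ae' (hK.measurableSet.prod measurableSet_Ioo)
        (g := fun _ => ENNReal.ofReal (t₀ ^ (m - 1))) (Filter.Eventually.of_forall
        fun p hp => ENNReal.ofReal_le_ofReal (pow_le_pow_left₀ hp.2.1.le hp.2.2.le _))).trans ?_
      rw [setLIntegral_const, Measure.volume_eq_prod, Measure.prod_prod, Real.volume_Ioo, sub_zero]
      exact le_of_eq (by ring)
    have h2 := ENNReal.rpow_le_rpow h1 hqr
    rw [ENNReal.mul_rpow_of_nonneg _ _ hqr] at h2
    calc _ ≤ C * ENNReal.ofReal B * (D * volume K ^ (((q : ℝ) - r) / q) *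
          ∏ i, dilEnergy K t₀ (tsupport φ) m k q (F i) ^ (1 / (q : ℝ))) := by gcongr
      _ = _ := by ring

end DilEnergyLimit

section GagliardoKernel

open scoped ENNReal

variable {N : ℕ}

theorem lintegral_comp_sub_smul {t : ℝ} (ht : 0 < t) (x : Euc N) {g : Euc N → ℝ≥0∞}
    (hg : Measurable g) :
    ∫⁻ z, g (x - t • z) = ENNReal.ofReal (t⁻¹ ^ N) * ∫⁻ y, g y := by
  have h1 : ∫⁻ z, g (x - t • z) = ∫⁻ y, g (x - y) ∂(Measure.map (fun z : Euc N => t • z) volume) := by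
    rw [lintegral_map (f := fun y => g (x - y)) (hg.comp (by fun_prop)) (by fun_prop)]
  rw [h1, Measure.map_addHaar_smul _ ht.ne', lintegral_smul_measure, lintegral_sub_left_eq_self g x,
    finrank_euclideanSpace_fin, smul_eq_mul, abs_of_pos (by positivity), inv_pow]

theorem lintegral_Ici_inv_pow (b : ℕ) (hb : 0 < b) {c : ℝ} (hc : 0 < c) :
    ∫⁻ t in Set.Ici c, ENNReal.ofReal (t⁻¹ ^ (b + 1)) = ENNReal.ofReal ((c ^ b)⁻¹ / b) := by
  have hb' : (0 : ℝ) < b := by exact_mod_cast hb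
  have ha : -((b : ℝ) + 1) < -1 := by linarith
  rw [setLIntegral_congr (Ioi_ae_eq_Ici (μ := volume) (a := c)).symm]
  have h1 : ∀ t ∈ Set.Ioi c, t⁻¹ ^ (b + 1) = t ^ (-((b : ℝ) + 1)) := by
    intro t ht
    have ht0 : 0 < t := hc.trans ht
    rw [Real.rpow_neg ht0.le, inv_pow]
    congr 1
    exact_mod_cast (Real.rpow_natCast t (b + 1)).symm
  rw [setLIntegral_congr_fun measurableSet_Ioi (fun t ht => by rw [h1 t ht]),
    ← ofReal_integral_eq_lintegral_ofReal (integrableOn_Ioi_rpow_of_lt ha hc)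
      ((ae_restrict_iff' measurableSet_Ioi).2 (Filter.Eventually.of_forall fun t ht =>
        Real.rpow_nonneg (hc.trans ht).le _)), integral_Ioi_rpow_of_lt ha hc]
  congr 1
  rw [show -((b : ℝ) + 1) + 1 = -b by ring, Real.rpow_neg hc.le, Real.rpow_natCast, neg_div_neg_eq]

theorem lintegral_dil_le {S : Set (Euc N)} (hSm : MeasurableSet S) {R : ℝ} (hR : 0 < R)
    (hS : ∀ z ∈ S, ‖z‖ ≤ R) {a b c : ℕ} (hb : 0 < b) (hab : N + c = a + b + 1) (t₀ : ℝ)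
    {Ω : Set (Euc N)} (hΩ : MeasurableSet Ω) {x : Euc N}
    (hx : ∀ t ∈ Set.Ioo 0 t₀, ∀ z ∈ S, x - t • z ∈ Ω) {g : Euc N → ℝ≥0∞} (hg : Measurable g)
    (hgx : g x = 0) :
    ∫⁻ t in Set.Ioo 0 t₀, ∫⁻ z in S, ENNReal.ofReal (t ^ a * t⁻¹ ^ c) * g (x - t • z) ≤
      ENNReal.ofReal (R ^ b / b) * ∫⁻ y in Ω, g y * ENNReal.ofReal ((‖x - y‖ ^ b)⁻¹) := by
  set A : Set (ℝ × Euc N) := {p | ‖x - p.2‖ ≤ R * p.1} with hA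
  have hAm : MeasurableSet A := measurableSet_le (by fun_prop) (by fun_prop)
  set G : ℝ → Euc N → ℝ≥0∞ := fun t y =>
    A.indicator (fun p => ENNReal.ofReal (p.1⁻¹ ^ (b + 1)) * g p.2) (t, y) with hG
  have hGm : Measurable (Function.uncurry G) := by
    refine Measurable.indicator ?_ hAm
    exact (Measurable.ennreal_ofReal (by fun_prop)).mul (hg.comp measurable_snd)
  have h1 : ∀ t ∈ Set.Ioo 0 t₀, ∫⁻ z in S, ENNReal.ofReal (t ^ a * t⁻¹ ^ c) * g (x - t • z) ≤
      ∫⁻ y in Ω, G t y := by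
    intro t ht
    have ht0 : 0 < t := ht.1
    set B : Set (Euc N) := Ω ∩ {y | ‖x - y‖ ≤ R * t}
    have hBm : MeasurableSet B := hΩ.inter (measurableSet_le (by fun_prop) (by fun_prop))
    have hgt : Measurable fun z => g (x - t • z) := hg.comp (by fun_prop)
    rw [lintegral_const_mul _ hgt]
    calc _ ≤ ENNReal.ofReal (t ^ a * t⁻¹ ^ c) * ∫⁻ z, B.indicator g (x - t • z) := by
          refine mul_le_mul_right ?_ _
          rw [← lintegral_indicator hSm]
          refine lintegral_mono fun z => ?_
          by_cases hz : z ∈ S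
          · rw [Set.indicator_of_mem hz, Set.indicator_of_mem]
            refine ⟨hx t ht z hz, ?_⟩
            simp only [Set.mem_ofPred_eq, sub_sub_cancel, norm_smul, Real.norm_eq_abs,
              abs_of_pos ht0]
            rw [mul_comm]
            exact mul_le_mul_of_nonneg_right (hS z hz) ht0.le
          · rw [Set.indicator_of_notMem hz]
            exact zero_le
      _ = ∫⁻ y in Ω, G t y := by
          rw [lintegral_comp_sub_smul ht0 x (hg.indicator hBm), ← mul_assoc,
            ← ENNReal.ofReal_mul (by positivity), ← lintegral_indicator hΩ,
            ← lintegral_const_mul _ (hg.indicator hBm)]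
          refine lintegral_congr fun y => ?_
          have e : t ^ a * t⁻¹ ^ c * t⁻¹ ^ N = t⁻¹ ^ (b + 1) := by
            rw [mul_assoc, ← pow_add, add_comm c, hab, add_assoc, pow_add, ← mul_assoc, ← mul_pow,
              mul_inv_cancel₀ ht0.ne', one_pow, one_mul]
          rw [e]
          by_cases hy : y ∈ Ω
          · rw [Set.indicator_of_mem hy]
            by_cases hy2 : ‖x - y‖ ≤ R * t
            · rw [Set.indicator_of_mem (show y ∈ B from ⟨hy, hy2⟩)]
              simp only [hG]
              rw [Set.indicator_of_mem (show (t, y) ∈ A from hy2)]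
            · rw [Set.indicator_of_notMem (fun h : y ∈ B => hy2 h.2)]
              simp only [hG]
              rw [Set.indicator_of_notMem (fun h : (t, y) ∈ A => hy2 h), mul_zero]
          · rw [Set.indicator_of_notMem hy, Set.indicator_of_notMem (fun h : y ∈ B => hy h.1),
              mul_zero]
  calc _ ≤ ∫⁻ t in Set.Ioo 0 t₀, ∫⁻ y in Ω, G t y :=
        setLIntegral_mono_ae' measurableSet_Ioo (Filter.Eventually.of_forall h1)
    _ = ∫⁻ y in Ω, ∫⁻ t in Set.Ioo 0 t₀, G t y := lintegral_lintegral_swap hGm.aemeasurable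
    _ ≤ ∫⁻ y in Ω, ENNReal.ofReal (R ^ b / b) * (g y * ENNReal.ofReal ((‖x - y‖ ^ b)⁻¹)) := by
        refine lintegral_mono fun y => ?_
        by_cases hy : y = x
        · subst hy
          have : ∀ t, G t y = 0 := fun t => by
            simp only [hG]
            refine Set.indicator_apply_eq_zero.2 fun _ => ?_
            rw [hgx, mul_zero]
          simp [this]
        · have hpos : 0 < ‖x - y‖ := norm_pos_iff.2 (sub_ne_zero.2 (Ne.symm hy))
          calc ∫⁻ t in Set.Ioo 0 t₀, G t y ≤ ∫⁻ t, G t y := setLIntegral_le_lintegral _ _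
            _ = ∫⁻ t in Set.Ici (‖x - y‖ / R), ENNReal.ofReal (t⁻¹ ^ (b + 1)) * g y := by
                rw [← lintegral_indicator measurableSet_Ici]
                refine lintegral_congr fun t => ?_
                simp only [hG]
                by_cases ht : ‖x - y‖ ≤ R * t
                · rw [Set.indicator_of_mem (show (t, y) ∈ A from ht), Set.indicator_of_mem]
                  rw [Set.mem_Ici, div_le_iff₀ hR, mul_comm]
                  exact ht
                · rw [Set.indicator_of_notMem (show (t, y) ∉ A from ht), Set.indicator_of_notMem]
                  rw [Set.mem_Ici, div_le_iff₀ hR, mul_comm]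
                  exact ht
            _ = _ := by
                rw [lintegral_mul_const _ (Measurable.ennreal_ofReal (by fun_prop)),
                  lintegral_Ici_inv_pow b hb (by positivity)]
                rw [mul_left_comm, ← ENNReal.ofReal_mul (by positivity), mul_comm (g y)]
                congr 2
                rw [div_pow, inv_div]
                ring
    _ = _ := lintegral_const_mul' _ _ ENNReal.ofReal_ne_top

end GagliardoKernel

theorem IsSmoothDomain.exists_cone {N : ℕ} {Ω : Set (Euc N)} (hΩ : IsSmoothDomain Ω)
    {x₀ : Euc N} (hx₀ : x₀ ∈ closure Ω) :
    ∃ ρ > (0 : ℝ), ∃ t₀ > (0 : ℝ), ∃ e : Euc N, ∃ ε > (0 : ℝ), ∀ x ∈ Ω ∩ Metric.ball x₀ ρ,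
      ∀ z ∈ Metric.closedBall e ε, ∀ t ∈ Set.Icc 0 t₀, x - t • z ∈ Ω := by
  obtain ⟨hopen, hbdd, f, hf, hΩf, hfr⟩ := hΩ
  by_cases hin : x₀ ∈ Ω
  · obtain ⟨η, hη, hball⟩ := Metric.isOpen_iff.1 hopen x₀ hin
    refine ⟨η / 2, by positivity, η / 2, by positivity, 0, 1 / 2, by norm_num, ?_⟩
    rintro x ⟨hx, hxb⟩ z hz t ht
    apply hball
    rw [Metric.mem_ball, dist_eq_norm] at hxb ⊢
    rw [mem_closedBall_zero_iff] at hz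
    have h1 : x - t • z - x₀ = (x - x₀) - t • z := by abel
    rw [h1]
    refine (norm_sub_le _ _).trans_lt ?_
    rw [norm_smul, Real.norm_of_nonneg ht.1]
    nlinarith [ht.1, ht.2, norm_nonneg z, mul_le_mul ht.2 hz (norm_nonneg z) (by positivity)]
  · have hfront : x₀ ∈ frontier Ω := ⟨hx₀, by rwa [hopen.interior_eq]⟩
    have hne := hfr x₀ hfront
    obtain ⟨e, he⟩ : ∃ e, 0 < fderiv ℝ f x₀ e := by
      obtain ⟨e, he⟩ : ∃ e, fderiv ℝ f x₀ e ≠ 0 := by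
        by_contra! h
        exact hne (ContinuousLinearMap.ext h)
      rcases lt_or_gt_of_ne he with h | h
      · exact ⟨-e, by simpa using h⟩
      · exact ⟨e, h⟩
    have hcont : Continuous fun p : Euc N × Euc N => fderiv ℝ f p.1 p.2 :=
      ((hf.continuous_fderiv (by simp)).comp continuous_fst).clm_apply continuous_snd
    obtain ⟨η, hη, hball⟩ := Metric.isOpen_iff.1 (isOpen_lt continuous_const hcont) (x₀, e) he
    have hR : 0 < ‖e‖ + η := by positivity
    refine ⟨η / 2, by positivity, η / 2 / (‖e‖ + η), by positivity, e, η / 2, by positivity, ?_⟩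
    rintro x ⟨hx, hxb⟩ z hz t ht
    rw [Metric.mem_ball, dist_eq_norm] at hxb
    rw [Metric.mem_closedBall, dist_eq_norm] at hz
    have hzn : ‖z‖ ≤ ‖e‖ + η := by
      have := norm_add_le e (z - e)
      rw [add_sub_cancel] at this
      linarith
    have hpos : ∀ s ∈ Set.Icc 0 t, 0 < fderiv ℝ f (x - s • z) z := by
      intro s hs
      refine hball (show (x - s • z, z) ∈ Metric.ball (x₀, e) η from ?_)
      rw [Metric.mem_ball, Prod.dist_eq, max_lt_iff]
      constructor
      · simp only [dist_eq_norm]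
        have h1 : x - s • z - x₀ = (x - x₀) - s • z := by abel
        rw [h1]
        refine (norm_sub_le _ _).trans_lt ?_
        rw [norm_smul, Real.norm_of_nonneg hs.1]
        have h2 : s * ‖z‖ ≤ η / 2 / (‖e‖ + η) * (‖e‖ + η) :=
          mul_le_mul (hs.2.trans ht.2) hzn (norm_nonneg _) (by positivity)
        rw [div_mul_cancel₀ _ hR.ne'] at h2
        linarith
      · simp only [dist_eq_norm]
        linarith
    have hd : ∀ s, HasDerivAt (fun s : ℝ => f (x - s • z)) (-(fderiv ℝ f (x - s • z) z)) s := by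
      intro s
      have h1 : HasDerivAt (fun s : ℝ => x - s • z) (-z) s := by
        simpa using ((hasDerivAt_id s).smul_const z).const_sub x
      have h2 := ((hf.differentiable (by simp) (x - s • z)).hasFDerivAt).comp_hasDerivAt s h1
      rw [map_neg] at h2
      exact h2
    have hanti : AntitoneOn (fun s : ℝ => f (x - s • z)) (Set.Icc 0 t) := by
      refine antitoneOn_of_deriv_nonpos (convex_Icc 0 t)
        (fun s _ => (hd s).continuousAt.continuousWithinAt)
        (fun s _ => (hd s).differentiableAt.differentiableWithinAt) ?_
      intro s hs
      rw [(hd s).deriv]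
      have := hpos s (interior_subset hs)
      linarith
    have := hanti (Set.left_mem_Icc.2 ht.1) (Set.right_mem_Icc.2 ht.1) ht.1
    rw [hΩf] at hx ⊢
    simp only [zero_smul, sub_zero] at this
    exact lt_of_le_of_lt this hx

theorem ContDiffOn.exists_iteratedFDeriv_le {E F : Type*} [NormedAddCommGroup E]
    [NormedSpace ℝ E] [NormedAddCommGroup F] [NormedSpace ℝ F] {Ω : Set E} (hΩ : IsOpen Ω)
    (hK : IsCompact (closure Ω)) {m : ℕ} {u : E → F} (hu : ContDiffOn ℝ m u (closure Ω)) :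
    ∃ M, ∀ j ≤ m, ∀ x ∈ Ω, ‖iteratedFDeriv ℝ j u x‖ ≤ M := by
  have hloc : ∀ x₀ ∈ closure Ω, ∃ w ∈ 𝓝[closure Ω] x₀,
      ∃ M, ∀ j ≤ m, ∀ x ∈ w ∩ Ω, ‖iteratedFDeriv ℝ j u x‖ ≤ M := by
    intro x₀ hx₀
    obtain ⟨w, hw, p, hp⟩ := contDiffWithinAt_nat.1 (hu x₀ hx₀)
    rw [Set.insert_eq_of_mem hx₀] at hw
    obtain ⟨O, hO, hx₀O, hOw⟩ := mem_nhdsWithin.1 hw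
    have hx₀w : x₀ ∈ w := hOw ⟨hx₀O, hx₀⟩
    have heq : ∀ j ≤ m, ∀ x ∈ O ∩ Ω, iteratedFDeriv ℝ j u x = p x j := by
      intro j hj x hx
      have hopen : IsOpen (O ∩ Ω) := hO.inter hΩ
      have hsub : O ∩ Ω ⊆ w := fun y hy => hOw ⟨hy.1, subset_closure hy.2⟩
      have h1 := (hp.mono hsub).eq_iteratedFDerivWithin_of_uniqueDiffOn (m := j)
        (by exact_mod_cast hj) hopen.uniqueDiffOn hx
      rw [h1, iteratedFDerivWithin_of_isOpen j hopen hx]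
    have hbd : ∀ j ∈ Finset.range (m + 1), ∀ᶠ x in 𝓝[w] x₀, ‖p x j‖ < ‖p x₀ j‖ + 1 := by
      intro j hj
      have hc := (hp.cont j (by exact_mod_cast Nat.lt_succ_iff.1 (Finset.mem_range.1 hj))) x₀ hx₀w
      exact hc.norm.eventually_lt_const (lt_add_one _)
    have hall := (Finset.eventually_all _).2 hbd
    have hle : 𝓝[closure Ω] x₀ ≤ 𝓝[w] x₀ := nhdsWithin_le_iff.2 hw
    refine ⟨_, inter_mem (hle hall) (mem_nhdsWithin_of_mem_nhds (hO.mem_nhds hx₀O)),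
      ∑ j ∈ Finset.range (m + 1), (‖p x₀ j‖ + 1), ?_⟩
    rintro j hj x ⟨⟨hx1, hxO⟩, hxΩ⟩
    rw [heq j hj x ⟨hxO, hxΩ⟩]
    have hjm : j ∈ Finset.range (m + 1) := Finset.mem_range.2 (by omega)
    refine (hx1 j hjm).le.trans ?_
    exact Finset.single_le_sum (f := fun j => ‖p x₀ j‖ + 1) (fun i _ => by positivity) hjm
  have := hK.induction_on (p := fun w => ∃ M, ∀ j ≤ m, ∀ x ∈ w ∩ Ω, ‖iteratedFDeriv ℝ j u x‖ ≤ M)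
    ⟨0, by simp⟩ (fun s t hst ⟨M, hM⟩ => ⟨M, fun j hj x hx => hM j hj x ⟨hst hx.1, hx.2⟩⟩)
    (fun s t ⟨M, hM⟩ ⟨M', hM'⟩ => ⟨max M M', fun j hj x hx => hx.1.elim
      (fun h => (hM j hj x ⟨h, hx.2⟩).trans (le_max_left _ _))
      (fun h => (hM' j hj x ⟨h, hx.2⟩).trans (le_max_right _ _))⟩) hloc
  obtain ⟨M, hM⟩ := this
  exact ⟨M, fun j hj x hx => hM j hj x ⟨subset_closure hx, hx⟩⟩

theorem IsSmoothDomain.exists_lipschitz {N : ℕ} {Ω : Set (Euc N)} (hΩ : IsSmoothDomain Ω)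
    {G : Type*} [NormedAddCommGroup G] [NormedSpace ℝ G] {g : Euc N → G} {M : ℝ}
    (hd : ∀ x ∈ Ω, DifferentiableAt ℝ g x) (hg : ∀ x ∈ Ω, ‖g x‖ ≤ M)
    (hg' : ∀ x ∈ Ω, ‖fderiv ℝ g x‖ ≤ M) :
    ∃ L, ∀ x ∈ Ω, ∀ y ∈ Ω, ‖g x - g y‖ ≤ L * ‖x - y‖ := by
  have hK : IsCompact (closure Ω) := hΩ.2.1.isCompact_closure
  have hseg : ∀ a b : Euc N, segment ℝ a b ⊆ Ω → ‖g a - g b‖ ≤ M * ‖a - b‖ := by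
    intro a b hab
    rw [norm_sub_rev, norm_sub_rev a b]
    exact (convex_segment a b).norm_image_sub_le_of_norm_fderiv_le (fun x hx => hd x (hab hx))
      (fun x hx => hg' x (hab hx)) (left_mem_segment ℝ a b) (right_mem_segment ℝ a b)
  have hloc : ∀ p ∈ closure Ω ×ˢ closure Ω, ∃ w ∈ 𝓝[closure Ω ×ˢ closure Ω] p,
      ∃ L, ∀ x ∈ Ω, ∀ y ∈ Ω, (x, y) ∈ w → ‖g x - g y‖ ≤ L * ‖x - y‖ := by
    rintro ⟨x₀, y₀⟩ ⟨hx₀, -⟩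
    by_cases hxy : x₀ = y₀
    · subst hxy
      obtain ⟨ρ, hρ, t₀, ht₀, e, ε, hε, hcone⟩ := hΩ.exists_cone hx₀
      refine ⟨Metric.ball x₀ (min ρ (ε * t₀ / 2)) ×ˢ Metric.ball x₀ (min ρ (ε * t₀ / 2)),
        mem_nhdsWithin_of_mem_nhds (prod_mem_nhds (Metric.ball_mem_nhds _ (by positivity))
          (Metric.ball_mem_nhds _ (by positivity))), M * (2 * ‖e‖ / ε + 1), ?_⟩
      rintro x hx y hy ⟨hxb, hyb⟩
      rcases eq_or_ne x y with rfl | hne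
      · simp
      have hnpos : 0 < ‖x - y‖ := norm_pos_iff.2 (sub_ne_zero.2 hne)
      simp only [Metric.mem_ball, lt_min_iff] at hxb hyb
      set t := ‖x - y‖ / ε with ht
      have htpos : 0 < t := by positivity
      have htle : t ≤ t₀ := by
        rw [ht, div_le_iff₀ hε, ← dist_eq_norm]
        have := dist_triangle_right x y x₀
        linarith [hxb.2, hyb.2]
      have hside : ∀ a ∈ Ω ∩ Metric.ball x₀ ρ, ‖g a - g (a - t • e)‖ ≤ M * (t * ‖e‖) := by
        intro a ha
        refine (hseg _ _ ?_).trans_eq ?_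
        · rw [segment_eq_image']
          rintro _ ⟨θ, hθ, rfl⟩
          have h1 : a + θ • (a - t • e - a) = a - (θ * t) • e := by
            rw [mul_smul, sub_sub_cancel_left, smul_neg, sub_eq_add_neg]
          simp only [h1]
          exact hcone a ha e (Metric.mem_closedBall_self hε.le) _
            ⟨mul_nonneg hθ.1 htpos.le, (mul_le_of_le_one_left htpos.le hθ.2).trans htle⟩
        · rw [sub_sub_cancel, norm_smul, Real.norm_of_nonneg htpos.le]
      have hmid : ‖g (x - t • e) - g (y - t • e)‖ ≤ M * ‖x - y‖ := by
        refine (hseg _ _ ?_).trans_eq (by rw [sub_sub_sub_cancel_right])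
        rw [segment_eq_image']
        rintro _ ⟨θ, hθ, rfl⟩
        have h1 : x - t • e + θ • (y - t • e - (x - t • e))
            = x - t • (e + (θ / t) • (x - y)) := by
          rw [sub_sub_sub_cancel_right, smul_add, smul_smul, mul_div_cancel₀ _ htpos.ne',
            ← neg_sub x y, smul_neg]
          abel
        simp only [h1]
        refine hcone x ⟨hx, hxb.1⟩ _ ?_ t ⟨htpos.le, htle⟩
        rw [Metric.mem_closedBall, dist_eq_norm, add_sub_cancel_left, norm_smul,
          Real.norm_of_nonneg (div_nonneg hθ.1 htpos.le), ht]
        have h2 : θ / (‖x - y‖ / ε) * ‖x - y‖ = θ * ε := by field_simp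
        rw [h2]
        exact mul_le_of_le_one_left hε.le hθ.2
      have h3 : g x - g y = (g x - g (x - t • e)) + (g (x - t • e) - g (y - t • e))
          - (g y - g (y - t • e)) := by abel
      rw [h3]
      refine (norm_sub_le _ _).trans ((_root_.add_le_add (norm_add_le _ _) le_rfl).trans ?_)
      have h4 := hside x ⟨hx, hxb.1⟩
      have h5 := hside y ⟨hy, hyb.1⟩
      have h6 : M * (2 * ‖e‖ / ε + 1) * ‖x - y‖
          = M * (t * ‖e‖) + M * ‖x - y‖ + M * (t * ‖e‖) := by
        rw [ht]; ring
      rw [h6]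
      linarith
    · have hpos : 0 < ‖x₀ - y₀‖ := norm_pos_iff.2 (sub_ne_zero.2 hxy)
      have hc : Continuous fun p : Euc N × Euc N => ‖p.1 - p.2‖ := by fun_prop
      have hev : ∀ᶠ p in 𝓝 (x₀, y₀), ‖x₀ - y₀‖ / 2 < ‖p.1 - p.2‖ :=
        (hc.tendsto (x₀, y₀)).eventually_const_lt (half_lt_self hpos)
      refine ⟨_, mem_nhdsWithin_of_mem_nhds hev, 2 * M / (‖x₀ - y₀‖ / 2), ?_⟩
      intro x hx y hy hp
      have hp' : ‖x₀ - y₀‖ / 2 < ‖x - y‖ := hp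
      have hM : 0 ≤ M := (norm_nonneg _).trans (hg x hx)
      calc ‖g x - g y‖ ≤ 2 * M := (norm_sub_le _ _).trans (by linarith [hg x hx, hg y hy])
        _ = 2 * M / (‖x₀ - y₀‖ / 2) * (‖x₀ - y₀‖ / 2) := by field_simp
        _ ≤ _ := by gcongr
  obtain ⟨L, hL⟩ := (hK.prod hK).induction_on
    (p := fun w => ∃ L, ∀ x ∈ Ω, ∀ y ∈ Ω, (x, y) ∈ w → ‖g x - g y‖ ≤ L * ‖x - y‖)
    ⟨0, by simp⟩ (fun s t hst ⟨L, hL⟩ => ⟨L, fun x hx y hy h => hL x hx y hy (hst h)⟩)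
    (fun s t ⟨L, hL⟩ ⟨L', hL'⟩ => ⟨max L L', fun x hx y hy h => h.elim
      (fun h => (hL x hx y hy h).trans
        (mul_le_mul_of_nonneg_right (le_max_left _ _) (norm_nonneg _)))
      (fun h => (hL' x hx y hy h).trans
        (mul_le_mul_of_nonneg_right (le_max_right _ _) (norm_nonneg _)))⟩) hloc
  exact ⟨L, fun x hx y hy => hL x hx y hy ⟨subset_closure hx, subset_closure hy⟩⟩

theorem IsSmoothDomain.exists_lipschitz_iteratedFDeriv {N : ℕ} {Ω : Set (Euc N)}
    (hΩ : IsSmoothDomain Ω) {F : Type*} [NormedAddCommGroup F] [NormedSpace ℝ F] {m k : ℕ}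
    (hk : k + 1 ≤ m) {u : Euc N → F} (hu : ContDiffOn ℝ m u (closure Ω)) :
    ∃ L, ∀ x ∈ Ω, ∀ y ∈ Ω,
      ‖iteratedFDeriv ℝ k u x - iteratedFDeriv ℝ k u y‖ ≤ L * ‖x - y‖ := by
  obtain ⟨M, hM⟩ := hu.exists_iteratedFDeriv_le hΩ.1 hΩ.2.1.isCompact_closure
  refine hΩ.exists_lipschitz (M := M) (fun x hx => ?_) (fun x hx => hM k (by omega) x hx)
    (fun x hx => ?_)
  · have h1 : ContDiffAt ℝ m u x :=
      (hu.mono subset_closure).contDiffAt (hΩ.1.mem_nhds hx)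
    exact (h1.differentiableAt_iteratedFDeriv (by exact_mod_cast hk))
  · rw [norm_fderiv_iteratedFDeriv]
    exact hM (k + 1) hk x hx

section ComponentBounds

variable {N n : ℕ}

theorem pderivList_congr_of_eventuallyEq {f g : Euc N → ℝ} {x : Euc N} (h : f =ᶠ[𝓝 x] g)
    (l : List (Fin N)) : pderivList l f =ᶠ[𝓝 x] pderivList l g := by
  induction l with
  | nil => exact h
  | cons i l ih =>
    exact (ih.fderiv (𝕜 := ℝ)).mono fun y hy => by
      simp only [pderivList, pderiv', hy]

theorem pderivList_component {m : ℕ} {Ω : Set (Euc N)} (hΩ : IsOpen Ω) {u : Euc N → Fin n → ℝ}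
    (hu : ContDiffOn ℝ m u Ω) (b : Fin n) (l : List (Fin N)) (hl : l.length ≤ m) :
    ∀ x ∈ Ω, pderivList l (fun y => u y b) x =
      iteratedFDeriv ℝ l.length u x (fun i => EuclideanSpace.single (l.get i) 1) b := by
  induction l with
  | nil => intro x _; simp [pderivList]
  | cons i l ih =>
    intro x hx
    have hl' : l.length + 1 ≤ m := by simpa using hl
    have h1 : pderivList l (fun y => u y b) =ᶠ[𝓝 x] fun y =>
        iteratedFDeriv ℝ l.length u y (fun i => EuclideanSpace.single (l.get i) 1) b := by
      filter_upwards [hΩ.mem_nhds hx] with y hy using ih (by omega) y hy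
    have h2 : DifferentiableAt ℝ (iteratedFDeriv ℝ l.length u) x :=
      (hu.contDiffAt (hΩ.mem_nhds hx)).differentiableAt_iteratedFDeriv (by exact_mod_cast hl')
    have h3 := (hasFDerivAt_pi'.1 (h2.hasFDerivAt.continuousMultilinear_apply_const
      (fun i => (EuclideanSpace.single (l.get i) 1 : Euc N)))) b
    simp only [pderivList, pderiv']
    rw [h1.fderiv_eq, h3.fderiv]
    simp only [List.length_cons]
    rw [iteratedFDeriv_succ_apply_left]
    rfl

theorem abs_apply_single_le {k : ℕ} (A : Euc N [×n]→L[ℝ] (Fin k → ℝ)) (v : Fin n → Fin N) (b : Fin k) :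
    |A (fun i => EuclideanSpace.single (v i) 1) b| ≤ ‖A‖ := by
  have h1 := norm_le_pi_norm (A (fun i => EuclideanSpace.single (v i) 1)) b
  have h2 := A.le_opNorm (fun i => (EuclideanSpace.single (v i) 1 : Euc N))
  simp only [PiLp.norm_single, norm_one, Finset.prod_const_one, mul_one] at h2
  exact h1.trans h2

theorem abs_pderivList_component_le {m : ℕ} {Ω : Set (Euc N)} (hΩ : IsOpen Ω)
    {u : Euc N → Fin n → ℝ} (hu : ContDiffOn ℝ m u Ω) (b : Fin n) (l : List (Fin N))
    (hl : l.length ≤ m) {x : Euc N} (hx : x ∈ Ω) :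
    |pderivList l (fun y => u y b) x| ≤ ‖iteratedFDeriv ℝ l.length u x‖ := by
  rw [pderivList_component hΩ hu b l hl x hx]
  exact abs_apply_single_le _ _ _

theorem abs_pderivList_component_sub_le {m : ℕ} {Ω : Set (Euc N)} (hΩ : IsOpen Ω)
    {u : Euc N → Fin n → ℝ} (hu : ContDiffOn ℝ m u Ω) (b : Fin n) (l : List (Fin N))
    (hl : l.length ≤ m) {x y : Euc N} (hx : x ∈ Ω) (hy : y ∈ Ω) :
    |pderivList l (fun y => u y b) x - pderivList l (fun y => u y b) y| ≤
      ‖iteratedFDeriv ℝ l.length u x - iteratedFDeriv ℝ l.length u y‖ := by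
  rw [pderivList_component hΩ hu b l hl x hx, pderivList_component hΩ hu b l hl y hy]
  exact abs_apply_single_le (iteratedFDeriv ℝ l.length u x - iteratedFDeriv ℝ l.length u y) _ _

/-- The Gagliardo energy of the `k`-th derivative. -/
def gagEnergy (Ω : Set (Euc N)) (k q b : ℕ) (u : Euc N → Fin n → ℝ) : ENNReal :=
  ∫⁻ x in Ω, ∫⁻ y in Ω, ENNReal.ofReal
    (‖iteratedFDeriv ℝ k u x - iteratedFDeriv ℝ k u y‖ ^ q / ‖x - y‖ ^ b)

theorem diffSum_component_le {m k : ℕ} (hk : k ≤ m) {Ω : Set (Euc N)} (hΩ : IsOpen Ω)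
    {u : Euc N → Fin n → ℝ} (hu : ContDiffOn ℝ m u Ω) (b : Fin n) {f : Euc N → ℝ} {x y : Euc N}
    (hx : x ∈ Ω) (hy : y ∈ Ω) (hfx : f =ᶠ[𝓝 x] fun y => u y b) (hfy : f =ᶠ[𝓝 y] fun y => u y b) :
    diffSum k f x y ≤ (N ^ k : ℕ) * ‖iteratedFDeriv ℝ k u x - iteratedFDeriv ℝ k u y‖ := by
  have h : ∀ γ ∈ (Finset.univ : Finset (Fin k → Fin N)),
      |pderivList (List.ofFn γ) f x - pderivList (List.ofFn γ) f y| ≤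
        ‖iteratedFDeriv ℝ k u x - iteratedFDeriv ℝ k u y‖ := by
    intro γ _
    rw [(pderivList_congr_of_eventuallyEq hfx _).self_of_nhds,
      (pderivList_congr_of_eventuallyEq hfy _).self_of_nhds]
    have := abs_pderivList_component_sub_le hΩ hu b (List.ofFn γ) (by simpa using hk) hx hy
    rwa [List.length_ofFn] at this
  refine (Finset.sum_le_card_nsmul _ _ _ h).trans_eq ?_
  simp

theorem wordSumLE_component_le {m s : ℕ} (hs : s ≤ m) {Ω : Set (Euc N)} (hΩ : IsOpen Ω)
    {u : Euc N → Fin n → ℝ} (hu : ContDiffOn ℝ m u Ω) (b : Fin n) {f : Euc N → ℝ} {x : Euc N}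
    (hx : x ∈ Ω) (hfx : f =ᶠ[𝓝 x] fun y => u y b) :
    wordSumLE s f x ≤ ∑ j ∈ Finset.range (s + 1), (N ^ j : ℕ) * ‖iteratedFDeriv ℝ j u x‖ := by
  refine Finset.sum_le_sum fun j hj => ?_
  have h : ∀ γ ∈ (Finset.univ : Finset (Fin j → Fin N)),
      |pderivList (List.ofFn γ) f x| ≤ ‖iteratedFDeriv ℝ j u x‖ := by
    intro γ _
    rw [(pderivList_congr_of_eventuallyEq hfx _).self_of_nhds]
    have := abs_pderivList_component_le hΩ hu b (List.ofFn γ)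
      (by have := Finset.mem_range.1 hj; simp; omega) hx
    rwa [List.length_ofFn] at this
  refine (Finset.sum_le_card_nsmul _ _ _ h).trans_eq ?_
  simp

theorem ContDiffOn.continuousOn_norm_iteratedFDeriv {F : Type*} [NormedAddCommGroup F]
    [NormedSpace ℝ F] {m j : ℕ} {Ω : Set (Euc N)} (hΩ : IsOpen Ω) {u : Euc N → F}
    (hu : ContDiffOn ℝ m u Ω) (hj : j ≤ m) : ContinuousOn (iteratedFDeriv ℝ j u) Ω :=
  (hu.continuousOn_iteratedFDerivWithin (by exact_mod_cast hj) hΩ.uniqueDiffOn).congr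
    fun _ hx => (iteratedFDerivWithin_of_isOpen j hΩ hx).symm

theorem lintegral_norm_iteratedFDeriv_pow {m j q : ℕ} {Ω : Set (Euc N)} (hΩ : IsOpen Ω)
    (hb : Bornology.IsBounded Ω) {u : Euc N → Fin n → ℝ} (hu : ContDiffOn ℝ m u (closure Ω))
    (hj : j ≤ m) (hq : 1 ≤ q) :
    ∫⁻ x in Ω, ENNReal.ofReal (‖iteratedFDeriv ℝ j u x‖ ^ q) =
      ENNReal.ofReal (((∫ x in Ω, ‖iteratedFDeriv ℝ j u x‖ ^ (q : ℝ)) ^ (1 / (q : ℝ))) ^ q) := by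
  obtain ⟨M, hM⟩ := hu.exists_iteratedFDeriv_le hΩ hb.isCompact_closure
  have hc := ((hu.mono subset_closure).continuousOn_norm_iteratedFDeriv hΩ hj).norm
  have hq0 : (q : ℝ) ≠ 0 := by positivity
  rw [← Real.rpow_natCast (_ ^ (1 / (q : ℝ))) q, ← Real.rpow_mul (by positivity),
    one_div_mul_cancel hq0, Real.rpow_one]
  simp only [Real.rpow_natCast]
  symm
  refine ofReal_integral_eq_lintegral_ofReal ?_ (ae_of_all _ fun x => by positivity)
  have : IsFiniteMeasure (volume.restrict Ω) :=
    isFiniteMeasure_restrict.2 hb.measure_lt_top.ne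
  refine Integrable.of_bound ((hc.pow q).aestronglyMeasurable hΩ.measurableSet) (M ^ q) ?_
  filter_upwards [ae_restrict_mem hΩ.measurableSet] with x hx
  rw [Real.norm_of_nonneg (by positivity)]
  exact pow_le_pow_left₀ (norm_nonneg _) (hM j hj x hx) q

theorem intSobNorm_nonneg (Ω : Set (Euc N)) (k : ℕ) (p : ℝ) (u : Euc N → Fin n → ℝ) :
    0 ≤ intSobNorm Ω k p u :=
  Finset.sum_nonneg fun _ _ => Real.rpow_nonneg (integral_nonneg fun _ => by positivity) _

theorem exists_intEnergy_rpow_le (N n : ℕ) {s q : ℕ} (hq : 1 ≤ q) :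
    ∃ C : ℝ, 0 ≤ C ∧ ∀ (m : ℕ), s ≤ m → ∀ Ω : Set (Euc N), IsOpen Ω → Bornology.IsBounded Ω →
      ∀ u : Euc N → Fin n → ℝ, ContDiffOn ℝ m u (closure Ω) → ∀ (b : Fin n) (f : Euc N → ℝ)
      (K : Set (Euc N)), MeasurableSet K → K ⊆ Ω → (∀ x ∈ K, f =ᶠ[𝓝 x] fun y => u y b) →
      intEnergy K s q f ^ (1 / (q : ℝ)) ≤ ENNReal.ofReal (C * intSobNorm Ω s q u) := by
  obtain ⟨p, rfl⟩ : ∃ p, q = p + 1 := ⟨q - 1, by omega⟩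
  set A : ℝ := ∑ j ∈ Finset.range (s + 1), ((N ^ j : ℕ) : ℝ) with hA
  have hA0 : 0 ≤ A := Finset.sum_nonneg fun _ _ => by positivity
  refine ⟨A * (s + 1), by positivity, ?_⟩
  intro m hs Ω hΩ hb u hu b f K hKm hKΩ hf
  set S := intSobNorm Ω s ((p + 1 : ℕ) : ℝ) u with hS
  have hS0 : 0 ≤ S := intSobNorm_nonneg _ _ _ _
  have hpt : ∀ x ∈ K, ENNReal.ofReal (wordSumLE s f x) ^ (p + 1) ≤
      ∑ j ∈ Finset.range (s + 1), ENNReal.ofReal (A ^ (p + 1) * (s + 1 : ℝ) ^ p) *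
        ENNReal.ofReal (‖iteratedFDeriv ℝ j u x‖ ^ (p + 1)) := by
    intro x hx
    rw [← Finset.mul_sum, ← ENNReal.ofReal_sum_of_nonneg (fun _ _ => by positivity),
      ← ENNReal.ofReal_mul (by positivity), ← ENNReal.ofReal_pow (wordSumLE_nonneg _ _ _)]
    refine ENNReal.ofReal_le_ofReal ?_
    have h1 := wordSumLE_component_le hs hΩ (hu.mono subset_closure) b (hKΩ hx) (hf x hx)
    have h2 : ∑ j ∈ Finset.range (s + 1), ((N ^ j : ℕ) : ℝ) * ‖iteratedFDeriv ℝ j u x‖ ≤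
        A * ∑ j ∈ Finset.range (s + 1), ‖iteratedFDeriv ℝ j u x‖ := by
      rw [Finset.mul_sum]
      refine Finset.sum_le_sum fun j hj => ?_
      refine mul_le_mul_of_nonneg_right ?_ (norm_nonneg _)
      exact Finset.single_le_sum (f := fun j => ((N ^ j : ℕ) : ℝ)) (fun _ _ => by positivity) hj
    have h3 := pow_sum_div_card_le_sum_pow (s := Finset.range (s + 1))
      (f := fun j => ‖iteratedFDeriv ℝ j u x‖) (n := p) (fun _ _ => norm_nonneg _)
    rw [Finset.card_range, div_le_iff₀ (by positivity)] at h3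
    calc wordSumLE s f x ^ (p + 1)
        ≤ (A * ∑ j ∈ Finset.range (s + 1), ‖iteratedFDeriv ℝ j u x‖) ^ (p + 1) :=
          pow_le_pow_left₀ (wordSumLE_nonneg _ _ _) (h1.trans h2) _
      _ = A ^ (p + 1) * (∑ j ∈ Finset.range (s + 1), ‖iteratedFDeriv ℝ j u x‖) ^ (p + 1) :=
          mul_pow _ _ _
      _ ≤ A ^ (p + 1) * ((∑ j ∈ Finset.range (s + 1), ‖iteratedFDeriv ℝ j u x‖ ^ (p + 1)) *
            ((s + 1 : ℕ) : ℝ) ^ p) := mul_le_mul_of_nonneg_left h3 (by positivity)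
      _ = _ := by push_cast; ring
  have hj : ∀ j ∈ Finset.range (s + 1),
      ∫⁻ x in Ω, ENNReal.ofReal (‖iteratedFDeriv ℝ j u x‖ ^ (p + 1)) ≤
        ENNReal.ofReal (S ^ (p + 1)) := by
    intro j hj
    have hjs := Finset.mem_range.1 hj
    rw [lintegral_norm_iteratedFDeriv_pow hΩ hb hu (by omega) (by omega)]
    refine ENNReal.ofReal_le_ofReal (pow_le_pow_left₀
      (Real.rpow_nonneg (integral_nonneg fun _ => by positivity) _) ?_ _)
    exact Finset.single_le_sum (f := fun j =>
      (∫ x in Ω, ‖iteratedFDeriv ℝ j u x‖ ^ ((p + 1 : ℕ) : ℝ)) ^ (1 / ((p + 1 : ℕ) : ℝ)))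
      (fun _ _ => Real.rpow_nonneg (integral_nonneg fun _ => by positivity) _) hj
  have hmain : intEnergy K s (p + 1) f ≤ ENNReal.ofReal ((A * (s + 1) * S) ^ (p + 1)) := by
    calc intEnergy K s (p + 1) f
        ≤ ∫⁻ x in K, ∑ j ∈ Finset.range (s + 1), ENNReal.ofReal (A ^ (p + 1) * (s + 1 : ℝ) ^ p) *
        ENNReal.ofReal (‖iteratedFDeriv ℝ j u x‖ ^ (p + 1)) :=
          setLIntegral_mono_ae' hKm (ae_of_all _ hpt)
      _ ≤ ∫⁻ x in Ω, ∑ j ∈ Finset.range (s + 1), ENNReal.ofReal (A ^ (p + 1) * (s + 1 : ℝ) ^ p) *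
        ENNReal.ofReal (‖iteratedFDeriv ℝ j u x‖ ^ (p + 1)) := lintegral_mono_set hKΩ
      _ = ∑ j ∈ Finset.range (s + 1), ENNReal.ofReal (A ^ (p + 1) * (s + 1 : ℝ) ^ p) *
        ∫⁻ x in Ω, ENNReal.ofReal (‖iteratedFDeriv ℝ j u x‖ ^ (p + 1)) := by
          have hm : ∀ j ∈ Finset.range (s + 1), AEMeasurable
              (fun x => ENNReal.ofReal (‖iteratedFDeriv ℝ j u x‖ ^ (p + 1)))
              (volume.restrict Ω) := by
            intro j hj
            have hjs := Finset.mem_range.1 hj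
            have hc := ((hu.mono subset_closure).continuousOn_norm_iteratedFDeriv hΩ
              (show j ≤ m by omega)).norm
            exact ((hc.pow _).aemeasurable hΩ.measurableSet).ennreal_ofReal
          rw [lintegral_finsetSum' _ fun j hj => (hm j hj).const_mul _]
          exact Finset.sum_congr rfl fun j hj => lintegral_const_mul'' _ (hm j hj)
      _ ≤ ∑ j ∈ Finset.range (s + 1), ENNReal.ofReal (A ^ (p + 1) * (s + 1 : ℝ) ^ p) *
            ENNReal.ofReal (S ^ (p + 1)) := by
          gcongr with j hj'
          exact hj j hj'
      _ = ENNReal.ofReal ((A * (s + 1) * S) ^ (p + 1)) := by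
          rw [Finset.sum_const, Finset.card_range, ← ENNReal.ofReal_mul (by positivity),
            ← ENNReal.ofReal_nsmul]
          congr 1
          rw [nsmul_eq_mul, mul_pow, mul_pow]
          push_cast
          ring
  refine (ENNReal.rpow_le_rpow hmain (by positivity)).trans_eq ?_
  rw [ENNReal.ofReal_pow (by positivity), ← ENNReal.rpow_natCast, ← ENNReal.rpow_mul,
    mul_one_div_cancel (by positivity), ENNReal.rpow_one]

end ComponentBounds

section DilationBound

variable {N n : ℕ}

theorem ContinuousOn.measurable_indicator {X : Type*} [TopologicalSpace X] [MeasurableSpace X]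
    [OpensMeasurableSpace X] {s : Set X} (hs : MeasurableSet s) {f : X → ℝ}
    (hf : ContinuousOn f s) : Measurable (s.indicator f) := by
  classical
  rw [← Set.piecewise_eq_indicator]
  exact hf.measurable_piecewise continuousOn_const hs

theorem integrable_indicator_norm_pow_div (hN : 1 ≤ N) {q b : ℕ} (hb : b < N + q) (R : ℝ) :
    Integrable ((Metric.ball (0 : Euc N) R).indicator fun z => ‖z‖ ^ q / ‖z‖ ^ b) := by
  have : Nonempty (Fin N) := ⟨⟨0, hN⟩⟩
  have h1 : ((Metric.ball (0 : Euc N) R).indicator fun z => ‖z‖ ^ q / ‖z‖ ^ b) =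
      fun z => (Set.Iio R).indicator (fun t : ℝ => t ^ q / t ^ b) ‖z‖ := by
    funext z
    by_cases hz : ‖z‖ < R
    · rw [Set.indicator_of_mem (by simpa using hz), Set.indicator_of_mem (by simpa using hz)]
    · rw [Set.indicator_of_notMem (by simpa using hz), Set.indicator_of_notMem (by simpa using hz)]
  rw [h1, integrable_fun_norm_addHaar, finrank_euclideanSpace_fin]
  have h2 : (fun y : ℝ => y ^ (N - 1) • (Set.Iio R).indicator (fun t : ℝ => t ^ q / t ^ b) y) =
      (Set.Iio R).indicator fun t => t ^ (N - 1) * (t ^ q / t ^ b) := by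
    funext y
    by_cases hy : y < R
    · rw [Set.indicator_of_mem (by simpa using hy), Set.indicator_of_mem (by simpa using hy),
        smul_eq_mul]
    · rw [Set.indicator_of_notMem (by simpa using hy), Set.indicator_of_notMem (by simpa using hy),
        smul_zero]
  rw [h2, IntegrableOn, integrable_indicator_iff measurableSet_Iio, IntegrableOn,
    Measure.restrict_restrict measurableSet_Iio]
  have hset : Set.Iio R ∩ Set.Ioi 0 = Set.Ioo 0 R := by
    ext y; simp [and_comm]
  rw [hset]
  refine Integrable.of_bound (by fun_prop) (R ^ (N - 1 + q - b)) ?_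
  filter_upwards [ae_restrict_mem measurableSet_Ioo] with t ht
  have h3 : t ^ (N - 1) * (t ^ q / t ^ b) = t ^ (N - 1 + q - b) := by
    rw [← mul_div_assoc, ← pow_add, div_eq_iff (pow_ne_zero _ ht.1.ne'), ← pow_add]
    congr 1
    omega
  rw [h3, Real.norm_of_nonneg (pow_nonneg ht.1.le _)]
  exact pow_le_pow_left₀ ht.1.le ht.2.le _

theorem gagEnergy_le_ofReal_integral (hN : 1 ≤ N) {m k q b : ℕ} (hk : k + 1 ≤ m)
    (hb : b < N + q) {Ω : Set (Euc N)} (hΩ : IsSmoothDomain Ω) {u : Euc N → Fin n → ℝ}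
    (hu : ContDiffOn ℝ m u (closure Ω)) :
    gagEnergy Ω k q b u ≤ ENNReal.ofReal (∫ x in Ω, ∫ y in Ω,
      ‖iteratedFDeriv ℝ k u x - iteratedFDeriv ℝ k u y‖ ^ q / ‖x - y‖ ^ b) := by
  obtain ⟨L, hL⟩ := hΩ.exists_lipschitz_iteratedFDeriv hk hu
  obtain ⟨R, hR⟩ := hΩ.2.1.subset_ball_lt 0 0 |>.imp fun _ h => h.2
  have hΩm : MeasurableSet Ω := hΩ.1.measurableSet
  have hfin : IsFiniteMeasure (volume.restrict Ω) :=
    isFiniteMeasure_restrict.2 hΩ.2.1.measure_lt_top.ne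
  have hc := (hu.mono subset_closure).continuousOn_norm_iteratedFDeriv hΩ.1 (show k ≤ m by omega)
  set D := iteratedFDeriv ℝ k u with hD
  set G := (Metric.ball (0 : Euc N) (2 * R)).indicator fun z => ‖z‖ ^ q / ‖z‖ ^ b with hG
  have hGi : Integrable G := integrable_indicator_norm_pow_div hN hb _
  have hG0 : ∀ z, 0 ≤ G z := fun z => Set.indicator_nonneg (fun _ _ => by positivity) _
  have hbd : ∀ x ∈ Ω, ∀ y ∈ Ω, ‖D x - D y‖ ^ q / ‖x - y‖ ^ b ≤ |L| ^ q * G (x - y) := by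
    intro x hx y hy
    have hmem : x - y ∈ Metric.ball (0 : Euc N) (2 * R) := by
      have h1 := hR hx
      have h2 := hR hy
      rw [mem_ball_zero_iff] at *
      linarith [norm_sub_le x y]
    rw [hG, Set.indicator_of_mem hmem, ← mul_div_assoc, ← mul_pow]
    have h3 : ‖D x - D y‖ ≤ |L| * ‖x - y‖ :=
      (hL x hx y hy).trans (mul_le_mul_of_nonneg_right (le_abs_self L) (norm_nonneg _))
    gcongr
  have hcont : ContinuousOn (fun p : Euc N × Euc N => ‖D p.1 - D p.2‖) (Ω ×ˢ Ω) :=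
    ((hc.comp continuousOn_fst fun p hp => hp.1).sub
      (hc.comp continuousOn_snd fun p hp => hp.2)).norm
  have hmeas : AEMeasurable
      (fun p : Euc N × Euc N => ‖D p.1 - D p.2‖ ^ q / ‖p.1 - p.2‖ ^ b)
      ((volume.restrict Ω).prod (volume.restrict Ω)) := by
    rw [Measure.prod_restrict]
    refine ((hcont.aemeasurable (hΩm.prod hΩm)).pow_const q).div ?_
    exact (Continuous.measurable (by fun_prop)).aemeasurable
  have hmeasx : ∀ x ∈ Ω, AEMeasurable (fun y => ‖D x - D y‖ ^ q / ‖x - y‖ ^ b)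
      (volume.restrict Ω) := by
    intro x _
    refine ((((continuousOn_const.sub hc).norm).aemeasurable hΩm).pow_const q).div ?_
    exact (Continuous.measurable (by fun_prop)).aemeasurable
  have hint : ∀ x ∈ Ω, IntegrableOn (fun y => ‖D x - D y‖ ^ q / ‖x - y‖ ^ b) Ω := by
    intro x hx
    refine Integrable.mono' (((hGi.comp_sub_left x).const_mul (|L| ^ q)).integrableOn (s := Ω))
      (hmeasx x hx).aestronglyMeasurable ?_
    filter_upwards [ae_restrict_mem hΩm] with y hy
    rw [Real.norm_of_nonneg (by positivity)]
    exact hbd x hx y hy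
  have hF : Integrable (fun x => ∫ y in Ω, ‖D x - D y‖ ^ q / ‖x - y‖ ^ b)
      (volume.restrict Ω) := by
    refine Integrable.of_bound hmeas.aestronglyMeasurable.integral_prod_right'
      (|L| ^ q * ∫ z, G z) ?_
    filter_upwards [ae_restrict_mem hΩm] with x hx
    rw [Real.norm_of_nonneg (integral_nonneg fun _ => by positivity)]
    calc ∫ y in Ω, ‖D x - D y‖ ^ q / ‖x - y‖ ^ b
        ≤ ∫ y in Ω, |L| ^ q * G (x - y) :=
          setIntegral_mono_on (hint x hx)
            ((hGi.comp_sub_left x).const_mul (|L| ^ q)).integrableOn hΩm (hbd x hx)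
      _ ≤ ∫ y, |L| ^ q * G (x - y) :=
          setIntegral_le_integral ((hGi.comp_sub_left x).const_mul (|L| ^ q))
            (ae_of_all _ fun y => mul_nonneg (by positivity) (hG0 _))
      _ = |L| ^ q * ∫ z, G z := by rw [integral_const_mul, integral_sub_left_eq_self]
  rw [ofReal_integral_eq_lintegral_ofReal hF
    (ae_of_all _ fun x => integral_nonneg fun _ => by positivity)]
  refine setLIntegral_mono_ae' hΩm (ae_of_all _ fun x hx => ?_)
  rw [ofReal_integral_eq_lintegral_ofReal (hint x hx) (ae_of_all _ fun y => by positivity)]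

theorem dilEnergy_le_gagEnergy {m k q b : ℕ} (hkm : k < m) (hq : 1 ≤ q) (hb : 0 < b)
    (hab : N + (m - k) * q = m + b) {S : Set (Euc N)} (hSm : MeasurableSet S) {R : ℝ} (hR : 0 < R)
    (hS : ∀ z ∈ S, ‖z‖ ≤ R) (t₀ : ℝ) {Ω : Set (Euc N)} (hΩ : IsOpen Ω) {K : Set (Euc N)}
    (hK : MeasurableSet K) (hKΩ : K ⊆ Ω)
    (hx : ∀ x ∈ K, ∀ t ∈ Set.Ioo 0 t₀, ∀ z ∈ S, x - t • z ∈ Ω) {u : Euc N → Fin n → ℝ}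
    (hu : ContDiffOn ℝ m u Ω) (c : Fin n) {f : Euc N → ℝ}
    (hf : ∀ x ∈ K, f =ᶠ[𝓝 x] fun y => u y c)
    (hf' : ∀ x ∈ K, ∀ t ∈ Set.Ioo 0 t₀, ∀ z ∈ S, f =ᶠ[𝓝 (x - t • z)] fun y => u y c) :
    dilEnergy K t₀ S m k q f ≤
      ENNReal.ofReal ((N ^ k : ℕ) ^ q) * ENNReal.ofReal (R ^ b / b) * gagEnergy Ω k q b u := by
  have hc := hu.continuousOn_norm_iteratedFDeriv hΩ (show k ≤ m by omega)
  set D := iteratedFDeriv ℝ k u with hD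
  set A := ENNReal.ofReal (((N ^ k : ℕ) : ℝ) ^ q) with hA
  have hAtop : A ≠ ⊤ := ENNReal.ofReal_ne_top
  rw [dilEnergy, Measure.volume_eq_prod, ← Measure.prod_restrict]
  refine (lintegral_prod_le _).trans ?_
  rw [gagEnergy, ← lintegral_const_mul' _ _
    (ENNReal.mul_ne_top hAtop ENNReal.ofReal_ne_top)]
  refine le_trans ?_ (lintegral_mono_set hKΩ)
  refine setLIntegral_mono_ae' hK (ae_of_all _ fun x hxK => ?_)
  set g : Euc N → ENNReal := fun y => ENNReal.ofReal (Ω.indicator (fun y => ‖D x - D y‖) y) ^ q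
    with hg
  have hgm : Measurable g :=
    (((continuousOn_const.sub hc).norm.measurable_indicator hΩ.measurableSet).ennreal_ofReal).pow_const q
  have hgx : g x = 0 := by
    simp only [hg, Set.indicator_of_mem (hKΩ hxK), sub_self, norm_zero, ENNReal.ofReal_zero]
    exact zero_pow (by omega)
  have hdil := lintegral_dil_le (N := N) hSm hR hS (a := m - 1) (c := (m - k) * q) hb (by omega) t₀
    hΩ.measurableSet (x := x) (hx x hxK) hgm hgx
  calc ∫⁻ t in Set.Ioo 0 t₀, ∫⁻ z in S, ENNReal.ofReal (t ^ (m - 1) * (t⁻¹ ^ (m - k)) ^ q) *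
        ENNReal.ofReal (diffSum k f (x - t • z) x) ^ q
      ≤ ∫⁻ t in Set.Ioo 0 t₀, ∫⁻ z in S, A *
          (ENNReal.ofReal (t ^ (m - 1) * t⁻¹ ^ ((m - k) * q)) * g (x - t • z)) := by
        refine setLIntegral_mono_ae' measurableSet_Ioo (ae_of_all _ fun t ht => ?_)
        refine setLIntegral_mono_ae' hSm (ae_of_all _ fun z hz => ?_)
        rw [← pow_mul, mul_left_comm]
        gcongr
        rw [hA, ENNReal.ofReal_pow (by positivity), hg, ← mul_pow]
        refine pow_le_pow_left' ?_ q
        rw [Set.indicator_of_mem (hx x hxK t ht z hz), ← ENNReal.ofReal_mul (by positivity),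
          norm_sub_rev]
        exact ENNReal.ofReal_le_ofReal (diffSum_component_le (by omega) hΩ hu c
          (hx x hxK t ht z hz) (hKΩ hxK) (hf' x hxK t ht z hz) (hf x hxK))
    _ = A * ∫⁻ t in Set.Ioo 0 t₀, ∫⁻ z in S,
          ENNReal.ofReal (t ^ (m - 1) * t⁻¹ ^ ((m - k) * q)) * g (x - t • z) := by
        rw [← lintegral_const_mul' _ _ hAtop]
        refine lintegral_congr fun t => ?_
        rw [lintegral_const_mul' _ _ hAtop]
    _ ≤ A * (ENNReal.ofReal (R ^ b / b) *
          ∫⁻ y in Ω, g y * ENNReal.ofReal ((‖x - y‖ ^ b)⁻¹)) := by gcongr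
    _ = A * ENNReal.ofReal (R ^ b / b) *
          ∫⁻ y in Ω, ENNReal.ofReal (‖D x - D y‖ ^ q / ‖x - y‖ ^ b) := by
        rw [mul_assoc]
        congr 2
        refine setLIntegral_congr_fun hΩ.measurableSet fun y hy => ?_
        simp only [hg, Set.indicator_of_mem hy]
        rw [← ENNReal.ofReal_pow (norm_nonneg _), ← ENNReal.ofReal_mul (by positivity),
          div_eq_mul_inv]

end DilationBound

section SobolevNorms

variable {N n : ℕ}

theorem sobNorm_nonneg (Ω : Set (Euc N)) (s p : ℝ) (u : Euc N → Fin n → ℝ) :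
    0 ≤ sobNorm Ω s p u := by
  unfold sobNorm
  split_ifs
  · exact intSobNorm_nonneg _ _ _ _
  · exact add_nonneg (intSobNorm_nonneg _ _ _ _) (Real.rpow_nonneg
      (integral_nonneg fun _ => integral_nonneg fun _ => by positivity) _)

theorem sobNorm_eq_intSobNorm {m q d : ℕ} (hq : 1 ≤ q) (hd : m = q * d) (Ω : Set (Euc N))
    (u : Euc N → Fin n → ℝ) :
    sobNorm Ω ((m : ℝ) - (m : ℝ) / q) q u = intSobNorm Ω (m - d) q u := by
  have hq0 : (q : ℝ) ≠ 0 := by positivity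
  have hdm : d ≤ m := by rw [hd]; exact Nat.le_mul_of_pos_left d (by omega)
  have h : (m : ℝ) - (m : ℝ) / q = ((m - d : ℕ) : ℝ) := by
    rw [Nat.cast_sub hdm, hd]
    push_cast
    field_simp
  rw [h, sobNorm, if_pos ⟨_, rfl⟩, Nat.floor_natCast]

theorem gagEnergy_rpow_le_sobNorm (hN : 1 ≤ N) {m q : ℕ} (hm : 1 ≤ m) (hq : 2 ≤ q)
    (hd : ¬ q ∣ m) {b : ℕ} (hb : N + (m / q + 1) * q = m + b) {Ω : Set (Euc N)}
    (hΩ : IsSmoothDomain Ω) {u : Euc N → Fin n → ℝ} (hu : ContDiffOn ℝ m u (closure Ω)) :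
    gagEnergy Ω (m - m / q - 1) q b u ^ (1 / (q : ℝ)) ≤
      ENNReal.ofReal (sobNorm Ω ((m : ℝ) - (m : ℝ) / q) q u) := by
  have hq0 : (0 : ℝ) < q := by positivity
  have hdm : m / q < m := Nat.div_lt_self hm hq
  have h1 := Nat.div_add_mod m q
  have h2 : m % q ≠ 0 := fun h => hd (Nat.dvd_of_mod_eq_zero h)
  have h3 : m % q < q := Nat.mod_lt _ (by omega)
  have hr1 : (m : ℝ) = q * (m / q : ℕ) + (m % q : ℕ) := by exact_mod_cast h1.symm
  have hr2 : (m : ℝ) / q = (m / q : ℕ) + ((m % q : ℕ) : ℝ) / q := by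
    conv_lhs => rw [hr1]
    field_simp
  have hpos : 0 < ((m % q : ℕ) : ℝ) / q := div_pos (by exact_mod_cast Nat.pos_of_ne_zero h2) hq0
  have hlt : ((m % q : ℕ) : ℝ) / q < 1 := (div_lt_one hq0).2 (by exact_mod_cast h3)
  have hk : ((m - m / q - 1 : ℕ) : ℝ) = (m : ℝ) - (m / q : ℕ) - 1 := by
    rw [Nat.cast_sub (by omega), Nat.cast_sub hdm.le, Nat.cast_one]
  set s : ℝ := (m : ℝ) - (m : ℝ) / q with hs
  have hfl : ⌊s⌋₊ = m - m / q - 1 := by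
    rw [Nat.floor_eq_iff (by rw [hs]; have := Nat.cast_nonneg (α := ℝ) (m - m / q - 1); linarith)]
    constructor <;> linarith
  have hne : ¬ ∃ k : ℕ, s = k := by
    rintro ⟨k, hk'⟩
    have ha : ((m - m / q - 1 : ℕ) : ℝ) < k := by linarith
    have hb' : (k : ℝ) < ((m - m / q - 1 : ℕ) : ℝ) + 1 := by linarith
    have ha' : m - m / q - 1 < k := by exact_mod_cast ha
    have hb'' : k < m - m / q - 1 + 1 := by exact_mod_cast hb'
    omega
  have hexp : (N : ℝ) + (s - ((m - m / q - 1 : ℕ) : ℝ)) * q = (b : ℝ) := by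
    have hbr : (N : ℝ) + ((m / q : ℕ) + 1) * q = m + b := by exact_mod_cast hb
    have hsq : (m : ℝ) / q * q = m := by field_simp
    rw [hs, hk]
    nlinarith
  have hbN : b < N + q := by
    have h4 : (m / q + 1) * q = q * (m / q) + q := by ring
    rw [h4] at hb
    omega
  have hk1 : ∀ a < m, m - a - 1 + 1 ≤ m := fun a ha => by omega
  have hgag := gagEnergy_le_ofReal_integral (q := q) (b := b) hN
    (hk1 _ hdm) hbN hΩ hu
  rw [sobNorm, if_neg hne, hfl, hexp]
  simp only [Real.rpow_natCast]
  refine (ENNReal.rpow_le_rpow hgag (by positivity)).trans ?_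
  rw [ENNReal.ofReal_rpow_of_nonneg
    (integral_nonneg fun _ => integral_nonneg fun _ => by positivity) (by positivity)]
  exact ENNReal.ofReal_le_ofReal (le_add_of_nonneg_left (intSobNorm_nonneg _ _ _ _))

theorem exists_contDiff_eventuallyEq {m : ℕ} {Ω K : Set (Euc N)} (hΩ : IsOpen Ω)
    (hK : IsCompact K) (hKΩ : K ⊆ Ω) {g : Euc N → ℝ} (hg : ContDiffOn ℝ m g Ω) :
    ∃ f : Euc N → ℝ, ContDiff ℝ m f ∧ HasCompactSupport f ∧ ∀ x ∈ K, f =ᶠ[𝓝 x] g := by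
  obtain ⟨L, hL, hKL, hLΩ⟩ := exists_compact_between hK hΩ hKΩ
  obtain ⟨η, hη1, hη0, -⟩ := exists_contMDiffMap_one_nhds_of_subset_interior
    (n := (⊤ : ℕ∞)) (modelWithCornersSelf ℝ (Euc N)) hK.isClosed hKL
  have hηc : ContDiff ℝ (⊤ : ℕ∞) (η : Euc N → ℝ) := η.contMDiff.contDiff
  have hts : tsupport (η : Euc N → ℝ) ⊆ L := by
    refine closure_minimal (fun x hx => ?_) hL.isClosed
    by_contra h
    exact hx (hη0 x h)
  have hηm : ContDiff ℝ m (η : Euc N → ℝ) := hηc.of_le (by exact_mod_cast le_top)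
  refine ⟨fun x => η x * g x, ?_, ?_, ?_⟩
  · rw [contDiff_iff_contDiffAt]
    intro x
    by_cases hx : x ∈ Ω
    · exact hηm.contDiffAt.mul (hg.contDiffAt (hΩ.mem_nhds hx))
    · have hx' : x ∉ tsupport (η : Euc N → ℝ) := fun h => hx (hLΩ (hts h))
      have h0 : (fun x => η x * g x) =ᶠ[𝓝 x] fun _ => (0 : ℝ) := by
        filter_upwards [notMem_tsupport_iff_eventuallyEq.1 hx'] with y hy
        rw [hy]; simp
      exact contDiffAt_const.congr_of_eventuallyEq h0
  · exact (HasCompactSupport.intro hL hη0).mul_right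
  · intro x hx
    filter_upwards [hη1.filter_mono (nhds_le_nhdsSet hx)] with y hy
    rw [hy, one_mul]

theorem exists_le_card_fiber {m r d : ℕ} (hr : 1 ≤ r) (h : r * d ≤ m) :
    ∃ i : Fin m → Fin r, ∀ k, d ≤ (Finset.univ.filter fun j => i j = k).card := by
  refine ⟨fun j => ⟨j % r, Nat.mod_lt _ hr⟩, fun k => ?_⟩
  have hlt : ∀ t : Fin d, (k : ℕ) + r * t < m := by
    intro t
    have h1 : r * (t + 1) ≤ r * d := Nat.mul_le_mul_left r t.2
    have h2 := k.2
    rw [Nat.mul_add] at h1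
    omega
  have hinj : Function.Injective fun t : Fin d => (⟨k + r * t, hlt t⟩ : Fin m) := by
    intro t t' htt
    have h1 : (k : ℕ) + r * t = k + r * t' := congrArg Fin.val htt
    have h2 : r * (t : ℕ) = r * t' := by omega
    exact Fin.ext (Nat.eq_of_mul_eq_mul_left hr h2)
  have := Finset.card_le_card_of_injOn (s := (Finset.univ : Finset (Fin d)))
    (t := Finset.univ.filter fun j : Fin m => (⟨j % r, Nat.mod_lt _ hr⟩ : Fin r) = k)
    (fun t => (⟨k + r * t, hlt t⟩ : Fin m)) (fun t _ => by
      simp only [Finset.coe_filter, Finset.mem_univ, true_and, Set.mem_ofPred_eq]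
      ext
      simp [Nat.add_mul_mod_self_left, Nat.mod_eq_of_lt k.2]) hinj.injOn
  simpa using this

end SobolevNorms

section LocalBound

open scoped ENNReal

variable {N n m r : ℕ}

theorem mul_jacFam_congr (α : Fin m → Fin r → Fin N) {f g : Fin r → Euc N → ℝ}
    {ψ : Euc N → ℝ} (h : ∀ i, ∀ x ∈ tsupport ψ, f i =ᶠ[𝓝 x] g i) :
    (fun x => ψ x * jacFam (coordDir α) f x) = fun x => ψ x * jacFam (coordDir α) g x := by
  ext x
  by_cases hx : x ∈ tsupport ψ
  · rw [jacFam_coordDir, jacFam_coordDir]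
    congr 1
    refine Finset.sum_congr rfl fun τ _ => ?_
    congr 1
    exact Finset.prod_congr rfl fun k _ =>
      (pderivList_congr_of_eventuallyEq (h k x hx) _).self_of_nhds
  · rw [image_eq_zero_of_notMem_tsupport hx, zero_mul, zero_mul]

theorem integrable_mul_jacFam (α : Fin m → Fin r → Fin N) {Ω : Set (Euc N)} (hΩ : IsOpen Ω)
    {g : Fin r → Euc N → ℝ} (hg : ∀ i, ContDiffOn ℝ m (g i) Ω) {ψ : Euc N → ℝ}
    (hψ : Continuous ψ) (hψc : HasCompactSupport ψ) (hψΩ : tsupport ψ ⊆ Ω) :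
    Integrable fun x => ψ x * jacFam (coordDir α) g x := by
  choose f hf hfc hfg using fun i => exists_contDiff_eventuallyEq hΩ hψc hψΩ (hg i)
  rw [← mul_jacFam_congr α hfg]
  exact (hψ.mul (continuous_jacFam_coordDir α hf)).integrable_of_hasCompactSupport hψc.mul_right

theorem abs_le_toReal_mul_prod {I B e : ℝ} {X V W D : ℝ≥0∞} {E : Fin r → ℝ≥0∞} {S : Fin r → ℝ}
    (hX : X ≠ ⊤) (hVW : V ≤ W) (hW : W ≠ ⊤) (he : 0 ≤ e) (hD : D ≠ ⊤) (hB : 0 ≤ B)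
    (hS : ∀ i, 0 ≤ S i) (hE : ∀ i, E i ≤ D * ENNReal.ofReal (S i))
    (h : ENNReal.ofReal |I| ≤ X * ENNReal.ofReal B * V ^ e * ∏ i, E i) :
    |I| ≤ (X * W ^ e * D ^ r).toReal * B * ∏ i, S i := by
  have hA : X * W ^ e * D ^ r ≠ ⊤ :=
    ENNReal.mul_ne_top (ENNReal.mul_ne_top hX (ENNReal.rpow_ne_top_of_nonneg he hW))
      (ENNReal.pow_ne_top hD)
  have h1 : ENNReal.ofReal |I| ≤
      ENNReal.ofReal ((X * W ^ e * D ^ r).toReal * B * ∏ i, S i) := by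
    rw [ENNReal.ofReal_mul (by positivity), ENNReal.ofReal_mul (by positivity),
      ENNReal.ofReal_toReal hA, ENNReal.ofReal_prod_of_nonneg fun i _ => hS i]
    calc _ ≤ X * ENNReal.ofReal B * V ^ e * ∏ i, E i := h
      _ ≤ X * ENNReal.ofReal B * W ^ e * ∏ i, (D * ENNReal.ofReal (S i)) := by
        gcongr with i
        exact hE i
      _ = _ := by
        rw [Finset.prod_mul_distrib, Finset.prod_const, Finset.card_univ, Fintype.card_fin]
        ring
  exact (ENNReal.ofReal_le_ofReal_iff
    (mul_nonneg (by positivity) (Finset.prod_nonneg fun i _ => hS i))).1 h1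

theorem exists_cthickening_subset_isCompact {Ω : Set (Euc N)} (hΩ : IsOpen Ω) {T : Set (Euc N)}
    (hT : IsCompact T) (hTΩ : T ⊆ Ω) : ∃ δ > (0 : ℝ), IsCompact (Metric.cthickening δ T) ∧
      Metric.cthickening δ T ⊆ Ω := by
  obtain ⟨δ, hδ, h⟩ := hT.exists_cthickening_subset_open hΩ hTΩ
  exact ⟨δ, hδ, hT.cthickening, h⟩

theorem IsSmoothDomain.exists_local_bound_of_dvd {q : ℕ} (hq : 1 ≤ q)
    (hr1 : 1 ≤ r) (hrq : r ≤ q) (hd : q ∣ m) {Ω : Set (Euc N)} (hΩ : IsSmoothDomain Ω)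
    (α : Fin m → Fin r → Fin N) :
    ∃ C : ℝ, 0 ≤ C ∧ ∀ (w : Fin r → Euc N → Fin n → ℝ),
      (∀ i, ContDiffOn ℝ m (w i) (closure Ω)) → ∀ (β : Fin r → Fin n) (ψ : Euc N → ℝ),
      ContDiff ℝ m ψ → HasCompactSupport ψ → tsupport ψ ⊆ Ω → ∀ B : ℝ,
      (∀ l : List (Fin N), l.length ≤ m → ∀ x, |pderivList l ψ x| ≤ B) →
      |∫ x, ψ x * jacFam (coordDir α) (fun i y => w i y (β i)) x| ≤
        C * B * ∏ i, sobNorm Ω ((m : ℝ) - (m : ℝ) / q) q (w i) := by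
  obtain ⟨d, hd⟩ := hd
  obtain ⟨i, hi⟩ := exists_le_card_fiber (m := m) (d := d) hr1
    (by rw [hd]; exact Nat.mul_le_mul_right d hrq)
  have hdm : d ≤ m := by rw [hd]; exact Nat.le_mul_of_pos_left d (by omega)
  obtain ⟨C, hC0, hC⟩ := exists_intEnergy_rpow_le N n (s := m - d) hq
  have he : 0 ≤ ((q : ℝ) - r) / q :=
    div_nonneg (sub_nonneg.2 (by exact_mod_cast hrq)) (Nat.cast_nonneg _)
  refine ⟨((Fintype.card (Fin m → Equiv.Perm (Fin (r + 1))) : ℝ≥0∞) *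
    volume Ω ^ (((q : ℝ) - r) / q) * ENNReal.ofReal C ^ r).toReal, ENNReal.toReal_nonneg, fun w hw β ψ hψ hψc hψΩ B hB => ?_⟩
  have hB0 : 0 ≤ B := (abs_nonneg _).trans (hB [] (by simp) 0)
  obtain ⟨δ, hδ, hK, hKΩ⟩ := exists_cthickening_subset_isCompact hΩ.1 hψc hψΩ
  choose f hf hfc hfw using fun i => exists_contDiff_eventuallyEq hΩ.1 hK hKΩ
    (contDiffOn_pi.1 ((hw i).mono subset_closure) (β i))
  rw [← mul_jacFam_congr α (f := f) fun i x hx =>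
    hfw i x (Metric.self_subset_cthickening _ hx)]
  refine abs_le_toReal_mul_prod (D := ENNReal.ofReal C) (E := fun j => intEnergy _ _ q (f j) ^ _)
    (ENNReal.natCast_ne_top _) (measure_mono hKΩ)
    hΩ.2.1.measure_lt_top.ne he ENNReal.ofReal_ne_top hB0 (fun j => sobNorm_nonneg _ _ _ _)
    (fun j => ?_) (ofReal_abs_integral_jacFam_le_intEnergy hq hrq (Nat.sub_le m d) α i
    (fun k => by have := hi k; omega) hf hfc hψ hψc hδ hB hK subset_rfl)
  rw [← ENNReal.ofReal_mul hC0, sobNorm_eq_intSobNorm hq hd]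
  exact hC m (Nat.sub_le m d) Ω hΩ.1 hΩ.2.1 (w j) (hw j) (β j) (f j) _ hK.measurableSet hKΩ (hfw j)

theorem IsSmoothDomain.exists_local_bound_of_not_dvd {q : ℕ} (hN : 1 ≤ N) (hm : 1 ≤ m)
    (hq : 2 ≤ q) (hrq : r ≤ q) (hd : ¬ q ∣ m) {Ω : Set (Euc N)} (hΩ : IsSmoothDomain Ω)
    {x₀ : Euc N} (hx₀ : x₀ ∈ closure Ω) (α : Fin m → Fin r → Fin N) :
    ∃ ρ > (0 : ℝ), ∃ C : ℝ, 0 ≤ C ∧ ∀ (w : Fin r → Euc N → Fin n → ℝ),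
      (∀ i, ContDiffOn ℝ m (w i) (closure Ω)) → ∀ (β : Fin r → Fin n) (ψ : Euc N → ℝ),
      ContDiff ℝ m ψ → HasCompactSupport ψ → tsupport ψ ⊆ Ω ∩ Metric.ball x₀ ρ → ∀ B : ℝ,
      (∀ l : List (Fin N), l.length ≤ m → ∀ x, |pderivList l ψ x| ≤ B) →
      |∫ x, ψ x * jacFam (coordDir α) (fun i y => w i y (β i)) x| ≤
        C * B * ∏ i, sobNorm Ω ((m : ℝ) - (m : ℝ) / q) q (w i) := by
  obtain ⟨ρ, hρ, t₀, ht₀, e, ε, hε, hcone⟩ := hΩ.exists_cone hx₀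
  have hdm : m / q < m := Nat.div_lt_self hm hq
  have h1 := Nat.div_add_mod m q
  have h2 : 0 < m % q := Nat.pos_of_ne_zero fun h => hd (Nat.dvd_of_mod_eq_zero h)
  have h3 : m % q < q := Nat.mod_lt _ (by omega)
  have hsub : ∀ a < m, m - (m - a - 1) = a + 1 ∧ m - (m - a - 1) - 1 = a ∧ m - a - 1 < m := by
    intro a ha; omega
  obtain ⟨hk1, hk2, hkm⟩ := hsub _ hdm
  have hkq : (m - (m - m / q - 1) - 1) * q < m := by
    rw [hk2, mul_comm]; omega
  obtain ⟨b, hb0, hab⟩ : ∃ b, 0 < b ∧ N + (m / q + 1) * q = m + b := by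
    refine ⟨N + (q - m % q), by omega, ?_⟩
    have : (m / q + 1) * q = q * (m / q) + q := by ring
    omega
  have hab' : N + (m - (m - m / q - 1)) * q = m + b := by rw [hk1]; exact hab
  let φ : ContDiffBump e := ⟨ε / 2, ε, by positivity, by linarith⟩
  obtain ⟨C, hC, hmain⟩ := exists_ofReal_abs_integral_jacFam_le_dilEnergy hkm hkq
    (by omega) hrq α (φ := φ.normed volume) φ.contDiff_normed φ.hasCompactSupport_normed
    φ.integral_normed ht₀
  rw [φ.tsupport_normed_eq] at hmain
  have he : 0 ≤ ((q : ℝ) - r) / q :=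
    div_nonneg (sub_nonneg.2 (by exact_mod_cast hrq)) (Nat.cast_nonneg _)
  set R : ℝ := ‖e‖ + ε with hR
  have hR0 : 0 < R := by positivity
  have hRS : ∀ z ∈ Metric.closedBall e ε, ‖z‖ ≤ R := fun z hz => by
    have := norm_sub_norm_le z e
    rw [Metric.mem_closedBall, dist_eq_norm] at hz
    linarith
  set D : ℝ≥0∞ := (ENNReal.ofReal ((N ^ (m - m / q - 1) : ℕ) ^ q) *
    ENNReal.ofReal (R ^ b / b)) ^ (1 / (q : ℝ)) with hD
  refine ⟨ρ, hρ, (C * volume Ω ^ (((q : ℝ) - r) / q) * D ^ r).toReal, ENNReal.toReal_nonneg, fun w hw β ψ hψ hψc hψΩ B hB => ?_⟩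
  have hB0 : 0 ≤ B := (abs_nonneg _).trans (hB [] (by simp) 0)
  obtain ⟨δ, hδ, hK, hKΩ⟩ :=
    exists_cthickening_subset_isCompact (hΩ.1.inter Metric.isOpen_ball) hψc hψΩ
  set K := Metric.cthickening δ (tsupport ψ) with hKdef
  have hL : IsCompact ((fun p : Euc N × ℝ × Euc N => p.1 - p.2.1 • p.2.2) ''
      (K ×ˢ Set.Icc 0 t₀ ×ˢ Metric.closedBall e ε)) :=
    (hK.prod (isCompact_Icc.prod (isCompact_closedBall e ε))).image (by fun_prop)
  have hLΩ : (fun p : Euc N × ℝ × Euc N => p.1 - p.2.1 • p.2.2) ''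
      (K ×ˢ Set.Icc 0 t₀ ×ˢ Metric.closedBall e ε) ⊆ Ω := by
    rintro _ ⟨⟨x, t, z⟩, ⟨hx, ht, hz⟩, rfl⟩
    exact hcone x (hKΩ hx) z hz t ht
  have hKΩ' : K ⊆ Ω := hKΩ.trans Set.inter_subset_left
  choose f hf hfc hfw using fun i => exists_contDiff_eventuallyEq hΩ.1 (hK.union hL)
    (Set.union_subset hKΩ' hLΩ) (contDiffOn_pi.1 ((hw i).mono subset_closure) (β i))
  rw [← mul_jacFam_congr α (f := f) fun i x hx =>
    hfw i x (Or.inl (Metric.self_subset_cthickening _ hx))]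
  refine abs_le_toReal_mul_prod (D := D) hC (measure_mono hKΩ')
    hΩ.2.1.measure_lt_top.ne he (ENNReal.rpow_ne_top_of_nonneg (by positivity)
      (ENNReal.mul_ne_top ENNReal.ofReal_ne_top ENNReal.ofReal_ne_top))
    hB0 (fun j => sobNorm_nonneg _ _ _ _) (fun j => ?_)
    (hmain f hf hfc ψ hψ hψc δ hδ K hK subset_rfl B hB)
  have h4 := dilEnergy_le_gagEnergy hkm (by omega : 1 ≤ q) hb0 hab'
    Metric.isClosed_closedBall.measurableSet hR0 hRS t₀ hΩ.1 hK.measurableSet hKΩ'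
    (fun x hx t ht z hz => hcone x (hKΩ hx) z hz t ⟨ht.1.le, ht.2.le⟩)
    ((hw j).mono subset_closure) (β j) (f := f j) (fun x hx => hfw j x (Or.inl hx))
    (fun x hx t ht z hz => hfw j _ (Or.inr ⟨(x, t, z), ⟨hx, ⟨ht.1.le, ht.2.le⟩, hz⟩, rfl⟩))
  refine (ENNReal.rpow_le_rpow h4 (by positivity)).trans ?_
  rw [ENNReal.mul_rpow_of_nonneg _ _ (by positivity)]
  gcongr
  exact gagEnergy_rpow_le_sobNorm hN hm hq hd hab hΩ (hw j)

theorem IsSmoothDomain.exists_local_bound {q : ℕ} (hN : 1 ≤ N) (hm : 1 ≤ m)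
    (hq : 2 ≤ q) (hr1 : 1 ≤ r) (hrq : r ≤ q) {Ω : Set (Euc N)} (hΩ : IsSmoothDomain Ω)
    {x₀ : Euc N} (hx₀ : x₀ ∈ closure Ω) (α : Fin m → Fin r → Fin N) :
    ∃ ρ > (0 : ℝ), ∃ C : ℝ, 0 ≤ C ∧ ∀ (w : Fin r → Euc N → Fin n → ℝ),
      (∀ i, ContDiffOn ℝ m (w i) (closure Ω)) → ∀ (β : Fin r → Fin n) (ψ : Euc N → ℝ),
      ContDiff ℝ m ψ → HasCompactSupport ψ → tsupport ψ ⊆ Ω ∩ Metric.ball x₀ ρ → ∀ B : ℝ,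
      (∀ l : List (Fin N), l.length ≤ m → ∀ x, |pderivList l ψ x| ≤ B) →
      |∫ x, ψ x * jacFam (coordDir α) (fun i y => w i y (β i)) x| ≤
        C * B * ∏ i, sobNorm Ω ((m : ℝ) - (m : ℝ) / q) q (w i) := by
  by_cases hd : q ∣ m
  · obtain ⟨C, hC, h⟩ := hΩ.exists_local_bound_of_dvd (n := n) (by omega) hr1 hrq hd α
    exact ⟨1, one_pos, C, hC, fun w hw β ψ hψ hψc hψΩ =>
      h w hw β ψ hψ hψc (hψΩ.trans Set.inter_subset_left)⟩
  · exact hΩ.exists_local_bound_of_not_dvd hN hm hq hrq hd hx₀ α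

end LocalBound

section GlobalBound

variable {N n m r : ℕ}

theorem pderivList_eq_iteratedFDeriv {f : Euc N → ℝ} (hf : ContDiff ℝ m f) (l : List (Fin N))
    (hl : l.length ≤ m) (x : Euc N) :
    pderivList l f x = iteratedFDeriv ℝ l.length f x fun i => EuclideanSpace.single (l.get i) 1 := by
  induction l generalizing x with
  | nil => simp [pderivList]
  | cons i l ih =>
    have hl' : l.length + 1 ≤ m := by simpa using hl
    have h1 : pderivList l f = fun y =>
        iteratedFDeriv ℝ l.length f y (fun i => EuclideanSpace.single (l.get i) 1) :=
      funext fun y => ih (by omega) y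
    have h2 : DifferentiableAt ℝ (iteratedFDeriv ℝ l.length f) x :=
      hf.contDiffAt.differentiableAt_iteratedFDeriv (by exact_mod_cast hl')
    have h3 := h2.hasFDerivAt.continuousMultilinear_apply_const
      (fun i => (EuclideanSpace.single (l.get i) 1 : Euc N))
    simp only [pderivList, pderiv']
    rw [h1, h3.fderiv]
    simp only [List.length_cons]
    rw [iteratedFDeriv_succ_apply_left]
    rfl

theorem abs_pderivList_le_norm_iteratedFDeriv {f : Euc N → ℝ} (hf : ContDiff ℝ m f)
    (l : List (Fin N)) (hl : l.length ≤ m) (x : Euc N) :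
    |pderivList l f x| ≤ ‖iteratedFDeriv ℝ l.length f x‖ := by
  rw [pderivList_eq_iteratedFDeriv hf l hl]
  simpa using (iteratedFDeriv ℝ l.length f x).le_opNorm
    (fun i => (EuclideanSpace.single (l.get i) 1 : Euc N))

theorem supDm_nonneg (m : ℕ) (ψ : Euc N → ℝ) : 0 ≤ supDm m ψ :=
  Real.iSup_nonneg fun _ => norm_nonneg _

theorem norm_iteratedFDeriv_le_supDm {ψ : Euc N → ℝ} (hψ : ContDiff ℝ m ψ)
    (hψc : HasCompactSupport ψ) (x : Euc N) : ‖iteratedFDeriv ℝ m ψ x‖ ≤ supDm m ψ := by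
  obtain ⟨C, hC⟩ := (hψ.continuous_iteratedFDeriv le_rfl).bounded_above_of_compact_support
    (hψc.iteratedFDeriv m)
  exact le_ciSup (f := fun x => ‖iteratedFDeriv ℝ m ψ x‖) ⟨C, Set.forall_mem_range.2 hC⟩ x

theorem exists_norm_iteratedFDeriv_le_supDm (hN : 1 ≤ N) {Ω : Set (Euc N)}
    (hΩ : Bornology.IsBounded Ω) (m : ℕ) :
    ∃ L : ℝ, 0 ≤ L ∧ ∀ ψ : Euc N → ℝ, ContDiff ℝ m ψ → HasCompactSupport ψ → tsupport ψ ⊆ Ω →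
      ∀ j ≤ m, ∀ x, ‖iteratedFDeriv ℝ j ψ x‖ ≤ L * supDm m ψ := by
  have : Nonempty (Fin N) := ⟨⟨0, hN⟩⟩
  obtain ⟨R, hR⟩ := hΩ.exists_norm_le
  obtain ⟨y, hy⟩ := NormedSpace.exists_lt_norm ℝ (Euc N) R
  set L : ℝ := |R| + ‖y‖ + 1 with hL
  have hL1 : 1 ≤ L := by rw [hL]; linarith [abs_nonneg R, norm_nonneg y]
  refine ⟨L ^ m, by positivity, fun ψ hψ hψc hψΩ => ?_⟩
  have hA := supDm_nonneg m ψ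
  have key : ∀ d ≤ m, ∀ x, ‖iteratedFDeriv ℝ (m - d) ψ x‖ ≤ L ^ d * supDm m ψ := by
    intro d
    induction d with
    | zero => intro _ x; simpa using norm_iteratedFDeriv_le_supDm hψ hψc x
    | succ d ih =>
      intro hd x
      by_cases hx : x ∈ tsupport ψ
      · have hj : m - (d + 1) + 1 = m - d := by omega
        have h0 : iteratedFDeriv ℝ (m - (d + 1)) ψ y = 0 := by
          by_contra h
          have h2 := tsupport_iteratedFDeriv_subset (𝕜 := ℝ) (f := ψ) (m - (d + 1))
            (subset_tsupport _ h)
          exact absurd (hR y (hψΩ h2)) (not_le.2 hy)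
        have h1 := convex_univ.norm_image_sub_le_of_norm_fderiv_le (𝕜 := ℝ)
          (f := iteratedFDeriv ℝ (m - (d + 1)) ψ) (C := L ^ d * supDm m ψ) (x := y) (y := x)
          (fun z _ => hψ.contDiffAt.differentiableAt_iteratedFDeriv (by norm_cast; omega))
          (fun z _ => by
            rw [norm_fderiv_iteratedFDeriv, hj]
            exact ih (by omega) z) (Set.mem_univ _) (Set.mem_univ _)
        rw [h0, sub_zero] at h1
        refine h1.trans ?_
        have h3 : ‖x - y‖ ≤ L := by
          have := norm_sub_le x y
          have := (hR x (hψΩ hx)).trans (le_abs_self R)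
          linarith
        calc _ ≤ L ^ d * supDm m ψ * L := by gcongr
          _ = _ := by ring
      · have h0 : iteratedFDeriv ℝ (m - (d + 1)) ψ x = 0 := by
          by_contra h
          exact hx (tsupport_iteratedFDeriv_subset (𝕜 := ℝ) (f := ψ) (m - (d + 1))
            (subset_tsupport _ h))
        rw [h0, norm_zero]
        positivity
  intro j hj x
  have h1 := key (m - j) (Nat.sub_le m j) x
  rw [Nat.sub_sub_self hj] at h1
  refine h1.trans ?_
  gcongr
  exact Nat.sub_le m j

theorem exists_abs_pderivList_mul_le (hN : 1 ≤ N) {Ω : Set (Euc N)}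
    (hΩ : Bornology.IsBounded Ω) {χ : Euc N → ℝ} (hχ : ContDiff ℝ m χ)
    (hχc : HasCompactSupport χ) :
    ∃ L : ℝ, 0 ≤ L ∧ ∀ ψ : Euc N → ℝ, ContDiff ℝ m ψ → HasCompactSupport ψ → tsupport ψ ⊆ Ω →
      ∀ l : List (Fin N), l.length ≤ m → ∀ x,
        |pderivList l (fun y => χ y * ψ y) x| ≤ L * supDm m ψ := by
  obtain ⟨L, hL, h⟩ := exists_norm_iteratedFDeriv_le_supDm hN hΩ m
  have hb : ∀ j, ∃ M, j ≤ m → ∀ x, ‖iteratedFDeriv ℝ j χ x‖ ≤ M := by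
    intro j
    by_cases hj : j ≤ m
    · obtain ⟨M, hM⟩ := (hχ.continuous_iteratedFDeriv (m := j)
        (by exact_mod_cast hj)).bounded_above_of_compact_support (hχc.iteratedFDeriv j)
      exact ⟨M, fun _ => hM⟩
    · exact ⟨0, fun h => absurd h hj⟩
  choose M hM using hb
  have hM0 : ∀ j ≤ m, 0 ≤ M j := fun j hj => (norm_nonneg _).trans (hM j hj 0)
  refine ⟨∑ k ∈ Finset.range (m + 1), ∑ i ∈ Finset.range (k + 1), (k.choose i : ℝ) * M i * L,
    Finset.sum_nonneg fun k hk => Finset.sum_nonneg fun i hi => ?_, ?_⟩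
  · have := hM0 i (by simp only [Finset.mem_range] at hk hi; omega)
    positivity
  intro ψ hψ hψc hψΩ l hl x
  refine (abs_pderivList_le_norm_iteratedFDeriv (hχ.mul hψ) l hl x).trans ?_
  refine (norm_iteratedFDeriv_mul_le hχ hψ x (by exact_mod_cast hl)).trans ?_
  have hA := supDm_nonneg m ψ
  calc _ ≤ ∑ i ∈ Finset.range (l.length + 1), (l.length.choose i : ℝ) * M i * L * supDm m ψ := by
        refine Finset.sum_le_sum fun i hi => ?_
        have hi' : i ≤ m := by simp only [Finset.mem_range] at hi; omega
        have h1 := hM i hi' x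
        have h2 := h ψ hψ hψc hψΩ (l.length - i) (by omega) x
        have h3 := hM0 i hi'
        calc _ ≤ (l.length.choose i : ℝ) * M i * (L * supDm m ψ) := by gcongr
          _ = _ := by ring
    _ = (∑ i ∈ Finset.range (l.length + 1), (l.length.choose i : ℝ) * M i * L) * supDm m ψ := by
        rw [Finset.sum_mul]
    _ ≤ _ := by
        gcongr
        refine Finset.single_le_sum
          (f := fun k => ∑ i ∈ Finset.range (k + 1), (k.choose i : ℝ) * M i * L)
          (fun k hk => Finset.sum_nonneg fun i hi => ?_) (by simp; omega)
        have := hM0 i (by simp only [Finset.mem_range] at hk hi; omega)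
        positivity

theorem IsSmoothDomain.exists_global_bound {q : ℕ} (hN : 1 ≤ N) (hm : 1 ≤ m)
    (hq : 2 ≤ q) (hr1 : 1 ≤ r) (hrq : r ≤ q) {Ω : Set (Euc N)} (hΩ : IsSmoothDomain Ω)
    (α : Fin m → Fin r → Fin N) :
    ∃ C : ℝ, 0 ≤ C ∧ ∀ (w : Fin r → Euc N → Fin n → ℝ),
      (∀ i, ContDiffOn ℝ m (w i) (closure Ω)) → ∀ (β : Fin r → Fin n) (ψ : Euc N → ℝ),
      ContDiff ℝ m ψ → HasCompactSupport ψ → tsupport ψ ⊆ Ω →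
      |∫ x, ψ x * jacFam (coordDir α) (fun i y => w i y (β i)) x| ≤
        C * supDm m ψ * ∏ i, sobNorm Ω ((m : ℝ) - (m : ℝ) / q) q (w i) := by
  have hloc := fun x₀ : closure Ω =>
    hΩ.exists_local_bound (n := n) hN hm hq hr1 hrq x₀.2 α
  choose ρ hρ C hC hbd using hloc
  have hcpt : IsCompact (closure Ω) := hΩ.2.1.isCompact_closure
  obtain ⟨t, ht⟩ := hcpt.elim_finite_subcover (fun x : closure Ω => Metric.ball (x : Euc N) (ρ x))
    (fun _ => Metric.isOpen_ball)
    (fun x hx => Set.mem_iUnion.2 ⟨⟨x, hx⟩, Metric.mem_ball_self (hρ _)⟩)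
  obtain ⟨χ, hχ⟩ := SmoothPartitionOfUnity.exists_isSubordinate (modelWithCornersSelf ℝ (Euc N))
    hcpt.isClosed (fun x : t => Metric.ball (x.1 : Euc N) (ρ x.1)) (fun _ => Metric.isOpen_ball)
    (fun x hx => by
      obtain ⟨i, hi, hxi⟩ := Set.mem_iUnion₂.1 (ht hx)
      exact Set.mem_iUnion.2 ⟨⟨i, hi⟩, hxi⟩)
  have hχs : ∀ i, ContDiff ℝ m (χ i : Euc N → ℝ) := fun i =>
    (χ i).contMDiff.contDiff.of_le (by exact_mod_cast le_top)
  have hχc : ∀ i, HasCompactSupport (χ i : Euc N → ℝ) := fun i =>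
    (isCompact_closedBall (i.1 : Euc N) (ρ i.1)).of_isClosed_subset (isClosed_tsupport _)
      ((hχ i).trans Metric.ball_subset_closedBall)
  choose L hL hLb using fun i => exists_abs_pderivList_mul_le hN hΩ.2.1 (hχs i) (hχc i)
  refine ⟨∑ i, C i.1 * L i, Finset.sum_nonneg fun i _ => mul_nonneg (hC _) (hL i),
    fun w hw β ψ hψ hψc hψΩ => ?_⟩
  set g : Fin r → Euc N → ℝ := fun i y => w i y (β i) with hg
  set P : ℝ := ∏ i, sobNorm Ω ((m : ℝ) - (m : ℝ) / q) q (w i) with hP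
  have hts : ∀ i, tsupport (fun y => χ i y * ψ y) ⊆ Ω ∩ Metric.ball (i.1 : Euc N) (ρ i.1) :=
    fun i => Set.subset_inter ((tsupport_mul_subset_right).trans hψΩ)
      ((tsupport_mul_subset_left).trans (hχ i))
  have hcs : ∀ i, HasCompactSupport fun y => χ i y * ψ y := fun i => hψc.mul_left
  have hsplit : (fun x => ψ x * jacFam (coordDir α) g x) =
      fun x => ∑ i, (χ i x * ψ x) * jacFam (coordDir α) g x := by
    ext x
    by_cases hx : x ∈ tsupport ψ
    · have h1 := χ.sum_eq_one (subset_closure (hψΩ hx))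
      rw [finsum_eq_sum_of_fintype] at h1
      rw [← Finset.sum_mul, ← Finset.sum_mul, h1, one_mul]
    · simp [image_eq_zero_of_notMem_tsupport hx]
  have hint : ∀ i ∈ Finset.univ,
      Integrable fun x => (χ i x * ψ x) * jacFam (coordDir α) g x := fun i _ =>
    integrable_mul_jacFam α hΩ.1
      (fun k => contDiffOn_pi.1 ((hw k).mono subset_closure) (β k))
      ((hχs i).continuous.mul hψ.continuous) (hcs i) ((hts i).trans Set.inter_subset_left)
  rw [hsplit, integral_finsetSum _ hint]
  calc _ ≤ ∑ i, |∫ x, (χ i x * ψ x) * jacFam (coordDir α) g x| := Finset.abs_sum_le_sum_abs _ _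
    _ ≤ ∑ i, C i.1 * (L i * supDm m ψ) * P := Finset.sum_le_sum fun i _ =>
        hbd i.1 w hw β _ ((hχs i).mul hψ) (hcs i) (hts i) _ (hLb i ψ hψ hψc hψΩ)
    _ = _ := by
        rw [Finset.sum_mul, Finset.sum_mul]
        exact Finset.sum_congr rfl fun i _ => by ring

end GlobalBound

section Telescoping

variable {N n m r : ℕ}

/-- The `i`-th hybrid of two families: `b` before `i`, `c` at `i` and `a` after `i`. -/
def hybrid {X : Type*} {r : ℕ} (a b c : X) (i k : Fin r) : X :=
  if k < i then b else if k = i then c else a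

theorem prod_sub_prod_eq_sum_hybrid (a b : Fin r → ℝ) :
    ∏ k, a k - ∏ k, b k = ∑ i, ∏ k, hybrid (a k) (b k) (a k - b k) i k := by
  simp only [hybrid]
  induction r with
  | zero => simp
  | succ r ih =>
    simp only [Fin.prod_univ_succ, Fin.sum_univ_succ, Fin.succ_lt_succ_iff, Fin.not_lt_zero,
      Fin.succ_ne_zero, Fin.succ_pos, Fin.succ_inj, if_true, if_false]
    rw [← Finset.mul_sum, ← ih]
    ring

theorem pderivList_sub_component {Ω : Set (Euc N)} (hΩ : IsOpen Ω) {u v : Euc N → Fin n → ℝ}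
    (hu : ContDiffOn ℝ m u Ω) (hv : ContDiffOn ℝ m v Ω) (b : Fin n) (l : List (Fin N))
    (hl : l.length ≤ m) {x : Euc N} (hx : x ∈ Ω) :
    pderivList l (fun y => (u y - v y) b) x =
      pderivList l (fun y => u y b) x - pderivList l (fun y => v y b) x := by
  have hl' : ((l.length : ℕ) : WithTop ℕ∞) ≤ m := by exact_mod_cast hl
  rw [pderivList_component hΩ hu b l hl x hx, pderivList_component hΩ hv b l hl x hx,
    pderivList_component hΩ (hu.sub hv) b l hl x hx,
    fun_iteratedFDeriv_sub_apply ((hu.contDiffAt (hΩ.mem_nhds hx)).of_le hl')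
      ((hv.contDiffAt (hΩ.mem_nhds hx)).of_le hl')]
  rfl

theorem jacFam_sub_jacFam {Ω : Set (Euc N)} (hΩ : IsOpen Ω) {u v : Euc N → Fin n → ℝ}
    (hu : ContDiffOn ℝ m u Ω) (hv : ContDiffOn ℝ m v Ω) (α : Fin m → Fin r → Fin N)
    (β : Fin r → Fin n) {x : Euc N} (hx : x ∈ Ω) :
    jacFam (coordDir α) (fun k y => u y (β k)) x - jacFam (coordDir α) (fun k y => v y (β k)) x =
      ∑ i, jacFam (coordDir α)
        (fun k y => hybrid u v (fun z => u z - v z) i k y (β k)) x := by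
  simp only [jacFam_coordDir]
  rw [← Finset.sum_sub_distrib, Finset.sum_comm]
  refine Finset.sum_congr rfl fun τ _ => ?_
  rw [← mul_sub, prod_sub_prod_eq_sum_hybrid, Finset.mul_sum]
  refine Finset.sum_congr rfl fun i _ => ?_
  congr 1
  refine Finset.prod_congr rfl fun k _ => ?_
  simp only [hybrid]
  split_ifs
  · rfl
  · exact (pderivList_sub_component hΩ hu hv (β k) _ (by simp) hx).symm
  · rfl

theorem prod_hybrid_le {U V d : ℝ} (hU : 0 ≤ U) (hV : 0 ≤ V) (hd : 0 ≤ d) (i : Fin r) :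
    ∏ k, hybrid U V d i k ≤ d * (U ^ (r - 1) + V ^ (r - 1)) := by
  rw [← Finset.mul_prod_erase _ _ (Finset.mem_univ i)]
  have h1 : hybrid U V d i i = d := by simp [hybrid]
  have h2 : ∏ k ∈ Finset.univ.erase i, hybrid U V d i k ≤ max U V ^ (r - 1) := by
    have hc : (Finset.univ.erase i).card = r - 1 := by simp
    rw [← hc]
    rw [← Finset.prod_const]
    refine Finset.prod_le_prod (fun k _ => ?_) fun k hk => ?_
    · simp only [hybrid]
      split_ifs <;> assumption
    · simp only [hybrid, if_neg (Finset.ne_of_mem_erase hk)]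
      split_ifs
      exacts [le_max_right _ _, le_max_left _ _]
  rw [h1]
  gcongr
  refine h2.trans ?_
  rcases max_cases U V with ⟨h, -⟩ | ⟨h, -⟩ <;> rw [h]
  · exact le_add_of_nonneg_right (by positivity)
  · exact le_add_of_nonneg_left (by positivity)

theorem IsSmoothDomain.exists_abs_integral_sub_le {q : ℕ} (hN : 1 ≤ N) (hm : 1 ≤ m)
    (hq : 2 ≤ q) (hr1 : 1 ≤ r) (hrq : r ≤ q) {Ω : Set (Euc N)} (hΩ : IsSmoothDomain Ω)
    (α : Fin m → Fin r → Fin N) :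
    ∃ C : ℝ, 0 ≤ C ∧ ∀ (β : Fin r → Fin n) (u v : Euc N → Fin n → ℝ),
      ContDiffOn ℝ m u (closure Ω) → ContDiffOn ℝ m v (closure Ω) → ∀ ψ : Euc N → ℝ,
      ContDiff ℝ m ψ → HasCompactSupport ψ → tsupport ψ ⊆ Ω →
      |(∫ x in Ω, jacMinor m r β α u x * ψ x) - ∫ x in Ω, jacMinor m r β α v x * ψ x| ≤
        C * sobNorm Ω ((m : ℝ) - (m : ℝ) / q) q (fun x => u x - v x) *
          (sobNorm Ω ((m : ℝ) - (m : ℝ) / q) q u ^ (r - 1) +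
            sobNorm Ω ((m : ℝ) - (m : ℝ) / q) q v ^ (r - 1)) * supDm m ψ := by
  obtain ⟨C, hC, h⟩ := hΩ.exists_global_bound (n := n) hN hm hq hr1 hrq α
  refine ⟨r * C, by positivity, fun β u v hu hv ψ hψ hψc hψΩ => ?_⟩
  have hset : ∀ w : Euc N → Fin n → ℝ, ∫ x in Ω, jacMinor m r β α w x * ψ x =
      ∫ x, ψ x * jacFam (coordDir α) (fun k y => w y (β k)) x := by
    intro w
    rw [setIntegral_eq_integral_of_forall_compl_eq_zero fun x hx => by
      rw [image_eq_zero_of_notMem_tsupport fun hh => hx (hψΩ hh), mul_zero]]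
    congr 1
    ext x
    rw [jacMinor_eq_jacFam, mul_comm]
    rfl
  have huΩ := hu.mono subset_closure
  have hvΩ := hv.mono subset_closure
  have hw : ∀ i k : Fin r,
      ContDiffOn ℝ m (hybrid u v (fun z => u z - v z) i k) (closure Ω) := by
    intro i k
    simp only [hybrid]
    split_ifs
    exacts [hv, hu.sub hv, hu]
  have hint : ∀ w : Fin r → Euc N → Fin n → ℝ, (∀ k, ContDiffOn ℝ m (w k) (closure Ω)) →
      Integrable fun x => ψ x * jacFam (coordDir α) (fun k y => w k y (β k)) x := fun w hw =>
    integrable_mul_jacFam α hΩ.1 (fun k => contDiffOn_pi.1 ((hw k).mono subset_closure) (β k))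
      hψ.continuous hψc hψΩ
  rw [hset, hset, ← integral_sub (hint (fun _ => u) fun _ => hu) (hint (fun _ => v) fun _ => hv)]
  have hsum : (fun x => ψ x * jacFam (coordDir α) (fun k y => u y (β k)) x -
      ψ x * jacFam (coordDir α) (fun k y => v y (β k)) x) = fun x => ∑ i, ψ x *
        jacFam (coordDir α) (fun k y => hybrid u v (fun z => u z - v z) i k y (β k)) x := by
    ext x
    by_cases hx : x ∈ tsupport ψ
    · rw [← mul_sub, jacFam_sub_jacFam hΩ.1 huΩ hvΩ α β (hψΩ hx), Finset.mul_sum]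
    · simp [image_eq_zero_of_notMem_tsupport hx]
  rw [hsum, integral_finsetSum _ fun i _ => hint _ (hw i)]
  set S := fun w : Euc N → Fin n → ℝ => sobNorm Ω ((m : ℝ) - (m : ℝ) / q) q w with hS
  have hS0 : ∀ w, 0 ≤ S w := fun w => sobNorm_nonneg _ _ _ _
  change _ ≤ r * C * S (fun x => u x - v x) * (S u ^ (r - 1) + S v ^ (r - 1)) * supDm m ψ
  have hA := supDm_nonneg m ψ
  calc _ ≤ ∑ i, |∫ x, ψ x * jacFam (coordDir α)
          (fun k y => hybrid u v (fun z => u z - v z) i k y (β k)) x| :=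
        Finset.abs_sum_le_sum_abs _ _
    _ ≤ ∑ _i : Fin r, C * supDm m ψ *
          (S (fun x => u x - v x) * (S u ^ (r - 1) + S v ^ (r - 1))) := by
        refine Finset.sum_le_sum fun i _ => (h _ (hw i) β ψ hψ hψc hψΩ).trans ?_
        gcongr
        refine le_trans (le_of_eq ?_) (prod_hybrid_le (hS0 u) (hS0 v) (hS0 _) i)
        refine Finset.prod_congr rfl fun k _ => ?_
        simp only [hybrid]
        split_ifs <;> rfl
    _ = _ := by
        rw [Finset.sum_const, Finset.card_univ, Fintype.card_fin, nsmul_eq_mul]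
        ring

end Telescoping

/-- Lemma 3.2 / Theorem 1.1 estimate: for `2 ≤ q ≤ min{n,N}`, `1 ≤ r ≤ q`, there is a
constant `C = C(q,r,m,n,N,Ω)` such that for all `u, v ∈ C^m(Ω̄, ℝ^n)` and
`ψ ∈ C_c^m(Ω)`,
`|∫_Ω M^β_α(D^m u) ψ - ∫_Ω M^β_α(D^m v) ψ| ≤
  C ‖u-v‖_{W^{m-m/q,q}} (‖u‖^{r-1}_{W^{m-m/q,q}} + ‖v‖^{r-1}_{W^{m-m/q,q}}) ‖D^m ψ‖_∞`. -/
theorem stmt6 (N n m q : ℕ) (hN : 2 ≤ N) (hn : 1 ≤ n) (hm : 1 ≤ m)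
    (hq2 : 2 ≤ q) (hq : q ≤ min n N)
    (Ω : Set (Euc N)) (hΩ : IsSmoothDomain Ω)
    (r : ℕ) (hr1 : 1 ≤ r) (hrq : r ≤ q) :
    ∃ C : ℝ, 0 < C ∧
      ∀ (β : Fin r → Fin n), StrictMono β →
        ∀ (α : Fin m → Fin r → Fin N), (∀ j, StrictMono (α j)) →
          ∀ (u v : Euc N → Fin n → ℝ),
            ContDiffOn ℝ m u (closure Ω) → ContDiffOn ℝ m v (closure Ω) →
              ∀ (ψ : Euc N → ℝ), ContDiff ℝ (m : ℕ∞) ψ → HasCompactSupport ψ →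
                tsupport ψ ⊆ Ω →
                |(∫ x in Ω, jacMinor m r β α u x * ψ x) -
                    ∫ x in Ω, jacMinor m r β α v x * ψ x| ≤
                  C * sobNorm Ω ((m : ℝ) - (m : ℝ) / q) q (fun x => u x - v x) *
                    (sobNorm Ω ((m : ℝ) - (m : ℝ) / q) q u ^ (r - 1) +
                      sobNorm Ω ((m : ℝ) - (m : ℝ) / q) q v ^ (r - 1)) *
                    supDm m ψ := by
  choose K hK0 hK using fun α : Fin m → Fin r → Fin N =>
    hΩ.exists_abs_integral_sub_le (n := n) (by omega) hm hq2 hr1 hrq α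
  have hS : ∀ α, K α ≤ 1 + ∑ α, K α := fun α =>
    (Finset.single_le_sum (fun α _ => hK0 α) (Finset.mem_univ α)).trans (by linarith)
  refine ⟨1 + ∑ α, K α, by have := Finset.sum_nonneg fun α (_ : α ∈ Finset.univ) => hK0 α; linarith,
    fun β _ α _ u v hu hv ψ hψ hψc hψΩ => (hK α β u v hu hv ψ hψ hψc hψΩ).trans ?_⟩
  have h1 := sobNorm_nonneg Ω ((m : ℝ) - (m : ℝ) / q) q u
  have h2 := sobNorm_nonneg Ω ((m : ℝ) - (m : ℝ) / q) q v
  have h3 := sobNorm_nonneg Ω ((m : ℝ) - (m : ℝ) / q) q fun x => u x - v x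
  have h4 := supDm_nonneg m ψ
  gcongr
  exact hS α
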